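/- arXiv:1906.02237 — 2 statements merged into one kernel-verified Lean document; each statement's English description precedes it below -/
import Mathlib

section
/- Let Ω be a convex lattice domain such that X_Ω is tightly constrained with some lower bound r₀ ∈ ℤ≥0, and set λ := ℓ_Ω(∂Ω) (a positive integer, equal to twice the area of Ω). Then for every r ∈ {0, 1, …, λ−1} there exist an integer γ_r and x₀ ∈ ℤ≥0 such that for every integer x ≥ x₀ one has cap_{X_Ω}(r + λx) = #(xΩ ∩ ℤ²) + r·x + γ_r, where xΩ denotes the x-fold dilate of Ω. In particular, for each residue r the cap function r + λx ↦ cap_{X_Ω}(r + λx) eventually agrees with the Ehrhart polynomial of Ω plus the linear term r·x + γ_r. -/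
open scoped BigOperators Pointwise

noncomputable section

/-- Planar cross product `det(v,p) = v₁p₂ − v₂p₁`. -/
def det2 (v p : ℝ × ℝ) : ℝ := v.1 * p.2 - v.2 * p.1

/-- The `Ω`-length of a vector `v`: `max_{p ∈ Ω} det(v,p)`. -/
def omegaLen (Ω : Set (ℝ × ℝ)) (v : ℝ × ℝ) : ℝ := sSup (det2 v '' Ω)

/-- A (possibly degenerate) compact convex polygon with vertices listed in
clockwise order: a cyclic (period `n`) list of pairwise distinct vertices such
that the polygon (the convex hull of the vertices) lies in the right
half-plane of every directed edge. -/
structure ClockPolygon where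
  n : ℕ
  npos : 0 < n
  verts : ℕ → ℝ × ℝ
  periodic : ∀ i, verts (i + n) = verts i
  inj : ∀ i j, i < n → j < n → verts i = verts j → i = j
  clockwise : ∀ i, ∀ q ∈ convexHull ℝ (Set.range verts),
      det2 (verts (i + 1) - verts i) (q - verts i) ≤ 0

/-- The underlying point set of a polygon. -/
def ClockPolygon.body (P : ClockPolygon) : Set (ℝ × ℝ) :=
  convexHull ℝ (Set.range P.verts)

/-- The `Ω`-perimeter `ℓ_Ω(∂Λ)`: the sum of the `Ω`-lengths of the edge
vectors of `Λ`. -/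
def omegaPerim (Ω : Set (ℝ × ℝ)) (P : ClockPolygon) : ℝ :=
  ∑ i ∈ Finset.range P.n, omegaLen Ω (P.verts (i + 1) - P.verts i)

/-- Lattice points of the plane. -/
def IsLatticePt (p : ℝ × ℝ) : Prop := (∃ m : ℤ, p.1 = m) ∧ (∃ m : ℤ, p.2 = m)

/-- Rational points of the plane. -/
def IsRationalPt (p : ℝ × ℝ) : Prop := (∃ q : ℚ, p.1 = q) ∧ (∃ q : ℚ, p.2 = q)

/-- The number of lattice points in a set. -/
def latticeCount (S : Set (ℝ × ℝ)) : ℕ := {p ∈ S | IsLatticePt p}.ncard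

/-- Competitor convex lattice domains: convex hulls of finite nonempty sets of
lattice points in `ℝ≥0²`, containing the origin and closed under taking
coordinate rectangles. -/
def IsCompetitor (P : ClockPolygon) : Prop :=
  (∀ i, IsLatticePt (P.verts i)) ∧
  (∀ i, 0 ≤ (P.verts i).1 ∧ 0 ≤ (P.verts i).2) ∧
  (((0 : ℝ), (0 : ℝ)) ∈ P.body) ∧
  ∀ q ∈ P.body, Set.Icc (0 : ℝ) q.1 ×ˢ Set.Icc (0 : ℝ) q.2 ⊆ P.body

/-- ECH capacities of `X_Ω`, via Cristofaro-Gardiner's combinatorial formula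
(taken as a definition). -/
def echCap (Ω : Set (ℝ × ℝ)) (k : ℕ) : ℝ :=
  sInf { r | ∃ P : ClockPolygon, IsCompetitor P ∧
      latticeCount P.body = k + 1 ∧ omegaPerim Ω P = r }

/-- The cap function `cap_{X_Ω}(r) = #{k : c_k(X_Ω) ≤ r}`. -/
def capFn (Ω : Set (ℝ × ℝ)) (r : ℝ) : ℕ := {k : ℕ | echCap Ω k ≤ r}.ncard

/-- A convex domain: a convex polygon in `ℝ≥0²` with nonempty interior,
containing the origin and closed under taking coordinate rectangles. -/
structure ConvexDomain where
  P : ClockPolygon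
  int_nonempty : (interior P.body).Nonempty
  nonneg : ∀ q ∈ P.body, 0 ≤ q.1 ∧ 0 ≤ q.2
  zero_mem : (((0 : ℝ), (0 : ℝ)) ∈ P.body)
  rect : ∀ q ∈ P.body, Set.Icc (0 : ℝ) q.1 ×ˢ Set.Icc (0 : ℝ) q.2 ⊆ P.body

def ConvexDomain.body (Ω : ConvexDomain) : Set (ℝ × ℝ) := Ω.P.body

/-- A convex lattice domain: all vertices are lattice points. -/
def ConvexDomain.IsLattice (Ω : ConvexDomain) : Prop :=
  ∀ i, IsLatticePt (Ω.P.verts i)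

/-- A rational convex domain: all vertices are rational points. -/
def ConvexDomain.IsRational (Ω : ConvexDomain) : Prop :=
  ∀ i, IsRationalPt (Ω.P.verts i)

/-- `X_Ω` is tightly constrained with lower bound `r₀` if every integer
`r ≥ r₀` is a value `c_k(X_Ω)`. -/
def TightlyConstrained (Ω : ConvexDomain) (r₀ : ℕ) : Prop :=
  ∀ r : ℕ, r₀ ≤ r → ∃ k : ℕ, echCap Ω.body k = r

/-- Every (nonzero) edge of `Q` is parallel to an edge of `P`. -/
def EdgesParallel (Q P : ClockPolygon) : Prop :=
  ∀ i < Q.n, Q.verts (i + 1) - Q.verts i ≠ 0 →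
    ∃ j < P.n, ∃ t : ℝ, t ≠ 0 ∧
      Q.verts (i + 1) - Q.verts i = t • (P.verts (j + 1) - P.verts j)

/-- Euclidean inner product on the plane. -/
def dot2 (u p : ℝ × ℝ) : ℝ := u.1 * p.1 + u.2 * p.2

/-- The dual-norm value `max_{p ∈ K} u·p` (the support function of `K`). -/
def dualLen (K : Set (ℝ × ℝ)) (u : ℝ × ℝ) : ℝ := sSup (dot2 u '' K)

/-- The pseudonorm length `ℓ'_Ω(∂Λ)` with respect to a translated body `K`. -/
def dualPerim (K : Set (ℝ × ℝ)) (P : ClockPolygon) : ℝ :=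
  ∑ i ∈ Finset.range P.n, dualLen K (P.verts (i + 1) - P.verts i)




/-! ### Chains -/

def chX (w : List (ℕ × ℕ)) : ℕ := (w.map Prod.fst).sum
def chY (w : List (ℕ × ℕ)) : ℕ := (w.map Prod.snd).sum

def Good (w : List (ℕ × ℕ)) : Prop :=
  w.Pairwise (fun u v => v.1 * u.2 ≤ u.1 * v.2) ∧ ∀ u ∈ w, 0 < u.1 + u.2

def chV : List (ℕ × ℕ) → List (ℕ × ℕ)
  | [] => [(0, 0)]
  | u :: w => (0, u.2 + chY w) :: (chV w).map (fun q => (q.1 + u.1, q.2))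

def chE : List (ℕ × ℕ) → ℝ → ℝ → Prop
  | [], x, _ => x ≤ 0
  | u :: w, x, y => (u.1 : ℝ) * y + u.2 * x ≤ u.1 * (u.2 + chY w) ∧ chE w (x - u.1) y

def chH (w : List (ℕ × ℕ)) (x y : ℝ) : Prop := 0 ≤ x ∧ 0 ≤ y ∧ y ≤ chY w ∧ chE w x y

lemma chX_nil : chX [] = 0 := rfl
lemma chY_nil : chY [] = 0 := rfl
lemma chX_cons (u w) : chX (u :: w) = u.1 + chX w := by simp [chX]
lemma chY_cons (u w) : chY (u :: w) = u.2 + chY w := by simp [chY]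

lemma slope_trans {u v z : ℕ × ℕ} (hv : 0 < v.1 + v.2)
    (h1 : v.1 * u.2 ≤ u.1 * v.2) (h2 : z.1 * v.2 ≤ v.1 * z.2) : z.1 * u.2 ≤ u.1 * z.2 := by
  rcases Nat.eq_zero_or_pos v.1 with h | h
  · have hv2 : 0 < v.2 := by omega
    rw [h] at h2
    have : z.1 = 0 := by
      rcases Nat.eq_zero_or_pos z.1 with h' | h'
      · exact h'
      · have := Nat.mul_pos h' hv2; omega
    simp [this]
  · rcases Nat.eq_zero_or_pos v.2 with h' | h'
    · rw [h'] at h1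
      have : u.2 = 0 := by
        rcases Nat.eq_zero_or_pos u.2 with h'' | h''
        · exact h''
        · have := Nat.mul_pos h h''; omega
      simp [this]
    · have a1 : (z.1 * u.2) * (v.1 * v.2) ≤ (u.1 * z.2) * (v.1 * v.2) := by
        calc (z.1 * u.2) * (v.1 * v.2) = (v.1 * u.2) * (z.1 * v.2) := by ring
          _ ≤ (u.1 * v.2) * (v.1 * z.2) := Nat.mul_le_mul h1 h2
          _ = _ := by ring
      exact Nat.le_of_mul_le_mul_right a1 (Nat.mul_pos h h')

lemma Good.tail {u w} (h : Good (u :: w)) : Good w :=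
  ⟨(List.pairwise_cons.1 h.1).2, fun v hv => h.2 v (List.mem_cons_of_mem _ hv)⟩

lemma Good.nil : Good [] := ⟨List.Pairwise.nil, by simp⟩

lemma Good.cons {u w} (h : Good w) (hu : 0 < u.1 + u.2)
    (hh : ∀ v ∈ w, v.1 * u.2 ≤ u.1 * v.2) : Good (u :: w) :=
  ⟨List.pairwise_cons.2 ⟨hh, h.1⟩, by
    intro v hv; rcases List.mem_cons.1 hv with rfl | hv
    · exact hu
    · exact h.2 v hv⟩

lemma Good.cons_head {u w} (h : Good w) (hu : 0 < u.1 + u.2)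
    (hh : ∀ v w', w = v :: w' → v.1 * u.2 ≤ u.1 * v.2) : Good (u :: w) := by
  refine h.cons hu ?_
  cases w with
  | nil => simp
  | cons v w' =>
    have h0 := hh v w' rfl
    intro z hz
    rcases List.mem_cons.1 hz with rfl | hz
    · exact h0
    · exact slope_trans (h.2 v (by simp)) h0 ((List.pairwise_cons.1 h.1).1 z hz)

lemma Good.single {u : ℕ × ℕ} (hu : 0 < u.1 + u.2) : Good [u] := Good.nil.cons hu (by simp)

lemma chE_mono {w} : ∀ {x y x' y' : ℝ}, chE w x y → x' ≤ x → y' ≤ y → chE w x' y' := by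
  induction w with
  | nil => intro x y x' y' h hx hy; exact hx.trans h
  | cons u w ih =>
    intro x y x' y' h hx hy
    refine ⟨le_trans ?_ h.1, ih h.2 (by linarith) hy⟩
    have := mul_le_mul_of_nonneg_left hx (Nat.cast_nonneg (α := ℝ) u.2)
    have := mul_le_mul_of_nonneg_left hy (Nat.cast_nonneg (α := ℝ) u.1)
    linarith

lemma chE_convex {w} : ∀ {x y x' y' a b : ℝ}, chE w x y → chE w x' y' → 0 ≤ a → 0 ≤ b → a + b = 1 →
    chE w (a * x + b * x') (a * y + b * y') := by
  induction w with
  | nil =>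
    intro x y x' y' a b h h' ha hb hab
    simp only [chE] at *
    nlinarith
  | cons u w ih =>
    intro x y x' y' a b h h' ha hb hab
    refine ⟨?_, ?_⟩
    · have h1 := mul_le_mul_of_nonneg_left h.1 ha
      have h2 := mul_le_mul_of_nonneg_left h'.1 hb
      have : (u.1 : ℝ) * (u.2 + chY w) = a * (u.1 * (u.2 + chY w)) + b * (u.1 * (u.2 + chY w)) := by
        rw [← add_mul, hab, one_mul]
      rw [this]; linarith
    · have := ih h.2 h'.2 ha hb hab
      convert this using 1
      have : (u.1 : ℝ) = a * u.1 + b * u.1 := by rw [← add_mul, hab, one_mul]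
      linarith

lemma chH_convex (w) : Convex ℝ {p : ℝ × ℝ | chH w p.1 p.2} := by
  rintro ⟨x, y⟩ ⟨h1, h2, h3, h4⟩ ⟨x', y'⟩ ⟨k1, k2, k3, k4⟩ a b ha hb hab
  simp only at h1 h2 h3 h4 k1 k2 k3 k4
  refine ⟨?_, ?_, ?_, ?_⟩
  · simp; positivity
  · simp; positivity
  · simp only [Prod.smul_mk, Prod.mk_add_mk, smul_eq_mul]; nlinarith
  · simpa using chE_convex h4 k4 ha hb hab

lemma chE_le_X {w} : ∀ {x y : ℝ}, chE w x y → x ≤ chX w := by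
  induction w with
  | nil => intro x y h; simpa [chX, chE] using h
  | cons u w ih =>
    intro x y h
    have := ih h.2
    rw [chX_cons]; push_cast; linarith

lemma chE_left {w : List (ℕ × ℕ)} : ∀ {u : ℕ × ℕ} {x y : ℝ}, Good (u :: w) → x ≤ 0 →
    (u.1 : ℝ) * y + u.2 * x ≤ u.1 * chY w → chE w x y := by
  induction w with
  | nil => intro u x y _ hx _; exact hx
  | cons v w ih =>
    intro u x y hg hx h
    have hs : v.1 * u.2 ≤ u.1 * v.2 := (List.pairwise_cons.1 hg.1).1 v (by simp)
    have hs' : (v.1 : ℝ) * u.2 ≤ u.1 * v.2 := by exact_mod_cast hs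
    have hu := hg.2 u (by simp)
    have key : (v.1 : ℝ) * y + v.2 * x ≤ v.1 * (v.2 + chY w) := by
      rw [chY_cons] at h; push_cast at h
      rcases Nat.eq_zero_or_pos u.1 with h0 | h0
      · have hu2 : 0 < u.2 := by omega
        have : v.1 = 0 := by
          rcases Nat.eq_zero_or_pos v.1 with h' | h'
          · exact h'
          · have := Nat.mul_pos h' hu2; rw [h0] at hs; omega
        rw [this]; simp
        exact mul_nonpos_of_nonneg_of_nonpos (by positivity) hx
      · have h0' : (0 : ℝ) < u.1 := by exact_mod_cast h0
        have e1 := mul_le_mul_of_nonneg_left h (Nat.cast_nonneg (α := ℝ) v.1)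
        have e2 := mul_le_mul_of_nonpos_right hs' hx
        refine le_of_mul_le_mul_left ?_ h0'
        nlinarith
    refine ⟨key, ih hg.tail ?_ ?_⟩
    · have : (0 : ℝ) ≤ v.1 := by positivity
      linarith
    · nlinarith

lemma chE_right {w : List (ℕ × ℕ)} {u : ℕ × ℕ} {x y : ℝ} (hg : Good (u :: w)) (hx : 0 ≤ x)
    (hE : chE w x y) (hy : y ≤ chY w) : (u.1 : ℝ) * y + u.2 * x ≤ u.1 * chY w := by
  cases w with
  | nil =>
    have : x = 0 := le_antisymm hE hx
    subst this
    simp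
    have := mul_le_mul_of_nonneg_left hy (Nat.cast_nonneg (α := ℝ) u.1)
    linarith
  | cons v w =>
    have hs : v.1 * u.2 ≤ u.1 * v.2 := (List.pairwise_cons.1 hg.1).1 v (by simp)
    have hs' : (v.1 : ℝ) * u.2 ≤ u.1 * v.2 := by exact_mod_cast hs
    have hv := hg.2 v (by simp)
    have h1 := hE.1
    rw [chY_cons] at hy ⊢
    push_cast at hy ⊢
    rcases Nat.eq_zero_or_pos v.1 with h0 | h0
    · have hv2 : (0 : ℝ) < v.2 := by
        have : 0 < v.2 := by omega
        exact_mod_cast this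
      rw [h0] at h1
      have : x ≤ 0 := by
        by_contra hc
        push Not at hc
        have := mul_pos hv2 hc
        simp at h1
        linarith
      have : x = 0 := le_antisymm this hx
      subst this
      have := mul_le_mul_of_nonneg_left hy (Nat.cast_nonneg (α := ℝ) u.1)
      linarith
    · have h0' : (0 : ℝ) < v.1 := by exact_mod_cast h0
      have e1 := mul_le_mul_of_nonneg_left h1 (Nat.cast_nonneg (α := ℝ) u.1)
      have e2 := mul_le_mul_of_nonneg_right hs' hx
      refine le_of_mul_le_mul_left ?_ h0'
      nlinarith

lemma chV_fst_le {w} : ∀ q ∈ chV w, q.1 ≤ chX w ∧ q.2 ≤ chY w := by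
  induction w with
  | nil => simp [chV]
  | cons u w ih =>
    intro q hq
    rw [chX_cons, chY_cons]
    simp only [chV, List.mem_cons, List.mem_map] at hq
    rcases hq with rfl | ⟨p, hp, rfl⟩
    · simp
    · have := ih p hp
      simp only
      omega

lemma chV_first (w) : (0, chY w) ∈ chV w := by
  cases w with
  | nil => simp [chV, chY]
  | cons u w => simp [chV, chY_cons]

lemma chV_last (w) : (chX w, 0) ∈ chV w := by
  induction w with
  | nil => simp [chV, chX]
  | cons u w ih =>
    simp only [chV, List.mem_cons, List.mem_map]
    right
    exact ⟨_, ih, by simp [chX_cons, add_comm]⟩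

lemma chV_mem_E {w} (hg : Good w) : ∀ q ∈ chV w, chE w q.1 q.2 := by
  induction w with
  | nil => simp [chV, chE]
  | cons u w ih =>
    intro q hq
    simp only [chV, List.mem_cons, List.mem_map] at hq
    rcases hq with rfl | ⟨p, hp, rfl⟩
    · refine ⟨by push_cast; simp, chE_left hg ?_ ?_⟩
      · push_cast; simp
      · push_cast; nlinarith
    · have hE := ih hg.tail p hp
      refine ⟨?_, ?_⟩
      · have := chE_right hg (by positivity) hE (by exact_mod_cast (chV_fst_le p hp).2)
        push_cast; nlinarith
      · push_cast; simpa using hE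

lemma chV_mem_H {w} (hg : Good w) : ∀ q ∈ chV w, chH w q.1 q.2 := fun q hq =>
  ⟨by positivity, by positivity, by exact_mod_cast (chV_fst_le q hq).2, chV_mem_E hg q hq⟩

lemma chH_zero {w} (hg : Good w) : chH w 0 0 := by
  have h := chV_mem_H hg _ (chV_first w)
  exact ⟨le_rfl, le_rfl, by positivity, chE_mono h.2.2.2 (by simp) (by positivity)⟩

/-- the main hull principle -/
lemma chH_sub {K : Set (ℝ × ℝ)} (hK : Convex ℝ K)
    (hcol : ∀ p ∈ K, ∀ y, 0 ≤ y → y ≤ p.2 → (p.1, y) ∈ K) {w : List (ℕ × ℕ)} :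
    ∀ {s : ℝ}, Good w → (∀ q ∈ chV w, (s + (q.1 : ℝ), (q.2 : ℝ)) ∈ K) → ∀ {x y : ℝ}, chH w x y →
      (s + x, y) ∈ K := by
  induction w with
  | nil =>
    intro s _ hV x y ⟨h1, h2, h3, h4⟩
    have hx : x = 0 := le_antisymm h4 h1
    have hy : y = 0 := le_antisymm (by simpa [chY] using h3) h2
    have := hV (0, 0) (by simp [chV])
    simpa [hx, hy] using this
  | cons u w ih =>
    intro s hg hV x y ⟨h1, h2, h3, h4, h5⟩
    have hu := hg.2 u (by simp)
    have hV0 := hV (0, u.2 + chY w) (by simp [chV])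
    rw [chY_cons] at h3
    push_cast at h3
    rcases Nat.eq_zero_or_pos u.1 with h0 | h0
    · have hu2 : (0 : ℝ) < u.2 := by
        have : 0 < u.2 := by omega
        exact_mod_cast this
      have : x ≤ 0 := by
        by_contra hc
        push Not at hc
        have := mul_pos hu2 hc
        rw [h0] at h4
        simp at h4
        linarith
      have hx : x = 0 := le_antisymm this h1
      subst hx
      have := hcol _ hV0 y h2 (by push_cast; exact h3)
      simpa using this
    · have h0' : (0 : ℝ) < u.1 := by exact_mod_cast h0
      rcases le_total x u.1 with hx | hx
      · have hV1 : (s + (u.1 : ℝ), (chY w : ℝ)) ∈ K := by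
          have := hV (u.1, chY w) (by
            simp only [chV, List.mem_cons, List.mem_map]
            right
            exact ⟨_, chV_first w, by simp⟩)
          simpa using this
        have hr := hK hV0 hV1 (a := 1 - x / u.1) (b := x / u.1)
          (by rw [sub_nonneg, div_le_one h0']; exact hx) (by positivity) (by ring)
        have := hcol _ hr y h2 (by
          simp only [Prod.smul_mk, Prod.mk_add_mk, smul_eq_mul]
          push_cast
          have : y * u.1 ≤ ((1 - x / u.1) * (u.2 + chY w) + x / u.1 * chY w) * u.1 := by
            have e : ((1 - x / u.1) * (u.2 + chY w) + x / u.1 * chY w) * u.1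
              = u.1 * (u.2 + chY w) - u.2 * x := by
              field_simp
              ring
            rw [e]; linarith
          exact le_of_mul_le_mul_right this h0')
        convert this using 1
        simp only [Prod.smul_mk, Prod.mk_add_mk, smul_eq_mul]
        push_cast
        congr 1
        field_simp
        ring
      · have := ih (s := s + u.1) hg.tail (by
          intro q hq
          have := hV (q.1 + u.1, q.2) (by
            simp only [chV, List.mem_cons, List.mem_map]
            right
            exact ⟨q, hq, rfl⟩)
          convert this using 2
          push_cast; ring) (x := x - u.1) (y := y) ⟨by linarith, h2, ?_, h5⟩
        · convert this using 2
          ring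
        · refine le_of_mul_le_mul_left ?_ h0'
          have := mul_le_mul_of_nonneg_left hx (Nat.cast_nonneg (α := ℝ) u.2)
          linarith

lemma steeper {u v : ℕ × ℕ} (hu : 0 < u.1 + u.2) (hs : v.1 * u.2 ≤ u.1 * v.2) {a b : ℝ}
    (ha : 0 ≤ a) (hb : 0 ≤ b) (h : b * u.1 ≤ a * u.2) : b * v.1 ≤ a * v.2 := by
  have hs' : (v.1 : ℝ) * u.2 ≤ u.1 * v.2 := by exact_mod_cast hs
  rcases Nat.eq_zero_or_pos u.1 with h0 | h0
  · have hu2 : 0 < u.2 := by omega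
    have : v.1 = 0 := by
      rcases Nat.eq_zero_or_pos v.1 with h' | h'
      · exact h'
      · have := Nat.mul_pos h' hu2; rw [h0] at hs; omega
    rw [this]; simp; positivity
  · have h0' : (0 : ℝ) < u.1 := by exact_mod_cast h0
    refine le_of_mul_le_mul_left ?_ h0'
    have := mul_le_mul_of_nonneg_left hs' ha
    have := mul_le_mul_of_nonneg_left h (Nat.cast_nonneg (α := ℝ) v.1)
    linarith

def mSum (w : List (ℕ × ℕ)) (a b : ℝ) : ℝ := (w.map fun v => max (a * v.2) (b * v.1)).sum

lemma mSum_cons (v w a b) : mSum (v :: w) a b = max (a * v.2) (b * v.1) + mSum w a b := by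
  simp [mSum]

lemma mSum_nonneg {w a b} (ha : 0 ≤ a) : 0 ≤ mSum w a b := by
  apply List.sum_nonneg
  simp only [List.mem_map]
  rintro x ⟨v, _, rfl⟩
  exact le_max_of_le_left (by positivity)

lemma mSum_exists {w} (hg : Good w) {a b : ℝ} (ha : 0 ≤ a) (hb : 0 ≤ b) :
    ∃ q ∈ chV w, mSum w a b = a * q.2 + b * q.1 := by
  induction w with
  | nil => exact ⟨(0, 0), by simp [chV], by simp [mSum]⟩
  | cons u w ih =>
    rcases le_total (b * u.1) (a * u.2) with h | h
    · refine ⟨(0, u.2 + chY w), by simp [chV], ?_⟩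
      have : ∀ l : List (ℕ × ℕ), (∀ v ∈ l, b * v.1 ≤ a * v.2) → mSum l a b = a * chY l := by
        intro l hl
        induction l with
        | nil => simp [mSum, chY]
        | cons v l ihl =>
          rw [mSum_cons, chY_cons, ihl (fun z hz => hl z (by simp [hz])), max_eq_left (hl v (by simp))]
          push_cast; ring
      rw [this (u :: w)]
      · simp [chY_cons]
      · intro v hv
        rcases List.mem_cons.1 hv with rfl | hv
        · exact h
        · exact steeper (hg.2 u (by simp)) ((List.pairwise_cons.1 hg.1).1 v hv) ha hb h
    · obtain ⟨q, hq, e⟩ := ih hg.tail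
      refine ⟨(q.1 + u.1, q.2), ?_, ?_⟩
      · simp only [chV, List.mem_cons, List.mem_map]
        right
        exact ⟨q, hq, rfl⟩
      · rw [mSum_cons, max_eq_right h, e]; push_cast; ring

lemma chV_le_mSum {w} {a b : ℝ} (ha : 0 ≤ a) (hb : 0 ≤ b) :
    ∀ q ∈ chV w, a * q.2 + b * q.1 ≤ mSum w a b := by
  induction w with
  | nil => simp [chV, mSum]
  | cons u w ih =>
    intro q hq
    rw [mSum_cons]
    simp only [chV, List.mem_cons, List.mem_map] at hq
    rcases hq with rfl | ⟨p, hp, rfl⟩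
    · have := ih _ (chV_first w)
      have := le_max_left (a * u.2) (b * u.1)
      push_cast at *
      linarith
    · have := ih p hp
      have := le_max_right (a * u.2) (b * u.1)
      push_cast at *
      linarith

lemma chH_le_mSum {w} (hg : Good w) {a b : ℝ} (ha : 0 ≤ a) (hb : 0 ≤ b) {x y : ℝ}
    (h : chH w x y) : a * y + b * x ≤ mSum w a b := by
  have := chH_sub (K := {p : ℝ × ℝ | a * p.2 + b * p.1 ≤ mSum w a b}) ?_ ?_ (s := 0) hg ?_ h
  · simpa using this
  · rintro ⟨x, y⟩ h ⟨x', y'⟩ h' s t hs ht hst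
    simp only [Set.mem_setOf_eq, Prod.smul_mk, Prod.mk_add_mk, smul_eq_mul] at *
    have := mul_le_mul_of_nonneg_left h hs
    have := mul_le_mul_of_nonneg_left h' ht
    have : s * mSum w a b + t * mSum w a b = mSum w a b := by rw [← add_mul, hst, one_mul]
    linarith
  · rintro ⟨x, y⟩ h y' _ hy'
    simp only [Set.mem_setOf_eq] at *
    have := mul_le_mul_of_nonneg_left hy' ha
    linarith
  · intro q hq
    simpa using chV_le_mSum ha hb q hq



/-! ### Counting -/

def mx (u v : ℕ × ℕ) : ℕ := max (u.1 * v.2) (u.2 * v.1)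
lemma mx_comm (u v) : mx u v = mx v u := by
  unfold mx; rw [max_comm, mul_comm, mul_comm u.1]

def BN (w w' : List (ℕ × ℕ)) : ℕ := (w.map fun v => (w'.map (mx v)).sum).sum
def el (w : List (ℕ × ℕ)) : ℕ := (w.map fun v => v.1 + v.2 + Nat.gcd v.1 v.2).sum

lemma BN_cons_left (u w w') : BN (u :: w) w' = (w'.map (mx u)).sum + BN w w' := by simp [BN]
lemma BN_cons_right (u w w') : BN w (u :: w') = (w.map (mx u)).sum + BN w w' := by
  induction w with
  | nil => simp [BN]
  | cons v w ih =>
    rw [BN_cons_left, BN_cons_left, ih]; simp [mx_comm v u]; ring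
lemma BN_comm (w w') : BN w w' = BN w' w := by
  induction w with
  | nil => simp [BN]
  | cons v w ih => rw [BN_cons_left, BN_cons_right, ih]

lemma mSum_eq (w : List (ℕ × ℕ)) (v : ℕ × ℕ) : mSum w v.1 v.2 = ((w.map (mx v)).sum : ℕ) := by
  induction w with
  | nil => simp [mSum]
  | cons u w ih => rw [mSum_cons, ih]; simp [mx]

lemma BN_eq_mSum (w w') : (BN w w' : ℝ) = (w.map fun v => mSum w' v.1 v.2).sum := by
  induction w with
  | nil => simp [BN]
  | cons u w ih => rw [BN_cons_left]; push_cast; rw [ih, List.map_cons, List.sum_cons, mSum_eq]; push_cast; rfl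

def HN (w : List (ℕ × ℕ)) : Set (ℕ × ℕ) := {p | chH w p.1 p.2}
def cnt (w : List (ℕ × ℕ)) : ℕ := (HN w).ncard

lemma HN_finite (w) : (HN w).Finite := by
  apply Set.Finite.subset (Set.finite_Iic ((chX w, chY w) : ℕ × ℕ))
  rintro ⟨x, y⟩ ⟨h1, h2, h3, h4⟩
  have := chE_le_X h4
  refine ⟨?_, ?_⟩
  · simpa using this
  · simpa using h3

lemma card_dvd (c d : ℕ) (hc : 0 < c) :
    ((Finset.range c).filter (fun i => c ∣ d * i)).card = Nat.gcd c d := by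
  have hg : 0 < Nat.gcd c d := Nat.gcd_pos_of_pos_left _ hc
  obtain ⟨m, hm⟩ := Nat.gcd_dvd_left c d
  obtain ⟨e, he⟩ := Nat.gcd_dvd_right c d
  have hm0 : 0 < m := Nat.pos_of_ne_zero (by rintro rfl; omega)
  have hcop : Nat.Coprime m e := by
    have := Nat.coprime_div_gcd_div_gcd (m := c) (n := d) hg
    rwa [Nat.div_eq_of_eq_mul_right hg hm, Nat.div_eq_of_eq_mul_right hg he] at this
  set g := Nat.gcd c d with hgdef
  have : (Finset.range c).filter (fun i => c ∣ d * i) = (Finset.range g).image (fun i => m * i) := by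
    ext i
    simp only [Finset.mem_filter, Finset.mem_range, Finset.mem_image]
    have hiff : c ∣ d * i ↔ m ∣ i := by
      rw [hm, he, mul_assoc, Nat.mul_dvd_mul_iff_left hg]
      exact hcop.dvd_mul_left
    rw [hiff]
    constructor
    · rintro ⟨h1, k, rfl⟩
      refine ⟨k, ?_, rfl⟩
      rw [hm, mul_comm] at h1
      exact Nat.lt_of_mul_lt_mul_right (a := m) (by linarith)
    · rintro ⟨k, hk, rfl⟩
      refine ⟨?_, dvd_mul_right _ _⟩
      rw [hm, mul_comm]; exact Nat.mul_lt_mul_of_pos_right hk hm0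
  rw [this, Finset.card_image_of_injective, Finset.card_range]
  intro a b h
  exact Nat.eq_of_mul_eq_mul_left hm0 h

lemma pair_div (c d i : ℕ) (hc : 0 < c) (hi : i ≤ c) :
    d * (c - i) / c + d * i / c + 1 = d + if c ∣ d * i then 1 else 0 := by
  obtain ⟨j, rfl⟩ := Nat.exists_eq_add_of_le hi
  rw [Nat.add_sub_cancel_left]
  set c := i + j
  have e : d * j + d * i = d * c := by simp only [c]; ring
  have a1 := Nat.div_add_mod (d * i) c
  have a2 := Nat.div_add_mod (d * j) c
  have b1 := Nat.mod_lt (d * i) hc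
  have b2 := Nat.mod_lt (d * j) hc
  have key : c * (d * j / c + d * i / c) + ((d * i) % c + (d * j) % c) = c * d := by
    rw [mul_add]; linarith [mul_comm c d]
  have hd : c ∣ (d * i) % c + (d * j) % c := by
    rw [← Nat.dvd_add_right (Dvd.intro _ rfl : c ∣ c * (d * j / c + d * i / c)), key]
    exact Dvd.intro _ rfl
  obtain ⟨k, hk⟩ := hd
  rw [hk, ← mul_add] at key
  have key' := Nat.eq_of_mul_eq_mul_left hc key
  have hk2 : k < 2 := by
    by_contra h
    push Not at h
    have := Nat.mul_le_mul_left c h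
    omega
  split_ifs with h
  · have := Nat.mod_eq_zero_of_dvd h
    rw [this] at hk
    have : k = 0 := by
      by_contra h
      have : 1 ≤ k := by omega
      have := Nat.mul_le_mul_left c this
      omega
    omega
  · have : (d * i) % c ≠ 0 := fun h' => h (Nat.dvd_of_mod_eq_zero h')
    have : k ≠ 0 := by rintro rfl; omega
    omega

lemma tri_sum (c d : ℕ) (hc : 0 < c) :
    2 * ∑ i ∈ Finset.range c, (d * (c - i) / c + 1) = c * d + c + d + Nat.gcd c d := by
  have h1 : ∑ i ∈ Finset.range c, (d * (c - i) / c + d * i / c + 1) = c * d + Nat.gcd c d := by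
    rw [Finset.sum_congr rfl (fun i hi => pair_div c d i hc (Finset.mem_range.1 hi).le),
      Finset.sum_add_distrib, ← Finset.card_filter, card_dvd c d hc]
    simp
  have h2 : ∑ i ∈ Finset.range c, d * (c - i) / c = ∑ i ∈ Finset.range c, d * i / c + d := by
    have e1 := Finset.sum_range_succ (fun i => d * i / c) c
    have e2 := Finset.sum_range_succ' (fun i => d * (c - i) / c) c
    have e3 := Finset.sum_range_succ (fun i => d * (c - i) / c) c
    have e4 := Finset.sum_range_reflect (fun i => d * i / c) (c + 1)
    simp only [Nat.add_sub_cancel, Nat.sub_self, mul_zero, Nat.zero_div, add_zero] at *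
    rw [Nat.mul_div_cancel _ hc] at e1
    have : ∑ i ∈ Finset.range (c+1), d * (c - i) / c = ∑ i ∈ Finset.range (c+1), d * i / c := by
      rw [← e4]
    omega
  simp only [Finset.sum_add_distrib] at *
  simp only [Finset.sum_const, Finset.card_range, smul_eq_mul, mul_one] at *
  omega

lemma cnt_vert {w} (h : ∀ v ∈ w, v.1 = 0) (hg : Good w) : cnt w = chY w + 1 := by
  have : HN w = (fun j => ((0 : ℕ), j)) '' (Set.Iic (chY w)) := by
    have hX : chX w = 0 := by
      unfold chX
      apply List.sum_eq_zero
      simp only [List.mem_map]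
      rintro x ⟨v, hv, rfl⟩
      exact h v hv
    ext ⟨x, y⟩
    simp only [Set.mem_image, Set.mem_Iic, Prod.mk.injEq]
    constructor
    · rintro ⟨h1, h2, h3, h4⟩
      have := chE_le_X h4
      rw [hX] at this
      simp at this h3
      exact ⟨y, h3, this.symm, rfl⟩
    · rintro ⟨j, hj, rfl, rfl⟩
      refine ⟨by simp, by simp, by simpa using hj, ?_⟩
      exact chE_mono (chV_mem_E hg _ (chV_first w)) le_rfl (by simpa using hj)
  rw [cnt, this, Set.ncard_image_of_injective _ (Prod.mk_right_injective 0), Set.ncard_eq_toFinset_card']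
  simp

lemma HN_cons {u w} (hg : Good (u :: w)) (hc : 0 < u.1) : HN (u :: w) =
    {p | p.1 < u.1 ∧ u.1 * p.2 + u.2 * p.1 ≤ u.1 * (u.2 + chY w)} ∪
      (fun q : ℕ × ℕ => (q.1 + u.1, q.2)) '' HN w := by
  have hc' : (0 : ℝ) < u.1 := by exact_mod_cast hc
  ext ⟨x, y⟩
  simp only [Set.mem_union, Set.mem_image, Prod.mk.injEq, Prod.exists]
  constructor
  · rintro ⟨h1, h2, h3, h4, h5⟩
    by_cases hx : x < u.1
    · left
      exact ⟨hx, by exact_mod_cast h4⟩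
    · right
      push Not at hx
      obtain ⟨z, rfl⟩ := Nat.exists_eq_add_of_le hx
      refine ⟨z, y, ⟨by simp, by simp, ?_, ?_⟩, by ring, rfl⟩
      · refine le_of_mul_le_mul_left ?_ hc'
        simp only at *
        push_cast at h4
        have : (0 : ℝ) ≤ u.2 * z := by positivity
        linarith
      · convert h5 using 1
        push_cast; ring
  · rintro (⟨h1, h2⟩ | ⟨a, b, ⟨h1, h2, h3, h4⟩, rfl, rfl⟩)
    · simp only at h1 h2
      have h2' : (u.1 : ℝ) * y + u.2 * x ≤ u.1 * (u.2 + chY w) := by exact_mod_cast h2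
      refine ⟨by simp, by simp, ?_, h2', chE_left hg ?_ ?_⟩
      · rw [chY_cons]
        have : u.1 * y ≤ u.1 * (u.2 + chY w) := by linarith [Nat.zero_le (u.2 * x)]
        exact_mod_cast Nat.le_of_mul_le_mul_left this hc
      · have : (x : ℝ) < u.1 := by exact_mod_cast h1
        simp only; linarith
      · simp only; nlinarith
    · simp only at *
      refine ⟨by positivity, by positivity, ?_, ?_, ?_⟩
      · rw [chY_cons]; push_cast; linarith [Nat.cast_nonneg (α := ℝ) u.2]
      · have := chE_right hg h1 h4 h3
        push_cast; linarith
      · push_cast; simpa using h4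

lemma card_trap (c d Y : ℕ) (hc : 0 < c) :
    {p : ℕ × ℕ | p.1 < c ∧ c * p.2 + d * p.1 ≤ c * (d + Y)}.Finite ∧
    2 * {p : ℕ × ℕ | p.1 < c ∧ c * p.2 + d * p.1 ≤ c * (d + Y)}.ncard =
      2 * (c * Y) + c * d + c + d + Nat.gcd c d := by
  have : {p : ℕ × ℕ | p.1 < c ∧ c * p.2 + d * p.1 ≤ c * (d + Y)} =
    (((Finset.range c).sigma (fun i => Finset.range (Y + (d * (c - i) / c + 1)))).image
      (fun s => (s.1, s.2)) : Finset (ℕ × ℕ)) := by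
    ext ⟨x, y⟩
    simp only [Set.mem_setOf_eq, Finset.coe_image, Set.mem_image, Finset.mem_coe, Finset.mem_sigma,
      Finset.mem_range, Sigma.exists, Prod.mk.injEq]
    have key : x < c → (c * y + d * x ≤ c * (d + Y) ↔ y < Y + (d * (c - x) / c + 1)) := by
      intro hx
      obtain ⟨z, rfl⟩ := Nat.exists_eq_add_of_le hx.le
      rw [Nat.add_sub_cancel_left, ← add_assoc, Nat.lt_succ_iff, add_comm Y,
        ← Nat.add_mul_div_left _ _ hc, Nat.le_div_iff_mul_le hc]
      constructor
      · intro h; nlinarith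
      · intro h; nlinarith
    constructor
    · rintro ⟨h1, h2⟩
      exact ⟨x, y, ⟨h1, (key h1).1 h2⟩, rfl, rfl⟩
    · rintro ⟨a, b, ⟨h1, h2⟩, rfl, rfl⟩
      exact ⟨h1, (key h1).2 h2⟩
  rw [this]
  refine ⟨Finset.finite_toSet _, ?_⟩
  rw [Set.ncard_coe_finset, Finset.card_image_of_injective, Finset.card_sigma]
  · simp only [Finset.card_range]
    rw [Finset.sum_add_distrib, mul_add, tri_sum c d hc]
    simp; ring
  · rintro ⟨a, b⟩ ⟨a', b'⟩ h
    simp at h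
    simp [h.1, h.2]

lemma sum_mx_sorted {u : ℕ × ℕ} {w : List (ℕ × ℕ)} (h : ∀ v ∈ w, v.1 * u.2 ≤ u.1 * v.2) :
    (w.map (mx u)).sum = u.1 * chY w := by
  induction w with
  | nil => simp [chY]
  | cons v w ih =>
    rw [List.map_cons, List.sum_cons, ih (fun z hz => h z (by simp [hz])), chY_cons]
    have := h v (by simp)
    unfold mx
    rw [max_eq_left (by rw [mul_comm u.2]; exact this)]; ring

lemma BN_self_cons {u w} (hg : Good (u :: w)) :
    BN (u :: w) (u :: w) = u.1 * u.2 + 2 * (u.1 * chY w) + BN w w := by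
  rw [BN_cons_left, BN_cons_right, List.map_cons, List.sum_cons,
    sum_mx_sorted (List.pairwise_cons.1 hg.1).1]
  have : mx u u = u.1 * u.2 := by simp [mx, mul_comm]
  rw [this]; ring

lemma BN_vert {w w'} (h : ∀ v ∈ w, v.1 = 0) (h' : ∀ v ∈ w', v.1 = 0) : BN w w' = 0 := by
  unfold BN
  apply List.sum_eq_zero
  simp only [List.mem_map]
  rintro x ⟨v, hv, rfl⟩
  apply List.sum_eq_zero
  simp only [List.mem_map]
  rintro x ⟨v', hv', rfl⟩
  simp [mx, h v hv, h' v' hv']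

lemma el_cons (u w) : el (u :: w) = u.1 + u.2 + Nat.gcd u.1 u.2 + el w := by simp [el]

theorem cnt_eq {w} (hg : Good w) : 2 * cnt w = BN w w + el w + 2 := by
  induction w with
  | nil => rw [cnt_vert (by simp) hg]; simp [BN, el, chY]
  | cons u w ih =>
    rcases Nat.eq_zero_or_pos u.1 with h0 | h0
    · have hu2 : 0 < u.2 := by have := hg.2 u (by simp); omega
      have hv : ∀ v ∈ u :: w, v.1 = 0 := by
        intro v hv
        rcases List.mem_cons.1 hv with rfl | hv
        · exact h0
        · have := (List.pairwise_cons.1 hg.1).1 v hv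
          rw [h0] at this
          rcases Nat.eq_zero_or_pos v.1 with h' | h'
          · exact h'
          · have := Nat.mul_pos h' hu2; omega
      rw [cnt_vert hv hg, BN_vert hv hv]
      have : ∀ l : List (ℕ × ℕ), (∀ v ∈ l, v.1 = 0) → el l = 2 * chY l := by
        intro l hl
        induction l with
        | nil => simp [el, chY]
        | cons v l ih =>
          rw [el_cons, chY_cons, ih (fun z hz => hl z (by simp [hz])), hl v (by simp)]
          simp; ring
      rw [this _ hv]; ring
    · have hT := card_trap u.1 u.2 (chY w) h0
      have hd : Disjoint {p : ℕ × ℕ | p.1 < u.1 ∧ u.1 * p.2 + u.2 * p.1 ≤ u.1 * (u.2 + chY w)}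
          ((fun q : ℕ × ℕ => (q.1 + u.1, q.2)) '' HN w) := by
        rw [Set.disjoint_left]
        rintro p ⟨hp, _⟩ ⟨q, _, rfl⟩
        simp at hp
      have hinj : Function.Injective (fun q : ℕ × ℕ => (q.1 + u.1, q.2)) := by
        rintro ⟨a, b⟩ ⟨a', b'⟩ h
        simp at h
        simp [h]
      rw [cnt, HN_cons hg h0, Set.ncard_union_eq hd hT.1 ((HN_finite w).image _), mul_add, hT.2,
        Set.ncard_image_of_injective _ hinj]
      have := ih hg.tail
      rw [cnt] at this
      rw [this, BN_self_cons hg, el_cons]; ring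

/-! scaling -/

def scl (x : ℕ) (w : List (ℕ × ℕ)) : List (ℕ × ℕ) := w.map fun v => (x * v.1, x * v.2)

lemma chY_scl (x w) : chY (scl x w) = x * chY w := by
  induction w with
  | nil => simp [scl, chY]
  | cons u w ih => rw [scl, List.map_cons, ← scl, chY_cons, ih, chY_cons]; ring

lemma chE_scl {x : ℕ} (hx : 0 < x) (w) : ∀ (a b : ℝ), chE (scl x w) (x * a) (x * b) ↔ chE w a b := by
  have hx' : (0 : ℝ) < x := by exact_mod_cast hx
  induction w with
  | nil =>
    intro a b; simp only [scl, List.map_nil, chE]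
    constructor
    · intro h; by_contra hc; push Not at hc; have := mul_pos hx' hc; linarith
    · intro h; exact mul_nonpos_of_nonneg_of_nonpos hx'.le h
  | cons u w ih =>
    intro a b
    rw [scl, List.map_cons, ← scl]
    simp only [chE]
    rw [chY_scl]
    push_cast
    have e : (x : ℝ) * a - x * u.1 = x * (a - u.1) := by ring
    rw [e, ih]
    have e1 : (x : ℝ) * u.1 * (x * b) + x * u.2 * (x * a) = (x * x) * (u.1 * b + u.2 * a) := by ring
    have e2 : (x : ℝ) * u.1 * (x * u.2 + x * chY w) = (x * x) * (u.1 * (u.2 + chY w)) := by ring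
    rw [e1, e2, mul_le_mul_iff_right₀ (by positivity)]

lemma chH_scl {x : ℕ} (hx : 0 < x) (w) (a b : ℝ) : chH (scl x w) (x * a) (x * b) ↔ chH w a b := by
  have hx' : (0 : ℝ) < x := by exact_mod_cast hx
  unfold chH
  rw [chE_scl hx, chY_scl]
  push_cast
  rw [mul_le_mul_iff_right₀ hx', mul_nonneg_iff_of_pos_left hx', mul_nonneg_iff_of_pos_left hx']

lemma Good.scl {x : ℕ} (hx : 0 < x) {w} (h : Good w) : Good (scl x w) := by
  refine ⟨?_, ?_⟩
  · unfold _root_.scl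
    rw [List.pairwise_map]
    refine h.1.imp ?_
    intro u v h
    simp only
    have := Nat.mul_le_mul_left (x * x) h
    linarith
  · unfold _root_.scl
    simp only [List.mem_map]
    rintro u ⟨v, hv, rfl⟩
    have := Nat.mul_pos hx (h.2 v hv)
    simp only
    linarith

lemma BN_scl (x : ℕ) (w w') : BN (scl x w) (scl x w') = x * x * BN w w' := by
  have h1 : ∀ w w', BN (scl x w) w' = x * BN w w' := by
    intro w w'
    induction w with
    | nil => simp [scl, BN]
    | cons u w ih =>
      rw [scl, List.map_cons, ← scl, BN_cons_left, BN_cons_left, ih, mul_add, ← List.sum_map_mul_left]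
      congr 3
      funext v
      simp [mx, Nat.mul_max_mul_left, mul_assoc]
  rw [h1, BN_comm, h1, BN_comm]; ring

lemma el_scl (x : ℕ) (w) : el (scl x w) = x * el w := by
  induction w with
  | nil => simp [scl, el]
  | cons u w ih =>
    rw [scl, List.map_cons, ← scl, el_cons, el_cons, ih, Nat.gcd_mul_left]; ring

/-! merging -/

lemma exists_sorted (w : List (ℕ × ℕ)) (h : ∀ u ∈ w, 0 < u.1 + u.2) :
    ∃ w', Good w' ∧ w'.Perm w := by
  induction w with
  | nil => exact ⟨[], Good.nil, List.Perm.refl _⟩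
  | cons u w ih =>
    obtain ⟨w1, hg, hp⟩ := ih (fun v hv => h v (by simp [hv]))
    have hu := h u (by simp)
    suffices H : ∀ l : List (ℕ × ℕ), Good l → ∃ w', Good w' ∧ w'.Perm (u :: l) by
      obtain ⟨w', h1, h2⟩ := H w1 hg
      exact ⟨w', h1, h2.trans (hp.cons u)⟩
    intro l
    induction l with
    | nil => intro _; exact ⟨[u], Good.single hu, List.Perm.refl _⟩
    | cons v l ihl =>
      intro hl
      rcases le_total (v.1 * u.2) (u.1 * v.2) with hh | hh
      · refine ⟨u :: v :: l, hl.cons_head hu ?_, List.Perm.refl _⟩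
        rintro z w' he
        simp only [List.cons.injEq] at he
        rw [← he.1]; exact hh
      · obtain ⟨w', h1, h2⟩ := ihl hl.tail
        refine ⟨v :: w', h1.cons (hl.2 v (by simp)) ?_, ?_⟩
        · intro z hz
          rcases List.mem_cons.1 (h2.subset hz) with rfl | hz
          · rw [mul_comm, mul_comm v.1]; linarith
          · exact (List.pairwise_cons.1 hl.1).1 z hz
        · exact (h2.cons v).trans (List.Perm.swap _ _ _)

lemma BN_perm {w1 w2 : List (ℕ × ℕ)} (h : w1.Perm w2) (w') : BN w1 w' = BN w2 w' :=
  (h.map _).sum_eq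
lemma el_perm {w1 w2 : List (ℕ × ℕ)} (h : w1.Perm w2) : el w1 = el w2 := (h.map _).sum_eq
lemma BN_append (w1 w2 w') : BN (w1 ++ w2) w' = BN w1 w' + BN w2 w' := by simp [BN]
lemma el_append (w1 w2) : el (w1 ++ w2) = el w1 + el w2 := by simp [el]

lemma merge {w wo : List (ℕ × ℕ)} (hg : Good w) (ho : Good wo) : ∃ w', Good w' ∧
    BN w' wo = BN w wo + BN wo wo ∧ 2 * cnt w' = 2 * cnt w + 2 * BN w wo + BN wo wo + el wo := by
  obtain ⟨w', h1, h2⟩ := exists_sorted (w ++ wo) (by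
    intro u hu
    rcases List.mem_append.1 hu with hu | hu
    · exact hg.2 u hu
    · exact ho.2 u hu)
  refine ⟨w', h1, by rw [BN_perm h2, BN_append], ?_⟩
  rw [cnt_eq h1, cnt_eq hg, BN_perm h2, el_perm h2, BN_append, el_append, BN_comm w, BN_perm h2,
    BN_comm wo, BN_perm h2, BN_append, BN_append, BN_comm wo w]
  ring



/-! ### Hulls -/

lemma hull_fun : ∀ (W : ℕ) (h : ℕ → ℕ), (∀ x y, x ≤ y → y ≤ W → h y ≤ h x) →
    ∃ w, Good w ∧ chY w = h 0 ∧ (∀ q ∈ chV w, q.1 ≤ W ∧ q.2 ≤ h q.1) ∧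
      ∀ x : ℕ, x ≤ W → chE w x (h x) := by
  intro W
  induction W using Nat.strong_induction_on with
  | _ W ih =>
    intro h hh
    rcases Nat.eq_zero_or_pos W with h0 | h0
    · subst h0
      rcases Nat.eq_zero_or_pos (h 0) with h1 | h1
      · refine ⟨[], Good.nil, by rw [h1]; rfl, by simp [chV], ?_⟩
        intro x hx
        simpa [chE] using hx
      · refine ⟨[(0, h 0)], Good.single (by simpa using h1), by simp [chY], by simp [chV, chY], ?_⟩
        intro x hx
        have : x = 0 := by omega
        subst this
        simp [chE]
    · obtain ⟨m, hm, hmin⟩ := Finset.exists_min_image (Finset.Icc 1 W)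
        (fun x => ((h 0 : ℝ) - h x) / x) ⟨1, by simp; omega⟩
      rw [Finset.mem_Icc] at hm
      have hm0 : (0 : ℝ) < m := by exact_mod_cast hm.1
      have hhm := hh 0 m (by omega) hm.2
      have hmin' : ∀ z : ℕ, z ≤ W → ((h 0 : ℝ) - h m) * z ≤ ((h 0 : ℝ) - h z) * m := by
        intro z hz
        rcases Nat.eq_zero_or_pos z with hz0 | hz0
        · subst hz0; simp
        · have := hmin z (by rw [Finset.mem_Icc]; exact ⟨hz0, hz⟩)
          have hz0' : (0 : ℝ) < z := by exact_mod_cast hz0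
          rwa [div_le_div_iff₀ hm0 hz0'] at this
      obtain ⟨w, hg, hY, hV, hE⟩ := ih (W - m) (by omega) (fun x => h (m + x)) (by
        intro x y hxy hy
        exact hh _ _ (by omega) (by omega))
      simp only [add_zero] at hY
      have hgood : Good ((m, h 0 - h m) :: w) := by
        refine hg.cons_head (by simp; omega) ?_
        rintro v w' rfl
        have h1 := hV (v.1, chY w') (by
          simp only [chV, List.mem_cons, List.mem_map]
          right
          exact ⟨_, chV_first w', by simp⟩)
        rw [chY_cons] at hY
        have h2 := hmin' (m + v.1) (by have := h1.1; omega)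
        have h3 : (v.2 : ℝ) + chY w' = h m := by exact_mod_cast hY
        have h4 : (chY w' : ℝ) ≤ h (m + v.1) := by exact_mod_cast h1.2
        have : (v.1 : ℝ) * ((h 0 - h m : ℕ) : ℝ) ≤ m * v.2 := by
          push_cast [hhm] at *
          have := mul_le_mul_of_nonneg_left h4 hm0.le
          nlinarith
        exact_mod_cast this
      have hfirst : ∀ z : ℕ, z ≤ W → (m : ℝ) * h z + ((h 0 - h m : ℕ) : ℝ) * z ≤ m * h 0 := by
        intro z hz
        have := hmin' z hz
        push_cast [hhm]
        linarith
      refine ⟨(m, h 0 - h m) :: w, hgood, ?_, ?_, ?_⟩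
      · rw [chY_cons, hY]; simp only; omega
      · intro q hq
        simp only [chV, List.mem_cons, List.mem_map] at hq
        rcases hq with rfl | ⟨p, hp, rfl⟩
        · rw [hY]; simp only; omega
        · have := hV p hp
          refine ⟨by simp only; omega, ?_⟩
          simp only
          rw [add_comm]; exact this.2
      · intro x hx
        have e := hfirst x hx
        have e2 : ((h 0 - h m : ℕ) : ℝ) + h m = h 0 := by
          have : h 0 - h m + h m = h 0 := by omega
          exact_mod_cast this
        refine ⟨?_, ?_⟩
        · simp only [hY]; rw [e2]; exact e
        · rcases le_total m x with hmx | hmx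
          · obtain ⟨z, rfl⟩ := Nat.exists_eq_add_of_le hmx
            have := hE z (by omega)
            convert this using 1
            push_cast; ring
          · refine chE_left hgood ?_ ?_
            · have : (x : ℝ) ≤ m := by exact_mod_cast hmx
              simp only; linarith
            · simp only [hY]
              rw [← e2] at e
              linarith

lemma hull_set {S : Set (ℕ × ℕ)} (hf : S.Finite) (h0 : (0, 0) ∈ S)
    (hd : ∀ p ∈ S, ∀ q : ℕ × ℕ, q ≤ p → q ∈ S) :
    ∃ w, Good w ∧ (∀ q ∈ chV w, q ∈ S) ∧ ∀ p ∈ S, chH w p.1 p.2 := by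
  obtain ⟨⟨bX, bY⟩, hb⟩ := hf.bddAbove
  set A : Set ℕ := {x | (x, 0) ∈ S}
  have hA : BddAbove A := ⟨bX, fun x hx => (hb hx).1⟩
  have hW : (sSup A, 0) ∈ S := Nat.sSup_mem (s := A) ⟨0, h0⟩ hA
  set C : ℕ → Set ℕ := fun x => {y | (x, y) ∈ S}
  have hC : ∀ x, BddAbove (C x) := fun x => ⟨bY, fun y hy => (hb hy).2⟩
  have hmem : ∀ x, x ≤ sSup A → (x, sSup (C x)) ∈ S := fun x hx =>
    Nat.sSup_mem (s := C x) ⟨0, hd _ hW _ ⟨hx, le_rfl⟩⟩ (hC x)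
  obtain ⟨w, hg, hY, hV, hE⟩ := hull_fun (sSup A) (fun x => sSup (C x)) (by
    intro x y hxy hy
    exact le_csSup (hC x) (hd _ (hmem y hy) _ ⟨hxy, le_rfl⟩))
  refine ⟨w, hg, ?_, ?_⟩
  · intro q hq
    exact hd _ (hmem q.1 (hV q hq).1) _ ⟨le_rfl, (hV q hq).2⟩
  · intro p hp
    have h1 : p.1 ≤ sSup A := le_csSup hA (hd _ hp _ ⟨le_rfl, Nat.zero_le _⟩)
    have h2 : p.2 ≤ sSup (C p.1) := le_csSup (hC _) hp
    refine ⟨by positivity, by positivity, ?_, ?_⟩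
    · rw [hY]
      have : p.2 ≤ sSup (C 0) := le_csSup (hC 0) (hd _ hp (0, p.2) ⟨Nat.zero_le _, le_rfl⟩)
      exact_mod_cast this
    · exact chE_mono (hE p.1 h1) le_rfl (by exact_mod_cast h2)

lemma chH_mono {w} {x y x' y' : ℝ} (h : chH w x y) (hx0 : 0 ≤ x') (hy0 : 0 ≤ y') (hx : x' ≤ x)
    (hy : y' ≤ y) : chH w x' y' := ⟨hx0, hy0, hy.trans h.2.2.1, chE_mono h.2.2.2 hx hy⟩

lemma BN_mono {w w' wo} (hg : Good w) (hg' : Good w') (h : ∀ q ∈ chV w', chH w q.1 q.2) :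
    BN w' wo ≤ BN w wo := by
  rw [BN_comm w', BN_comm w]
  have : (BN wo w' : ℝ) ≤ BN wo w := by
    rw [BN_eq_mSum, BN_eq_mSum]
    apply List.sum_le_sum
    intro v _
    obtain ⟨q, hq, e⟩ := mSum_exists hg' (a := v.1) (b := v.2) (by positivity) (by positivity)
    rw [e]
    exact chH_le_mSum hg (by positivity) (by positivity) (h q hq)
  exact_mod_cast this

lemma chH_sub_chH {w w'} (hg : Good w) (hg' : Good w') (h : ∀ q ∈ chV w', chH w q.1 q.2) {x y : ℝ}
    (hxy : chH w' x y) : chH w x y := by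
  have := chH_sub (K := {p : ℝ × ℝ | chH w p.1 p.2}) (chH_convex w) (by
    intro p hp y hy hy'
    exact chH_mono hp hp.1 hy le_rfl hy') (s := 0) hg' (by
    intro q hq
    simpa using h q hq) hxy
  simpa using this

lemma lin_convex (a b t : ℝ) : Convex ℝ {p : ℝ × ℝ | a * p.2 + b * p.1 ≤ t} := by
  rintro ⟨x, y⟩ h ⟨x', y'⟩ h' s r hs hr hst
  simp only [Set.mem_setOf_eq, Prod.smul_mk, Prod.mk_add_mk, smul_eq_mul] at *
  have := mul_le_mul_of_nonneg_left h hs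
  have := mul_le_mul_of_nonneg_left h' hr
  have : s * t + r * t = t := by rw [← add_mul, hst, one_mul]
  linarith

lemma remove_one {w wo} (hg : Good w) (hc : 2 ≤ cnt w) :
    ∃ w', Good w' ∧ cnt w' + 1 = cnt w ∧ BN w' wo ≤ BN w wo := by
  have hfin := HN_finite w
  have h00 : ((0, 0) : ℕ × ℕ) ∈ HN w := by simpa [HN] using chH_zero hg
  obtain ⟨p, hp, hmax⟩ := Set.exists_max_image (HN w) (fun p => (chY w + 1) * p.1 + p.2) hfin ⟨_, h00⟩
  have hy : ∀ q ∈ HN w, q.2 ≤ chY w := fun q hq => by exact_mod_cast hq.2.2.1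
  have hne : ∀ q ∈ HN w, q ≠ p → (chY w + 1) * q.1 + q.2 < (chY w + 1) * p.1 + p.2 := by
    intro q hq hqp
    refine lt_of_le_of_ne (hmax q hq) ?_
    intro he
    apply hqp
    have a1 := hy q hq
    have a2 := hy p hp
    have e1 : q.1 = p.1 := by
      rcases lt_trichotomy q.1 p.1 with hl | hl | hl
      · have := Nat.mul_le_mul_left (chY w + 1) (Nat.succ_le_of_lt hl)
        rw [Nat.mul_succ] at this
        omega
      · exact hl
      · have := Nat.mul_le_mul_left (chY w + 1) (Nat.succ_le_of_lt hl)
        rw [Nat.mul_succ] at this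
        omega
    rw [e1] at he
    exact Prod.ext e1 (by omega)
  have hp0 : p ≠ (0, 0) := by
    rintro rfl
    have : HN w ⊆ {(0, 0)} := by
      intro q hq
      by_contra hc
      have := hne q hq hc
      simp at this
    have := Set.ncard_le_ncard this
    rw [Set.ncard_singleton] at this
    unfold cnt at hc
    omega
  obtain ⟨w', hg', hV, hS⟩ := hull_set (S := HN w \ {p}) (hfin.subset Set.diff_subset)
    ⟨h00, fun h => hp0 h.symm⟩ (by
      rintro r ⟨hr, hrp⟩ q hq
      refine ⟨?_, ?_⟩
      · exact chH_mono hr (by positivity) (by positivity) (by exact_mod_cast hq.1) (by exact_mod_cast hq.2)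
      · rintro rfl
        have h1 := hne r hr hrp
        have h2 := hq.1
        have h3 := hq.2
        have := Nat.mul_le_mul_left (chY w + 1) h2
        omega)
  refine ⟨w', hg', ?_, BN_mono hg hg' (fun q hq => (hV q hq).1)⟩
  have : HN w' = HN w \ {p} := by
    apply Set.Subset.antisymm
    · intro q hq
      refine ⟨chH_sub_chH hg hg' (fun q hq => (hV q hq).1) hq, ?_⟩
      rintro rfl
      have := chH_sub (K := {r : ℝ × ℝ | 1 * r.2 + (chY w + 1 : ℝ) * r.1 ≤ 
        (chY w + 1 : ℝ) * q.1 + q.2 - 1}) (lin_convex _ _ _) (by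
          intro r hr y _ hy
          simp only [Set.mem_setOf_eq] at *
          linarith) (s := 0) hg' (by
          intro r hr
          have := hne r (hV r hr).1 (hV r hr).2
          have : ((chY w : ℝ) + 1) * r.1 + r.2 + 1 ≤ (chY w + 1) * q.1 + q.2 := by exact_mod_cast this
          simp only [Set.mem_setOf_eq]
          linarith) hq
      simp only [Set.mem_setOf_eq] at this
      linarith
    · intro q hq
      exact hS q hq
  rw [cnt, this, cnt]
  exact Set.ncard_diff_singleton_add_one hp hfin

lemma remove_many {w wo} (hg : Good w) {k : ℕ} (hk : k + 1 ≤ cnt w) :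
    ∃ w', Good w' ∧ cnt w' = k + 1 ∧ BN w' wo ≤ BN w wo := by
  obtain ⟨m, hm⟩ := Nat.exists_eq_add_of_le hk
  induction m generalizing w with
  | zero => exact ⟨w, hg, by omega, le_rfl⟩
  | succ m ih =>
    obtain ⟨w1, h1, h2, h3⟩ := remove_one (wo := wo) hg (by omega)
    obtain ⟨w2, k1, k2, k3⟩ := ih h1 (by omega) (by omega)
    exact ⟨w2, k1, k2, k3.trans h3⟩



/-! ### Polygons from chains -/

def toR (p : ℕ × ℕ) : ℝ × ℝ := ((p.1 : ℝ), (p.2 : ℝ))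

lemma toR_inj : Function.Injective toR := by
  rintro ⟨a, b⟩ ⟨a', b'⟩ h
  simpa [toR] using h

lemma hull_eq {w} (hg : Good w) {V : Set (ℝ × ℝ)} (h1 : ∀ v ∈ V, chH w v.1 v.2)
    (h2 : ∀ q ∈ chV w, toR q ∈ convexHull ℝ V) (h0 : ((0 : ℝ), (0 : ℝ)) ∈ convexHull ℝ V) :
    convexHull ℝ V = {p : ℝ × ℝ | chH w p.1 p.2} := by
  apply Set.Subset.antisymm
  · exact convexHull_min h1 (chH_convex w)
  · have hK : Convex ℝ (convexHull ℝ V) := convex_convexHull ℝ V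
    have hbase : ∀ p ∈ convexHull ℝ V, (p.1, (0 : ℝ)) ∈ convexHull ℝ V := by
      have : convexHull ℝ V ⊆ {p : ℝ × ℝ | (p.1, (0 : ℝ)) ∈ convexHull ℝ V} := by
        apply convexHull_min
        · intro v hv
          have hX := h2 _ (chV_last w)
          have hh := h1 v hv
          have hx := chE_le_X hh.2.2.2
          rcases Nat.eq_zero_or_pos (chX w) with hz | hz
          · have : v.1 = 0 := by
              rw [hz] at hx
              exact le_antisymm (by simpa using hx) hh.1
            simpa [this] using h0
          · have hz' : (0 : ℝ) < chX w := by exact_mod_cast hz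
            have := hK h0 hX (a := 1 - v.1 / chX w) (b := v.1 / chX w)
              (by rw [sub_nonneg, div_le_one hz']; exact hx) (div_nonneg hh.1 hz'.le) (by ring)
            show (v.1, (0 : ℝ)) ∈ convexHull ℝ V
            convert this using 1
            simp [toR]
            field_simp
        · rintro ⟨x, y⟩ h ⟨x', y'⟩ h' s t hs ht hst
          have := hK h h' hs ht hst
          simpa using this
      exact this
    have hcol : ∀ p ∈ convexHull ℝ V, ∀ y, 0 ≤ y → y ≤ p.2 → (p.1, y) ∈ convexHull ℝ V := by
      intro p hp y hy hyp
      rcases eq_or_lt_of_le (hy.trans hyp) with hz | hz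
      · have : y = p.2 := le_antisymm hyp (by linarith)
        rw [this]; exact hp
      · have := hK (hbase p hp) hp (a := 1 - y / p.2) (b := y / p.2)
          (by rw [sub_nonneg, div_le_one hz]; exact hyp) (div_nonneg hy hz.le) (by ring)
        convert this using 1
        simp only [Prod.smul_mk, smul_eq_mul]
        ext
        · simp; ring
        · simp; field_simp
    intro p hp
    have := chH_sub hK hcol (s := 0) hg (by intro q hq; simpa [toR] using h2 q hq) hp
    simpa using this

def vtx : List (ℕ × ℕ) → ℕ → ℕ × ℕ
  | [], _ => (0, 0)
  | u :: w, 0 => (0, u.2 + chY w)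
  | u :: w, j + 1 => ((vtx w j).1 + u.1, (vtx w j).2)

lemma vtx_mem (w) : ∀ j, j ≤ w.length → vtx w j ∈ chV w := by
  induction w with
  | nil => intro j _; simp [vtx, chV]
  | cons u w ih =>
    intro j hj
    cases j with
    | zero => simp [vtx, chV]
    | succ j =>
      simp only [vtx, chV, List.mem_cons, List.mem_map]
      right
      exact ⟨_, ih j (by simpa using hj), rfl⟩

lemma mem_vtx (w) : ∀ q ∈ chV w, ∃ j, j ≤ w.length ∧ vtx w j = q := by
  induction w with
  | nil => simp [vtx, chV]
  | cons u w ih =>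
    intro q hq
    simp only [chV, List.mem_cons, List.mem_map] at hq
    rcases hq with rfl | ⟨p, hp, rfl⟩
    · exact ⟨0, by simp, rfl⟩
    · obtain ⟨j, hj, e⟩ := ih p hp
      exact ⟨j + 1, by simpa using hj, by simp [vtx, e]⟩

lemma vtx_zero (w) : vtx w 0 = (0, chY w) := by
  cases w with
  | nil => rfl
  | cons u w => simp [vtx, chY_cons]

lemma vtx_last (w) : vtx w w.length = (chX w, 0) := by
  induction w with
  | nil => rfl
  | cons u w ih => simp [vtx, ih, chX_cons, add_comm]

lemma vtx_step (w) : ∀ j (hj : j < w.length),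
    (vtx w (j + 1)).1 = (vtx w j).1 + (w[j]).1 ∧ (vtx w (j + 1)).2 + (w[j]).2 = (vtx w j).2 := by
  induction w with
  | nil => intro j hj; simp at hj
  | cons u w ih =>
    intro j hj
    cases j with
    | zero => simp [vtx, vtx_zero]; omega
    | succ j =>
      have := ih j (by simpa using hj)
      simp only [vtx, List.getElem_cons_succ]
      omega

lemma vtx_edge {w} : ∀ j (hj : j < w.length) {x y : ℝ}, chE w x y →
    ((w[j]).1 : ℝ) * (y - (vtx w j).2) + (w[j]).2 * (x - (vtx w j).1) ≤ 0 := by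
  induction w with
  | nil => intro j hj; simp at hj
  | cons u w ih =>
    intro j hj x y h
    cases j with
    | zero =>
      have := h.1
      simp [vtx]
      linarith
    | succ j =>
      have := ih j (by simpa using hj) h.2
      simp only [vtx, List.getElem_cons_succ]
      push_cast
      linarith

lemma vtx_strict {w} (hg : Good w) : ∀ j k, j < k → k ≤ w.length →
    (vtx w j).1 + (vtx w k).2 < (vtx w k).1 + (vtx w j).2 := by
  intro j k hjk hk
  induction k with
  | zero => omega
  | succ k ih =>
    have h1 := vtx_step w k (by omega)
    have h2 := hg.2 _ (List.getElem_mem (l := w) (n := k) (by omega))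
    rcases Nat.lt_succ_iff_lt_or_eq.1 hjk with h | h
    · have := ih h (by omega)
      omega
    · subst h; omega

lemma zero_chV {w} (hg : Good w) (h : (0, 0) ∈ chV w) : chX w = 0 ∨ chY w = 0 := by
  cases w with
  | nil => left; rfl
  | cons u w =>
    simp only [chV, List.mem_cons, List.mem_map] at h
    rcases h with h | ⟨p, hp, h⟩
    · right
      rw [chY_cons]
      simp only [Prod.mk.injEq] at h
      omega
    · left
      simp only [Prod.mk.injEq] at h
      have hu1 : u.1 = 0 := by omega
      have hu := hg.2 u (by simp)
      apply List.sum_eq_zero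
      simp only [List.mem_map]
      rintro x ⟨v, hv, rfl⟩
      rcases List.mem_cons.1 hv with rfl | hv
      · exact hu1
      · have := (List.pairwise_cons.1 hg.1).1 v hv
        rw [hu1] at this
        rcases Nat.eq_zero_or_pos v.1 with h' | h'
        · exact h'
        · have := Nat.mul_pos h' (show 0 < u.2 by omega); omega

lemma sum_edges (w) (f : ℝ × ℝ → ℝ) :
    ∑ j ∈ Finset.range w.length, f (toR (vtx w (j + 1)) - toR (vtx w j)) =
      (w.map fun v => f ((v.1 : ℝ), -(v.2 : ℝ))).sum := by
  induction w with
  | nil => simp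
  | cons u w ih =>
    rw [List.length_cons, Finset.sum_range_succ', List.map_cons, List.sum_cons, add_comm, ← ih]
    congr 1
    · congr 1
      simp [vtx, vtx_zero, toR]
    · apply Finset.sum_congr rfl
      intro j _
      congr 1
      simp [vtx, toR]

/-! omega lengths -/

lemma omegaLen_le {Ω : Set (ℝ × ℝ)} {wo} (hne : Ω.Nonempty) (hΩ : ∀ p ∈ Ω, chH wo p.1 p.2)
    (ho : Good wo) {a b : ℝ} (ha : 0 ≤ a) (hb : 0 ≤ b) : omegaLen Ω (a, -b) ≤ mSum wo a b := by
  apply csSup_le (hne.image _)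
  rintro _ ⟨p, hp, rfl⟩
  have := chH_le_mSum ho ha hb (hΩ p hp)
  simp only [det2]
  linarith

lemma omegaLen_nonpos {Ω : Set (ℝ × ℝ)} {wo} (hne : Ω.Nonempty) (hΩ : ∀ p ∈ Ω, chH wo p.1 p.2)
    {v : ℝ × ℝ} (h1 : v.1 ≤ 0) (h2 : 0 ≤ v.2) : omegaLen Ω v ≤ 0 := by
  apply csSup_le (hne.image _)
  rintro _ ⟨p, hp, rfl⟩
  have := hΩ p hp
  have := mul_nonneg h2 this.1
  have := mul_nonpos_of_nonpos_of_nonneg h1 (hΩ p hp).2.1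
  simp only [det2]
  linarith

lemma toR_lattice (p) : IsLatticePt (toR p) := ⟨⟨p.1, by simp [toR]⟩, ⟨p.2, by simp [toR]⟩⟩

lemma competitor_of {w} (hg : Good w) (P : ClockPolygon) (hl : ∀ i, ∃ p, P.verts i = toR p)
    (hb : P.body = {p : ℝ × ℝ | chH w p.1 p.2}) : IsCompetitor P := by
  refine ⟨?_, ?_, ?_, ?_⟩
  · intro i; obtain ⟨p, hp⟩ := hl i; rw [hp]; exact toR_lattice p
  · intro i; obtain ⟨p, hp⟩ := hl i; rw [hp]; simp [toR]
  · rw [hb]; exact chH_zero hg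
  · intro q hq r hr
    rw [hb] at hq ⊢
    exact chH_mono hq hr.1.1 hr.2.1 hr.1.2 hr.2.2

lemma lattice_cnt (w) : latticeCount {p : ℝ × ℝ | chH w p.1 p.2} = cnt w := by
  have : {p ∈ {p : ℝ × ℝ | chH w p.1 p.2} | IsLatticePt p} = toR '' HN w := by
    ext ⟨x, y⟩
    constructor
    · rintro ⟨h, ⟨m, hm⟩, ⟨n, hn⟩⟩
      simp only at hm hn
      subst hm hn
      have h1 : (0 : ℤ) ≤ m := by have : (0 : ℝ) ≤ (m : ℝ) := h.1; exact_mod_cast this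
      have h2 : (0 : ℤ) ≤ n := by have : (0 : ℝ) ≤ (n : ℝ) := h.2.1; exact_mod_cast this
      lift m to ℕ using h1
      lift n to ℕ using h2
      exact ⟨(m, n), by simpa [HN] using h, by simp [toR]⟩
    · rintro ⟨p, hp, e⟩
      rw [← e]
      exact ⟨hp, toR_lattice p⟩
  rw [latticeCount, this, Set.ncard_image_of_injective _ toR_inj, cnt]

theorem exists_poly {Ω : Set (ℝ × ℝ)} {wo} (hne : Ω.Nonempty) (hΩ : ∀ p ∈ Ω, chH wo p.1 p.2)
    (ho : Good wo) {w} (hg : Good w) :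
    ∃ P, IsCompetitor P ∧ latticeCount P.body = cnt w ∧ omegaPerim Ω P ≤ BN w wo := by
  suffices H : ∃ P : ClockPolygon, (∀ i, ∃ p, P.verts i = toR p) ∧
      P.body = {p : ℝ × ℝ | chH w p.1 p.2} ∧ omegaPerim Ω P ≤ BN w wo by
    obtain ⟨P, h1, h2, h3⟩ := H
    exact ⟨P, competitor_of hg P h1 h2, by rw [h2, lattice_cnt], h3⟩
  by_cases hdeg : chX w = 0 ∨ chY w = 0
  · have hcol : ∀ q : ℝ × ℝ, chH w q.1 q.2 → (chX w : ℝ) * q.2 - chY w * q.1 = 0 := by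
      intro q hq
      rcases hdeg with h | h
      · have h1 := chE_le_X hq.2.2.2
        rw [h] at h1 ⊢
        have : q.1 = 0 := le_antisymm (by simpa using h1) hq.1
        simp [this]
      · have h1 := hq.2.2.1
        rw [h] at h1 ⊢
        have : q.2 = 0 := le_antisymm (by simpa using h1) hq.2.1
        simp [this]
    have hXY : (chX w, chY w) ∈ chV w := by
      rcases hdeg with h | h
      · rw [h]; exact chV_first w
      · rw [h]; exact chV_last w
    by_cases hz : chX w = 0 ∧ chY w = 0
    · have hh := hull_eq hg (V := Set.range (fun _ : ℕ => toR (0, 0))) (by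
        rintro v ⟨i, rfl⟩; simpa [toR] using chH_zero hg) (by
        intro q hq
        have := chV_fst_le q hq
        have : q = (0, 0) := Prod.ext (by simp only; omega) (by simp only; omega)
        rw [this]
        exact subset_convexHull _ _ ⟨0, rfl⟩) (subset_convexHull _ _ ⟨0, by simp [toR]⟩)
      refine ⟨⟨1, one_pos, fun _ => toR (0, 0), fun _ => rfl, fun i j hi hj _ => by omega, ?_⟩,
        fun i => ⟨_, rfl⟩, hh, ?_⟩
      · intro i q hq
        simp [det2]
      · simp only [omegaPerim]
        have := omegaLen_nonpos hne hΩ (v := 0) (by simp) (by simp)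
        simp only [Finset.range_one, Finset.sum_singleton, sub_self]
        exact this.trans (by positivity)
    · have hh := hull_eq hg (V := Set.range (fun i : ℕ => if i % 2 = 0 then toR (0, 0) else
          toR (chX w, chY w))) (by
        rintro v ⟨i, rfl⟩
        dsimp only
        split_ifs
        · simpa [toR] using chH_zero hg
        · exact chV_mem_H hg _ hXY) (by
        intro q hq
        have hc := hcol (toR q) (chV_mem_H hg q hq)
        have hfl := chV_fst_le q hq
        have m0 : toR (0, 0) ∈ convexHull ℝ (Set.range (fun i : ℕ => if i % 2 = 0 then toR (0, 0) else
          toR (chX w, chY w))) := subset_convexHull _ _ ⟨0, by simp⟩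
        have m1 : toR (chX w, chY w) ∈ convexHull ℝ (Set.range (fun i : ℕ => if i % 2 = 0 then toR (0, 0) else
          toR (chX w, chY w))) := subset_convexHull _ _ ⟨1, by simp⟩
        have hpos : (0 : ℝ) < chX w + chY w := by
          have : 0 < chX w + chY w := by omega
          exact_mod_cast this
        have := convex_convexHull ℝ _ m0 m1 (a := 1 - ((q.1 + q.2 : ℝ) / (chX w + chY w)))
          (b := ((q.1 + q.2 : ℝ) / (chX w + chY w)))
          (by
            rw [sub_nonneg, div_le_one hpos]
            have : q.1 + q.2 ≤ chX w + chY w := by omega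
            exact_mod_cast this) (by positivity) (by ring)
        convert this using 1
        simp only [toR, Prod.smul_mk, smul_eq_mul, Prod.mk_add_mk] at hc ⊢
        ext
        · simp
          rw [div_mul_eq_mul_div, eq_div_iff hpos.ne']
          linarith
        · simp
          rw [div_mul_eq_mul_div, eq_div_iff hpos.ne']
          linarith) (subset_convexHull _ _ ⟨0, by simp [toR]⟩)
      refine ⟨⟨2, two_pos, fun i => if i % 2 = 0 then toR (0, 0) else toR (chX w, chY w),
        fun i => by simp, ?_, ?_⟩, ?_, hh, ?_⟩
      · intro i j hi hj h
        have hne' : toR (0, 0) ≠ toR (chX w, chY w) := by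
          intro h
          have := toR_inj h
          simp only [Prod.mk.injEq] at this
          omega
        interval_cases i <;> interval_cases j <;> simp at h ⊢
        · exact hne' h
        · exact hne' h.symm
      · intro i q hq
        rw [hh] at hq
        have := hcol q hq
        rcases Nat.mod_two_eq_zero_or_one i with hi | hi
        · have hi' : (i + 1) % 2 = 1 := by omega
          simp only [hi, hi']
          simp [det2, toR]
          linarith
        · have hi' : (i + 1) % 2 = 0 := by omega
          simp only [hi, hi']
          simp [det2, toR]
          linarith
      · intro i
        dsimp only
        split_ifs
        · exact ⟨_, rfl⟩
        · exact ⟨_, rfl⟩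
      · simp only [omegaPerim, Finset.sum_range_succ, Finset.sum_range_zero]
        norm_num
        rcases hdeg with h | h
        · rw [h]
          have e1 := omegaLen_nonpos hne hΩ (v := toR (0, chY w) - toR (0, 0)) (by simp [toR]) (by simp [toR])
          have e2 := omegaLen_le hne hΩ ho (a := 0) (b := chY w) le_rfl (by positivity)
          have e3 : toR (0, 0) - toR (0, chY w) = (0, -(chY w : ℝ)) := by simp [toR]
          rw [e3]
          have hY : 0 < chY w := by omega
          have e4 := BN_mono (wo := wo) hg (w' := [(0, chY w)]) (Good.single (by simpa using hY)) (by
            intro q hq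
            simp [chV, chY] at hq
            rcases hq with rfl | rfl
            · exact chV_mem_H hg _ (chV_first w)
            · simpa using chH_zero hg)
          have e5 : (BN [(0, chY w)] wo : ℝ) = mSum wo 0 (chY w) := by simp [BN_eq_mSum]
          have e4' : (BN [(0, chY w)] wo : ℝ) ≤ BN w wo := by exact_mod_cast e4
          linarith
        · rw [h]
          have e1 := omegaLen_nonpos hne hΩ (v := toR (0, 0) - toR (chX w, 0)) (by simp [toR]) (by simp [toR])
          have e2 := omegaLen_le hne hΩ ho (a := chX w) (b := 0) (by positivity) le_rfl
          have e3 : toR (chX w, 0) - toR (0, 0) = ((chX w : ℝ), -0) := by simp [toR]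
          rw [e3]
          have hY : 0 < chX w := by omega
          have e4 := BN_mono (wo := wo) hg (w' := [(chX w, 0)]) (Good.single (by simpa using hY)) (by
            intro q hq
            simp [chV, chY] at hq
            rcases hq with rfl | rfl
            · simpa using chH_zero hg
            · exact chV_mem_H hg _ (chV_last w))
          have e5 : (BN [(chX w, 0)] wo : ℝ) = mSum wo (chX w) 0 := by simp [BN_eq_mSum]
          have e4' : (BN [(chX w, 0)] wo : ℝ) ≤ BN w wo := by exact_mod_cast e4
          linarith
  · push Not at hdeg
    set N := w.length + 2 with hN
    set pt : ℕ → ℕ × ℕ := fun j => if j = 0 then (0, 0) else vtx w (j - 1) with hpt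
    have hpt0 : pt 0 = (0, 0) := rfl
    have hptS : ∀ j, pt (j + 1) = vtx w j := fun j => rfl
    have hptH : ∀ j, j < N → chH w (toR (pt j)).1 (toR (pt j)).2 := by
      intro j hj
      cases j with
      | zero => rw [hpt0]; simpa [toR] using chH_zero hg
      | succ j => rw [hptS]; exact chV_mem_H hg _ (vtx_mem w j (by omega))
    have hh := hull_eq hg (V := Set.range (fun i : ℕ => toR (pt (i % N)))) (by
      rintro v ⟨i, rfl⟩
      exact hptH _ (Nat.mod_lt _ (by omega))) (by
      intro q hq
      obtain ⟨j, hj, rfl⟩ := mem_vtx w q hq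
      refine subset_convexHull _ _ ⟨j + 1, ?_⟩
      dsimp only
      rw [Nat.mod_eq_of_lt (by omega), hptS]) (subset_convexHull _ _ ⟨0, by simp [toR, hpt0]⟩)
    refine ⟨⟨N, by omega, fun i => toR (pt (i % N)), fun i => by simp, ?_, ?_⟩, fun i => ⟨_, rfl⟩,
      hh, ?_⟩
    · intro i j hi hj h
      have h := toR_inj h
      rw [Nat.mod_eq_of_lt hi, Nat.mod_eq_of_lt hj] at h
      have hz : ∀ k, k ≤ w.length → vtx w k ≠ (0, 0) := by
        intro k hk he
        have := vtx_mem w k hk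
        rw [he] at this
        rcases zero_chV hg this with h | h
        · exact hdeg.1 h
        · exact hdeg.2 h
      rcases i with _ | i <;> rcases j with _ | j
      · rfl
      · rw [hpt0, hptS] at h
        exact absurd h.symm (hz j (by omega))
      · rw [hpt0, hptS] at h
        exact absurd h (hz i (by omega))
      · rw [hptS, hptS] at h
        rcases lt_trichotomy i j with hl | hl | hl
        · have := vtx_strict hg i j hl (by omega)
          rw [h] at this; omega
        · rw [hl]
        · have := vtx_strict hg j i hl (by omega)
          rw [h] at this; omega
    · intro i q hq
      rw [hh] at hq
      have hi := Nat.mod_lt i (show 0 < N by omega)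
      have hsucc : (i + 1) % N = (i % N + 1) % N := by simp
      rw [hsucc]
      generalize i % N = k at hi
      rcases k with _ | k
      · rw [Nat.mod_eq_of_lt (by omega), hpt0, hptS, vtx_zero]
        simp [det2, toR]
        have := mul_nonneg (Nat.cast_nonneg (α := ℝ) (chY w)) hq.1
        linarith
      · rcases Nat.lt_or_ge k w.length with hk | hk
        · rw [Nat.mod_eq_of_lt (by omega), hptS, hptS]
          have e := vtx_edge k hk hq.2.2.2
          have s := vtx_step w k hk
          have s1 : ((vtx w (k + 1)).1 : ℝ) = (vtx w k).1 + (w[k]).1 := by exact_mod_cast s.1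
          have s2 : ((vtx w (k + 1)).2 : ℝ) + (w[k]).2 = (vtx w k).2 := by exact_mod_cast s.2
          simp only [det2, toR, Prod.fst_sub, Prod.snd_sub]
          have d1 : ((vtx w (k + 1)).1 : ℝ) - (vtx w k).1 = (w[k]).1 := by linarith
          have d2 : ((vtx w (k + 1)).2 : ℝ) - (vtx w k).2 = -(w[k]).2 := by linarith
          rw [d1, d2]
          linarith
        · have : k = w.length := by omega
          subst this
          rw [hN, Nat.mod_self, hpt0, hptS, vtx_last]
          simp [det2, toR]
          exact mul_nonneg (by positivity) hq.2.1
    · simp only [omegaPerim]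
      rw [hN, Finset.sum_range_succ, Finset.sum_range_succ']
      have t1 : ∑ k ∈ Finset.range w.length, omegaLen Ω (toR (pt ((k + 1 + 1) % (w.length + 2))) -
          toR (pt ((k + 1) % (w.length + 2)))) = (w.map fun v => omegaLen Ω ((v.1 : ℝ), -(v.2 : ℝ))).sum := by
        rw [← sum_edges]
        apply Finset.sum_congr rfl
        intro k hk
        rw [Finset.mem_range] at hk
        rw [Nat.mod_eq_of_lt (by omega), Nat.mod_eq_of_lt (by omega), hptS, hptS]
      have t2 : (w.map fun v => omegaLen Ω ((v.1 : ℝ), -(v.2 : ℝ))).sum ≤ BN w wo := by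
        rw [BN_eq_mSum]
        apply List.sum_le_sum
        intro v _
        exact omegaLen_le hne hΩ ho (by positivity) (by positivity)
      rw [t1]
      have e1 := omegaLen_nonpos hne hΩ (v := toR (pt ((0 + 1) % (w.length + 2))) -
          toR (pt (0 % (w.length + 2)))) (by
          rw [Nat.mod_eq_of_lt (by omega), Nat.mod_eq_of_lt (by omega), hptS, hpt0, vtx_zero]; simp [toR]) (by
          rw [Nat.mod_eq_of_lt (by omega), Nat.mod_eq_of_lt (by omega), hptS, hpt0, vtx_zero]; simp [toR])
      have e2 := omegaLen_nonpos hne hΩ (v := toR (pt ((w.length + 1 + 1) % (w.length + 2))) -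
          toR (pt ((w.length + 1) % (w.length + 2)))) (by
          rw [Nat.mod_self, Nat.mod_eq_of_lt (by omega), hptS, hpt0, vtx_last]; simp [toR]) (by
          rw [Nat.mod_self, Nat.mod_eq_of_lt (by omega), hptS, hpt0, vtx_last]; simp [toR])
      linarith



/-! ### Competitors give chains -/

lemma range_finite (P : ClockPolygon) : (Set.range P.verts).Finite := by
  apply Set.Finite.subset ((Finset.range P.n).image P.verts).finite_toSet
  rintro _ ⟨i, rfl⟩
  simp only [Finset.coe_image, Set.mem_image, Finset.mem_coe, Finset.mem_range]
  refine ⟨i % P.n, Nat.mod_lt _ P.npos, ?_⟩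
  have : Function.Periodic P.verts P.n := P.periodic
  exact this.map_mod_nat i

lemma lattice_nonneg {p : ℝ × ℝ} (h : IsLatticePt p) (h1 : 0 ≤ p.1) (h2 : 0 ≤ p.2) :
    ∃ q, p = toR q := by
  obtain ⟨⟨m, hm⟩, n, hn⟩ := h
  rw [hm] at h1; rw [hn] at h2
  have h1' : 0 ≤ m := by exact_mod_cast h1
  have h2' : 0 ≤ n := by exact_mod_cast h2
  lift m to ℕ using h1'
  lift n to ℕ using h2'
  exact ⟨(m, n), Prod.ext (by simpa [toR] using hm) (by simpa [toR] using hn)⟩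

lemma exists_chain {P : ClockPolygon} (hP : IsCompetitor P) :
    ∃ w, Good w ∧ P.body = {p : ℝ × ℝ | chH w p.1 p.2} := by
  obtain ⟨h1, h2, h3, h4⟩ := hP
  have hv : ∀ i, ∃ q, P.verts i = toR q := fun i => lattice_nonneg (h1 i) (h2 i).1 (h2 i).2
  have hfin : {p : ℕ × ℕ | toR p ∈ P.body}.Finite := by
    have hb : Bornology.IsBounded P.body := isBounded_convexHull.2 (range_finite P).isBounded
    obtain ⟨R, hR⟩ := hb.exists_norm_le
    apply Set.Finite.subset (Set.finite_Iic ((⌊R⌋₊, ⌊R⌋₊) : ℕ × ℕ))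
    intro p hp
    have := hR _ hp
    rw [Prod.norm_def, max_le_iff] at this
    refine ⟨Nat.le_floor ?_, Nat.le_floor ?_⟩
    · have := this.1; rw [Real.norm_eq_abs] at this; exact (le_abs_self _).trans this
    · have := this.2; rw [Real.norm_eq_abs] at this; exact (le_abs_self _).trans this
  obtain ⟨w, hg, hV, hS⟩ := hull_set hfin (by simpa [toR] using h3) (by
    intro p hp q hq
    refine h4 _ hp ⟨⟨by simp [toR], ?_⟩, ⟨by simp [toR], ?_⟩⟩
    · have := hq.1; simpa [toR] using this
    · have := hq.2; simpa [toR] using this)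
  refine ⟨w, hg, Set.Subset.antisymm ?_ ?_⟩
  · apply convexHull_min _ (chH_convex w)
    rintro _ ⟨i, rfl⟩
    obtain ⟨q, hq⟩ := hv i
    rw [hq]
    apply hS q
    show toR q ∈ P.body
    rw [← hq]
    exact subset_convexHull _ _ ⟨i, rfl⟩
  · intro p hp
    have := chH_sub (K := P.body) (convex_convexHull ℝ _) (by
      intro r hr y hy hy'
      have hr1 : 0 ≤ r.1 := by
        have : P.body ⊆ {p : ℝ × ℝ | 0 ≤ p.1} := convexHull_min (by
          rintro _ ⟨i, rfl⟩; exact (h2 i).1) (convex_halfSpace_ge (IsLinearMap.mk (fun _ _ => rfl) (fun _ _ => rfl)) _)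
        exact this hr
      exact h4 r hr ⟨⟨hr1, le_rfl⟩, ⟨hy, hy'⟩⟩) (s := 0) hg (by
      intro q hq
      simpa [toR] using hV q hq) hp
    simpa using this

lemma exists_zero_vert {P : ClockPolygon} (hP : IsCompetitor P) : ∃ j, P.verts j = (0, 0) := by
  obtain ⟨h1, h2, h3, h4⟩ := hP
  by_contra hc
  push Not at hc
  have : P.body ⊆ {p : ℝ × ℝ | (-1) * p.2 + (-1) * p.1 ≤ -1} := by
    apply convexHull_min _ (lin_convex _ _ _)
    rintro _ ⟨i, rfl⟩
    obtain ⟨q, hq⟩ := lattice_nonneg (h1 i) (h2 i).1 (h2 i).2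
    have h := hc i
    rw [hq] at h ⊢
    have : 1 ≤ q.1 + q.2 := by
      by_contra hlt
      apply h
      have e1 : q.1 = 0 := by omega
      have e2 : q.2 = 0 := by omega
      simp [toR, e1, e2]
    have : (1 : ℝ) ≤ q.1 + q.2 := by exact_mod_cast this
    simp only [Set.mem_setOf_eq, toR]
    linarith
  have := this h3
  simp only [Set.mem_setOf_eq] at this
  norm_num at this

lemma sum_shift (f : ℕ → ℝ) (n : ℕ) (hf : ∀ i, f (i + n) = f i) (j : ℕ) :
    ∑ i ∈ Finset.range n, f (j + i) = ∑ i ∈ Finset.range n, f i := by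
  induction j with
  | zero => simp
  | succ j ih =>
    rw [← ih]
    have e1 := Finset.sum_range_succ (fun i => f (j + i)) n
    have e2 := Finset.sum_range_succ' (fun i => f (j + i)) n
    simp only [add_zero] at e1 e2
    rw [hf] at e1
    have : ∑ i ∈ Finset.range n, f (j + 1 + i) = ∑ i ∈ Finset.range n, f (j + (i + 1)) := by
      apply Finset.sum_congr rfl; intro i _; congr 1; ring
    linarith

lemma omegaLen_ge {Ω : Set (ℝ × ℝ)} {wo} (hΩ : Ω = {p : ℝ × ℝ | chH wo p.1 p.2})
    (ho : Good wo) (v : ℝ × ℝ) : mSum wo (max v.1 0) (max (-v.2) 0) ≤ omegaLen Ω v := by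
  obtain ⟨q, hq, e⟩ := mSum_exists ho (a := max v.1 0) (b := max (-v.2) 0) (le_max_right _ _) (le_max_right _ _)
  rw [e]
  have hqH := chV_mem_H ho q hq
  have hbdd : BddAbove (det2 v '' Ω) := by
    refine ⟨|v.1| * chY wo + |v.2| * chX wo, ?_⟩
    rintro _ ⟨p, hp, rfl⟩
    rw [hΩ] at hp
    have h1 := mul_le_mul (le_abs_self v.1) hp.2.2.1 hp.2.1 (abs_nonneg _)
    have h2 := mul_le_mul (neg_le_abs v.2) (chE_le_X hp.2.2.2) hp.1 (abs_nonneg _)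
    simp only [det2]
    linarith
  have hmem : ∀ p : ℝ × ℝ, chH wo p.1 p.2 → det2 v p ≤ omegaLen Ω v := fun p hp =>
    le_csSup hbdd ⟨p, by rw [hΩ]; exact hp, rfl⟩
  rcases le_total v.1 0 with h1 | h1 <;> rcases le_total (-v.2) 0 with h2 | h2
  · rw [max_eq_right h1, max_eq_right h2]
    have := hmem (0, 0) (chH_mono hqH le_rfl le_rfl hqH.1 hqH.2.1)
    simpa [det2] using this
  · rw [max_eq_right h1, max_eq_left h2]
    have := hmem (q.1, 0) (chH_mono hqH hqH.1 le_rfl le_rfl hqH.2.1)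
    simpa [det2] using this
  · rw [max_eq_left h1, max_eq_right h2]
    have := hmem (0, q.2) (chH_mono hqH le_rfl hqH.2.1 hqH.1 le_rfl)
    simpa [det2] using this
  · rw [max_eq_left h1, max_eq_left h2]
    have := hmem (q.1, q.2) hqH
    simp only [det2] at this
    linarith

lemma list_sum_swap (l : List (ℕ × ℕ)) (n : ℕ) (f : ℕ → ℕ × ℕ → ℝ) :
    ∑ i ∈ Finset.range n, (l.map (f i)).sum = (l.map fun v => ∑ i ∈ Finset.range n, f i v).sum := by
  induction l with
  | nil => simp
  | cons v l ih => simp [Finset.sum_add_distrib, ih]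

theorem BN_le_perim {Ω : Set (ℝ × ℝ)} {wo} (hΩ : Ω = {p : ℝ × ℝ | chH wo p.1 p.2})
    (ho : Good wo) {P : ClockPolygon} (hP : IsCompetitor P) {w} (hg : Good w)
    (hb : P.body = {p : ℝ × ℝ | chH w p.1 p.2}) : (BN w wo : ℝ) ≤ omegaPerim Ω P := by
  obtain ⟨j, hj⟩ := exists_zero_vert hP
  set e : ℕ → ℝ × ℝ := fun i => P.verts (i + 1) - P.verts i with he
  have h1 : ∑ i ∈ Finset.range P.n, mSum wo (max (e i).1 0) (max (-(e i).2) 0) ≤ omegaPerim Ω P :=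
    Finset.sum_le_sum (fun i _ => omegaLen_ge hΩ ho _)
  refine le_trans ?_ h1
  simp only [mSum]
  rw [list_sum_swap, BN_comm, BN_eq_mSum]
  apply List.sum_le_sum
  intro v _
  obtain ⟨q, hq, eq⟩ := mSum_exists hg (a := v.1) (b := v.2) (by positivity) (by positivity)
  rw [eq]
  have hqb : toR q ∈ P.body := by rw [hb]; exact chV_mem_H hg q hq
  set T := ∑ i ∈ Finset.range P.n, max (max (e i).1 0 * v.2) (max (-(e i).2) 0 * v.1) with hT
  have hsub : P.body ⊆ {p : ℝ × ℝ | (v.1 : ℝ) * p.2 + v.2 * p.1 ≤ T} := by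
    apply convexHull_min _ (lin_convex _ _ _)
    rintro _ ⟨k, rfl⟩
    have hper : Function.Periodic P.verts P.n := P.periodic
    -- write vertex k as j + m
    obtain ⟨m, hm, hk⟩ : ∃ m, m ≤ P.n ∧ P.verts k = P.verts (j + m) := by
      refine ⟨(k + (P.n * j) - j) % P.n, (Nat.mod_lt _ P.npos).le, ?_⟩
      have hle : j ≤ P.n * j := Nat.le_mul_of_pos_left _ P.npos
      rw [← hper.map_mod_nat k, ← hper.map_mod_nat (j + _)]
      congr 1
      rw [Nat.add_mod_mod]
      have : j + (k + P.n * j - j) = k + P.n * j := by omega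
      rw [this, Nat.add_mul_mod_self_left]
    have hT' : T = ∑ i ∈ Finset.range P.n, max (max (e (j + i)).1 0 * v.2) (max (-(e (j + i)).2) 0 * v.1) := by
      rw [hT]
      symm
      apply sum_shift (fun i => max (max (e i).1 0 * v.2) (max (-(e i).2) 0 * v.1))
      intro i
      have : e (i + P.n) = e i := by
        simp only [he]
        rw [P.periodic, show i + P.n + 1 = i + 1 + P.n by ring, P.periodic]
      rw [this]
    obtain ⟨m', hm'⟩ := Nat.exists_eq_add_of_le hm
    have s1 : ∑ i ∈ Finset.range m, e (j + i) = P.verts (j + m) - P.verts j :=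
      Finset.sum_range_sub (fun i => P.verts (j + i)) m
    have s2 : ∑ i ∈ Finset.range m', e (j + (m + i)) = P.verts j - P.verts (j + m) := by
      have := Finset.sum_range_sub (fun i => P.verts (j + (m + i))) m'
      simp only [add_zero] at this
      rw [← hm', P.periodic] at this
      exact this
    have t1 : (P.verts (j + m)).1 ≤ ∑ i ∈ Finset.range m, max (e (j + i)).1 0 := by
      have := congrArg Prod.fst s1
      rw [hj, Prod.fst_sum] at this
      simp only [Prod.fst_sub, sub_zero] at this
      rw [← this]
      exact Finset.sum_le_sum fun i _ => le_max_left _ _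
    have t2 : (P.verts (j + m)).2 ≤ ∑ i ∈ Finset.range m', max (-(e (j + (m + i))).2) 0 := by
      have := congrArg Prod.snd s2
      rw [hj, Prod.snd_sum] at this
      simp only [Prod.snd_sub, zero_sub] at this
      have h' : (P.verts (j + m)).2 = ∑ i ∈ Finset.range m', -(e (j + (m + i))).2 := by
        rw [Finset.sum_neg_distrib, this, neg_neg]
      rw [h']
      exact Finset.sum_le_sum fun i _ => le_max_left _ _
    show (v.1 : ℝ) * (P.verts k).2 + v.2 * (P.verts k).1 ≤ T
    rw [hT', hk]
    conv_rhs => rw [hm', Finset.sum_range_add]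
    have u1 : (v.2 : ℝ) * (P.verts (j + m)).1 ≤ ∑ i ∈ Finset.range m,
        max (max (e (j + i)).1 0 * v.2) (max (-(e (j + i)).2) 0 * v.1) := by
      refine (mul_le_mul_of_nonneg_left t1 (Nat.cast_nonneg _)).trans ?_
      rw [Finset.mul_sum]
      exact Finset.sum_le_sum fun i _ => by rw [mul_comm]; exact le_max_left _ _
    have u2 : (v.1 : ℝ) * (P.verts (j + m)).2 ≤ ∑ i ∈ Finset.range m',
        max (max (e (j + (m + i))).1 0 * v.2) (max (-(e (j + (m + i))).2) 0 * v.1) := by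
      refine (mul_le_mul_of_nonneg_left t2 (Nat.cast_nonneg _)).trans ?_
      rw [Finset.mul_sum]
      exact Finset.sum_le_sum fun i _ => by rw [mul_comm]; exact le_max_right _ _
    linarith
  exact hsub hqb



/-! ### The perimeter of the domain itself -/

lemma phase {wo} (n : ℕ) (p : ℕ → ℕ × ℕ)
    (hD : ∀ i, chH wo (p i).1 (p i).2)
    (hcw : ∀ i, ∀ q : ℝ × ℝ, chH wo q.1 q.2 → det2 (toR (p (i + 1)) - toR (p i)) (q - toR (p i)) ≤ 0)
    (hne : ∀ i, i < n → p (i + 1) ≠ p i) (h0 : p 0 = (0, 0)) (hn : p n = (0, 0)) (hnpos : 0 < n)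
    (hz : ∀ i, 0 < i → i < n → p i ≠ (0, 0)) {z : ℝ × ℝ} (hzD : chH wo z.1 z.2) (hz1 : 0 < z.1)
    (hz2 : 0 < z.2) (F : ℝ × ℝ → ℝ)
    (hF1 : ∀ a b : ℝ, 0 ≤ a → 0 ≤ b → F (a, -b) ≤ mSum wo a b)
    (hF2 : ∀ v : ℝ × ℝ, v.1 ≤ 0 → 0 ≤ v.2 → F v ≤ 0) :
    ∃ w, Good w ∧ (∀ q ∈ chV w, chH wo q.1 q.2) ∧
      ∑ i ∈ Finset.Ico 0 n, F (toR (p (i + 1)) - toR (p i)) ≤ BN w wo := by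
  have hcl : ∀ i, i < n →
      ((p i).1 = 0 ∧ (p (i + 1)).1 = 0 ∧ (p i).2 < (p (i + 1)).2) ∨
      ((p i).2 = 0 ∧ (p (i + 1)).2 = 0 ∧ (p (i + 1)).1 < (p i).1) ∨
      ((p i).1 ≤ (p (i + 1)).1 ∧ (p (i + 1)).2 ≤ (p i).2 ∧ 0 < (p i).2 ∧ 0 < (p (i + 1)).1) := by
    intro i hi
    have hd := hD i
    have hd' := hD (i + 1)
    have c1 := hcw i ((p i).1, 0) (chH_mono hd hd.1 le_rfl le_rfl hd.2.1)
    have c2 := hcw i (0, (p i).2) (chH_mono hd le_rfl hd.2.1 hd.1 le_rfl)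
    have c3 := hcw i ((p (i + 1)).1, 0) (chH_mono hd' hd'.1 le_rfl le_rfl hd'.2.1)
    have c4 := hcw i (0, (p (i + 1)).2) (chH_mono hd' le_rfl hd'.2.1 hd'.1 le_rfl)
    have c5 := hcw i z hzD
    have hne' := hne i hi
    have hnep : ¬ ((p (i + 1)).1 = (p i).1 ∧ (p (i + 1)).2 = (p i).2) := fun h => hne' (Prod.ext h.1 h.2)
    simp only [det2, toR, Prod.fst_sub, Prod.snd_sub] at c1 c2 c3 c4 c5
    generalize (p i).1 = a at *
    generalize (p i).2 = b at *
    generalize (p (i + 1)).1 = a' at *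
    generalize (p (i + 1)).2 = b' at *
    have ha0 : (0 : ℝ) ≤ a := by positivity
    have hb0 : (0 : ℝ) ≤ b := by positivity
    have ha0' : (0 : ℝ) ≤ a' := by positivity
    have hb0' : (0 : ℝ) ≤ b' := by positivity
    rcases lt_or_ge a' a with h1 | h1
    · right; left
      have h1' : (a' : ℝ) < a := by exact_mod_cast h1
      have hb : (b : ℝ) = 0 := by
        by_contra hc
        have : (0 : ℝ) < b := lt_of_le_of_ne hb0 (Ne.symm hc)
        nlinarith
      have hb' : (b' : ℝ) = 0 := by
        by_contra hc
        have : (0 : ℝ) < b' := lt_of_le_of_ne hb0' (Ne.symm hc)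
        rw [hb] at *
        nlinarith
      exact ⟨by exact_mod_cast hb, by exact_mod_cast hb', h1⟩
    · have h1' : (a : ℝ) ≤ a' := by exact_mod_cast h1
      rcases lt_or_ge b b' with h2 | h2
      · left
        have h2' : (b : ℝ) < b' := by exact_mod_cast h2
        have ha : (a : ℝ) = 0 := by
          by_contra hc
          have : (0 : ℝ) < a := lt_of_le_of_ne ha0 (Ne.symm hc)
          nlinarith
        have ha' : (a' : ℝ) = 0 := by
          by_contra hc
          have : (0 : ℝ) < a' := lt_of_le_of_ne ha0' (Ne.symm hc)
          rw [ha] at *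
          nlinarith
        exact ⟨by exact_mod_cast ha, by exact_mod_cast ha', h2⟩
      · right; right
        have h2' : (b' : ℝ) ≤ b := by exact_mod_cast h2
        refine ⟨h1, h2, ?_, ?_⟩
        · by_contra hc
          have e1 : b = 0 := by omega
          have e2 : b' = 0 := by omega
          subst e1 e2
          have : a < a' := by omega
          have : (a : ℝ) < a' := by exact_mod_cast this
          simp at c5
          have := mul_pos (sub_pos.2 this) hz2
          linarith
        · by_contra hc
          have e1 : a = 0 := by omega
          have e2 : a' = 0 := by omega
          subst e1 e2
          have : b' < b := by omega
          have : (b' : ℝ) < b := by exact_mod_cast this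
          simp at c5
          have := mul_pos (sub_pos.2 this) hz1
          linarith
  -- strong claim
  have strong : ∀ m i, i + m = n → 0 < i → ((p i).1 = 0 → i = n) →
      ∃ w, Good w ∧ chY w = (p i).2 ∧ ((p i).2 = 0 → w = []) ∧
      (∀ q ∈ chV w, chH wo ((p i).1 + q.1) q.2) ∧
      (∑ k ∈ Finset.Ico i n, F (toR (p (k + 1)) - toR (p k)) ≤ BN w wo) ∧
      ∀ v w', w = v :: w' → (p (i + 1)).1 = (p i).1 + v.1 ∧ (p (i + 1)).2 + v.2 = (p i).2 := by
    intro m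
    induction m with
    | zero =>
      intro i hi _ _
      have : i = n := by omega
      subst this
      refine ⟨[], Good.nil, by simp [hn, chY], by simp, ?_, by simp [BN], by simp⟩
      have := hD i
      rw [hn] at this ⊢
      simpa [chV] using this
    | succ m ih =>
      intro i hi hi0 hx
      have hin : i < n := by omega
      have hx' : (p i).1 ≠ 0 := fun h => by have := hx h; omega
      rw [Finset.sum_eq_sum_Ico_succ_bot hin]
      rcases hcl i hin with h | h | h
      · exact absurd h.1 hx'
      · obtain ⟨w, g1, g2, g3, g4, g5, g6⟩ := ih (i + 1) (by omega) (by omega) (by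
          intro hx0
          by_contra hc
          exact hz (i + 1) (by omega) (by omega) (Prod.ext hx0 h.2.1))
        have hw := g3 h.2.1
        subst hw
        refine ⟨[], Good.nil, by rw [h.1]; rfl, by simp, ?_, ?_, by simp⟩
        · intro q hq
          simp [chV] at hq
          subst hq
          have := hD i
          rw [h.1] at this
          simpa using this
        · have := hF2 (toR (p (i + 1)) - toR (p i)) (by
            have : ((p (i + 1)).1 : ℝ) < (p i).1 := by exact_mod_cast h.2.2
            simp [toR]; exact h.2.2.le) (by simp [toR, h.1, h.2.1])
          linarith
      · obtain ⟨w, g1, g2, g3, g4, g5, g6⟩ := ih (i + 1) (by omega) (by omega) (by omega)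
        obtain ⟨c, hc⟩ := Nat.exists_eq_add_of_le h.1
        obtain ⟨d, hd⟩ := Nat.exists_eq_add_of_le h.2.1
        have hcd : 0 < c + d := by
          by_contra hcon
          exact hne i hin (Prod.ext (by omega) (by omega))
        refine ⟨(c, d) :: w, g1.cons_head hcd ?_, ?_, by omega, ?_, ?_, ?_⟩
        · rintro v w' rfl
          have hv := g6 v w' rfl
          have hk := hcw i (toR (p (i + 1 + 1))) (hD _)
          simp only [det2, toR, Prod.fst_sub, Prod.snd_sub] at hk
          have r1 : ((p (i + 1)).1 : ℝ) = (p i).1 + c := by exact_mod_cast hc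
          have r2 : ((p i).2 : ℝ) = (p (i + 1)).2 + d := by exact_mod_cast hd
          have r3 : ((p (i + 1 + 1)).1 : ℝ) = (p (i + 1)).1 + v.1 := by exact_mod_cast hv.1
          have r4 : ((p (i + 1 + 1)).2 : ℝ) + v.2 = (p (i + 1)).2 := by exact_mod_cast hv.2
          have : (v.1 : ℝ) * d ≤ c * v.2 := by
            rw [r3, r1, r2, ← r4] at hk
            nlinarith
          exact_mod_cast this
        · rw [chY_cons, g2]; simp only; omega
        · intro q hq
          simp only [chV, List.mem_cons, List.mem_map] at hq
          rcases hq with rfl | ⟨r, hr, rfl⟩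
          · have := hD i
            rw [g2, add_comm d, ← hd]
            simpa using this
          · have := g4 r hr
            rw [hc] at this
            push_cast at this ⊢
            convert this using 1
            ring
        · rw [BN_cons_left, Nat.cast_add, ← mSum_eq]
          have := hF1 c d (by positivity) (by positivity)
          have e : toR (p (i + 1)) - toR (p i) = ((c : ℝ), -(d : ℝ)) := by
            simp only [toR, hc, hd]
            push_cast
            ext <;> simp
          rw [e]
          linarith
        · rintro v w' he
          simp only [List.cons.injEq] at he
          rw [← he.1]
          simp only
          omega
  have weak : ∀ m i, i + m = n → i < n → (p i).1 = 0 →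
      ∃ w, Good w ∧ (∀ q ∈ chV w, chH wo q.1 q.2) ∧
      (∑ k ∈ Finset.Ico i n, F (toR (p (k + 1)) - toR (p k)) ≤ BN w wo) := by
    intro m
    induction m with
    | zero => intro i hi hi'; omega
    | succ m ih =>
      intro i hi hin hx
      rcases hcl i hin with h | h | h
      · have hi1 : i + 1 < n := by
          by_contra hc
          have : i + 1 = n := by omega
          rw [this, hn] at h
          have := h.2.2
          simp at this
        obtain ⟨w, g1, g2, g3⟩ := ih (i + 1) (by omega) hi1 h.2.1
        refine ⟨w, g1, g2, ?_⟩
        rw [Finset.sum_eq_sum_Ico_succ_bot hin]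
        have := hF2 (toR (p (i + 1)) - toR (p i)) (by simp [toR, h.1, h.2.1]) (by
          simp [toR]; exact h.2.2.le)
        linarith
      · omega
      · rw [Finset.sum_eq_sum_Ico_succ_bot hin]
        obtain ⟨w, g1, g2, g3, g4, g5, g6⟩ := strong m (i + 1) (by omega) (by omega) (by omega)
        obtain ⟨c, hc⟩ := Nat.exists_eq_add_of_le h.1
        obtain ⟨d, hd⟩ := Nat.exists_eq_add_of_le h.2.1
        have hcd : 0 < c + d := by
          by_contra hcon
          exact hne i hin (Prod.ext (by omega) (by omega))
        refine ⟨(c, d) :: w, g1.cons_head hcd ?_, ?_, ?_⟩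
        · rintro v w' rfl
          have hv := g6 v w' rfl
          have hk := hcw i (toR (p (i + 1 + 1))) (hD _)
          simp only [det2, toR, Prod.fst_sub, Prod.snd_sub] at hk
          have r1 : ((p (i + 1)).1 : ℝ) = (p i).1 + c := by exact_mod_cast hc
          have r2 : ((p i).2 : ℝ) = (p (i + 1)).2 + d := by exact_mod_cast hd
          have r3 : ((p (i + 1 + 1)).1 : ℝ) = (p (i + 1)).1 + v.1 := by exact_mod_cast hv.1
          have r4 : ((p (i + 1 + 1)).2 : ℝ) + v.2 = (p (i + 1)).2 := by exact_mod_cast hv.2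
          have : (v.1 : ℝ) * d ≤ c * v.2 := by
            rw [r3, r1, r2, ← r4] at hk
            nlinarith
          exact_mod_cast this
        · intro q hq
          simp only [chV, List.mem_cons, List.mem_map] at hq
          rcases hq with rfl | ⟨r, hr, rfl⟩
          · have := hD i
            rw [g2, add_comm d, ← hd]
            rw [hx] at this
            simpa using this
          · have := g4 r hr
            rw [hc, hx] at this
            push_cast at this ⊢
            convert this using 1
            ring
        · rw [BN_cons_left, Nat.cast_add, ← mSum_eq]
          have := hF1 c d (by positivity) (by positivity)
          have e : toR (p (i + 1)) - toR (p i) = ((c : ℝ), -(d : ℝ)) := by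
            simp only [toR, hc, hd]
            push_cast
            ext <;> simp
          rw [e]
          linarith
  exact weak n 0 (by omega) hnpos (by rw [h0])

lemma exists_interior_pt {Ω : Set (ℝ × ℝ)} {wo} (hΩ : Ω = {p : ℝ × ℝ | chH wo p.1 p.2})
    (h : (interior Ω).Nonempty) : ∃ z : ℝ × ℝ, chH wo z.1 z.2 ∧ 0 < z.1 ∧ 0 < z.2 := by
  obtain ⟨q, hq⟩ := h
  have hc : Continuous (fun t : ℝ => q + (t, t)) := by fun_prop
  have h1 : ∀ᶠ t in nhds (0 : ℝ), q + (t, t) ∈ interior Ω := by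
    apply hc.continuousAt.eventually_mem
    apply isOpen_interior.mem_nhds
    have e0 : q + ((0 : ℝ), (0 : ℝ)) = q := by ext <;> simp
    show q + ((0 : ℝ), (0 : ℝ)) ∈ _
    rw [e0]; exact hq
  have h2 : ∀ᶠ t in nhdsWithin (0 : ℝ) (Set.Ioi 0), q + (t, t) ∈ interior Ω := h1.filter_mono nhdsWithin_le_nhds
  obtain ⟨t, ht, ht0⟩ := (h2.and self_mem_nhdsWithin).exists
  have hm := interior_subset ht
  have hm' := interior_subset hq
  rw [hΩ] at hm hm'
  refine ⟨_, hm, ?_, ?_⟩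
  · have := hm'.1
    have : 0 < t := ht0
    simp; linarith
  · have := hm'.2.1
    have : 0 < t := ht0
    simp; linarith

theorem perim_self (Ω : ConvexDomain) (hlat : Ω.IsLattice) :
    ∃ wo, Good wo ∧ Ω.body = {p : ℝ × ℝ | chH wo p.1 p.2} ∧ omegaPerim Ω.body Ω.P = BN wo wo := by
  have hv : ∀ i, Ω.P.verts i ∈ Ω.P.body := fun i => subset_convexHull _ _ ⟨i, rfl⟩
  have hP : IsCompetitor Ω.P := ⟨hlat, fun i => Ω.nonneg _ (hv i), Ω.zero_mem, Ω.rect⟩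
  obtain ⟨wo, ho, hb⟩ := exists_chain hP
  have hb' : Ω.body = {p : ℝ × ℝ | chH wo p.1 p.2} := hb
  refine ⟨wo, ho, hb', le_antisymm ?_ (BN_le_perim hb' ho hP ho hb)⟩
  obtain ⟨j, hj⟩ := exists_zero_vert hP
  obtain ⟨z, hz, hz1, hz2⟩ := exists_interior_pt hb Ω.int_nonempty
  have hl : ∀ i, ∃ q, Ω.P.verts (j + i) = toR q := fun i =>
    lattice_nonneg (hlat _) (Ω.nonneg _ (hv _)).1 (Ω.nonneg _ (hv _)).2
  choose p hp using hl
  have hper : Function.Periodic Ω.P.verts Ω.P.n := Ω.P.periodic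
  have hmod : ∀ i k, p i = p k → i ≡ k [MOD Ω.P.n] := by
    intro i k h
    have h' : Ω.P.verts (j + i) = Ω.P.verts (j + k) := by rw [hp, hp, h]
    rw [← hper.map_mod_nat, ← hper.map_mod_nat (j + k)] at h'
    have := Ω.P.inj _ _ (Nat.mod_lt _ Ω.P.npos) (Nat.mod_lt _ Ω.P.npos) h'
    exact Nat.ModEq.add_left_cancel' j this
  have h00 : p 0 = (0, 0) := by
    apply toR_inj; rw [← hp]; simpa [toR] using hj
  have hn : Ω.P.n ≠ 1 := by
    intro h1
    have hall : ∀ i, Ω.P.verts i = (0, 0) := by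
      intro i
      rw [← hj, ← hper.map_mod_nat i, ← hper.map_mod_nat j, h1]
      simp [Nat.mod_one]
    have : Ω.P.body ⊆ {(0, 0)} := convexHull_min (by
      rintro _ ⟨i, rfl⟩; exact hall i) (convex_singleton _)
    have hzm : z ∈ Ω.P.body := by rw [hb]; exact hz
    have := this hzm
    simp only [Set.mem_singleton_iff] at this
    rw [this] at hz1
    simp at hz1
  have hperim : omegaPerim Ω.body Ω.P =
      ∑ i ∈ Finset.Ico 0 Ω.P.n, omegaLen Ω.body (toR (p (i + 1)) - toR (p i)) := by
    rw [omegaPerim, ← sum_shift (fun i => omegaLen Ω.body (Ω.P.verts (i + 1) - Ω.P.verts i)) Ω.P.n _ j]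
    · rw [Finset.range_eq_Ico]
      apply Finset.sum_congr rfl
      intro i _
      rw [← hp, ← hp]
      rfl
    · intro i
      rw [Ω.P.periodic, show i + Ω.P.n + 1 = i + 1 + Ω.P.n by ring, Ω.P.periodic]
  have hne : Ω.body.Nonempty := ⟨_, Ω.zero_mem⟩
  have hΩ : ∀ p ∈ Ω.body, chH wo p.1 p.2 := fun p hp => by rw [hb'] at hp; exact hp
  have hD : ∀ i, chH wo (p i).1 (p i).2 := by
    intro i
    have := hv (j + i)
    rw [hb, hp] at this
    exact this
  obtain ⟨w, g1, g2, g3⟩ := phase (wo := wo) Ω.P.n p hD (by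
    intro i q hq
    have := Ω.P.clockwise (j + i) q (by
      show q ∈ Ω.P.body
      rw [hb]; exact hq)
    rw [← hp, ← hp]
    exact this) (by
    intro i hi h
    have := hmod _ _ h
    have h2 : 1 ≡ 0 [MOD Ω.P.n] := Nat.ModEq.add_left_cancel' i (by simpa using this)
    rw [Nat.modEq_zero_iff_dvd, Nat.dvd_one] at h2
    exact hn h2) h00 (by
    apply toR_inj
    rw [← hp, Ω.P.periodic, hj]; simp [toR]) Ω.P.npos (by
    intro i hi0 hi h
    have := hmod i 0 (by rw [h, h00])
    rw [Nat.modEq_zero_iff_dvd] at this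
    exact absurd (Nat.le_of_dvd hi0 this) (by omega)) hz hz1 hz2 (omegaLen Ω.body)
    (fun a b ha hb => omegaLen_le hne hΩ ho ha hb)
    (fun v h1 h2 => omegaLen_nonpos hne hΩ h1 h2)
  rw [hperim]
  refine g3.trans ?_
  exact_mod_cast BN_mono ho g1 g2


lemma psd_min {ι : Type*} (g t : ι → ℝ) (s : Finset ι) : ∀ c, (∀ i ∈ s, c ≤ t i) →
    c * (∑ i ∈ s, g i) ^ 2 ≤ ∑ i ∈ s, ∑ j ∈ s, g i * g j * min (t i) (t j) := by
  classical
  induction s using Finset.induction_on_min_value t with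
  | empty => intro c _; simp
  | insert a s ha hmin ih =>
    intro c hc
    have h1 := ih (t a) hmin
    have h2 : ∑ i ∈ insert a s, ∑ j ∈ insert a s, g i * g j * min (t i) (t j) =
        g a * g a * t a + 2 * g a * t a * (∑ i ∈ s, g i) +
        ∑ i ∈ s, ∑ j ∈ s, g i * g j * min (t i) (t j) := by
      rw [Finset.sum_insert ha, Finset.sum_insert ha]
      simp_rw [Finset.sum_insert ha]
      rw [Finset.sum_add_distrib]
      have e1 : ∑ j ∈ s, g a * g j * min (t a) (t j) = g a * t a * ∑ j ∈ s, g j := by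
        rw [Finset.mul_sum]
        apply Finset.sum_congr rfl
        intro j hj
        rw [min_eq_left (hmin j hj)]; ring
      have e2 : ∑ j ∈ s, g j * g a * min (t j) (t a) = g a * t a * ∑ j ∈ s, g j := by
        rw [Finset.mul_sum]
        apply Finset.sum_congr rfl
        intro j hj
        rw [min_eq_right (hmin j hj)]; ring
      rw [e1, e2, min_self]; ring
    rw [h2, Finset.sum_insert ha]
    have h3 := hc a (Finset.mem_insert_self _ _)
    have h4 := mul_le_mul_of_nonneg_right h3 (sq_nonneg (g a + ∑ i ∈ s, g i))
    nlinarith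

lemma psd_m {ι : Type*} (g p q : ι → ℝ) (hp : ∀ i, 0 ≤ p i) (hq : ∀ i, 0 ≤ q i) (s : Finset ι) :
    0 ≤ ∑ i ∈ s, ∑ j ∈ s, g i * g j * min (p i * q j) (q i * p j) := by
  have h := psd_min (fun i => g i * q i) (fun i => p i / q i) s 0
    (fun i _ => div_nonneg (hp i) (hq i))
  rw [zero_mul] at h
  refine h.trans_eq ?_
  apply Finset.sum_congr rfl
  intro i _
  apply Finset.sum_congr rfl
  intro j _
  rcases (hq i).eq_or_lt with hi | hi
  · have : min (p i * q j) (q i * p j) = 0 := by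
      rw [← hi, zero_mul]; exact min_eq_right (mul_nonneg (hp i) (hq j))
    rw [this, ← hi]; ring
  rcases (hq j).eq_or_lt with hj | hj
  · have : min (p i * q j) (q i * p j) = 0 := by
      rw [← hj, mul_zero]; exact min_eq_left (mul_nonneg (hq i) (hp j))
    rw [this, ← hj]; ring
  have : min (p i * q j) (q i * p j) = q i * q j * min (p i / q i) (p j / q j) := by
    rw [mul_min_of_nonneg _ _ (by positivity)]
    congr 1 <;> field_simp
  rw [this]; ring

abbrev FS := (ℕ × ℕ) →₀ ℝ

def Mr (u v : ℕ × ℕ) : ℝ := max ((u.1 : ℝ) * v.2) (u.2 * v.1)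

lemma Mr_comm (u v) : Mr u v = Mr v u := by
  unfold Mr; rw [max_comm]; congr 1 <;> ring

def LC (k : ℕ × ℕ → ℝ) : FS →ₗ[ℝ] ℝ := Finsupp.linearCombination ℝ k

lemma LC_eq (k f) : LC k f = ∑ v ∈ f.support, f v * k v := by
  simp [LC, Finsupp.linearCombination_apply, Finsupp.sum]

lemma LC_single (k v c) : LC k (Finsupp.single v c) = c * k v := by
  simp [LC, Finsupp.linearCombination_single]

def BB (f g : FS) : ℝ := LC (fun u => LC (Mr u) g) f

lemma BB_eq (f g : FS) : BB f g = ∑ u ∈ f.support, ∑ v ∈ g.support, f u * g v * Mr u v := by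
  rw [BB, LC_eq]
  apply Finset.sum_congr rfl
  intro u _
  rw [LC_eq, Finset.mul_sum]
  apply Finset.sum_congr rfl
  intros; ring

lemma BB_comm (f g : FS) : BB f g = BB g f := by
  rw [BB_eq, BB_eq, Finset.sum_comm]
  apply Finset.sum_congr rfl
  intro u _
  apply Finset.sum_congr rfl
  intro v _
  rw [Mr_comm]; ring

lemma BB_add_left (f f' g : FS) : BB (f + f') g = BB f g + BB f' g := by
  simp [BB, map_add]
lemma BB_smul_left (c : ℝ) (f g : FS) : BB (c • f) g = c * BB f g := by
  simp [BB, map_smul]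
lemma BB_add_right (f g g' : FS) : BB f (g + g') = BB f g + BB f g' := by
  rw [BB_comm, BB_add_left, BB_comm g, BB_comm g']
lemma BB_smul_right (c : ℝ) (f g : FS) : BB f (c • g) = c * BB f g := by
  rw [BB_comm, BB_smul_left, BB_comm]

lemma LC_sq (f : FS) (k l : ℕ × ℕ → ℝ) :
    ∑ u ∈ f.support, ∑ v ∈ f.support, f u * f v * (k u * l v) = LC k f * LC l f := by
  rw [LC_eq, LC_eq, Finset.sum_mul_sum]
  apply Finset.sum_congr rfl
  intro u _
  apply Finset.sum_congr rfl
  intro v _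
  ring

lemma max_ident (U1 U2 V1 V2 : ℝ) (h1 : 0 ≤ U1) (h2 : 0 ≤ U2) (h3 : 0 ≤ V1) (h4 : 0 ≤ V2) :
    max (U1 * V2) (U2 * V1) = max U1 U2 * max V1 V2 -
      min (U1 * max (V1 - V2) 0) (max (U1 - U2) 0 * V1) -
      min (U2 * max (V2 - V1) 0) (max (U2 - U1) 0 * V2) := by
  rcases le_total U1 U2 with hU | hU <;> rcases le_total V1 V2 with hV | hV
  · rw [max_eq_right hU, max_eq_right hV, max_eq_right (sub_nonpos.2 hU), max_eq_right (sub_nonpos.2 hV),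
      max_eq_left (sub_nonneg.2 hU), max_eq_left (sub_nonneg.2 hV)]
    rcases le_total (U1 * V2) (U2 * V1) with h | h
    · rw [max_eq_right h, min_eq_left (by nlinarith : U2 * (V2 - V1) ≤ (U2 - U1) * V2)]
      simp; ring
    · rw [max_eq_left h, min_eq_right (by nlinarith : (U2 - U1) * V2 ≤ U2 * (V2 - V1))]
      simp; ring
  · rw [max_eq_right hU, max_eq_left hV, max_eq_right (sub_nonpos.2 hU), max_eq_left (sub_nonneg.2 hV),
      max_eq_left (sub_nonneg.2 hU), max_eq_right (sub_nonpos.2 hV),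
      max_eq_right (by nlinarith [mul_nonneg h1 h4] : U1 * V2 ≤ U2 * V1)]
    rw [zero_mul, mul_zero, min_eq_right (mul_nonneg h1 (sub_nonneg.2 hV)),
      min_eq_left (mul_nonneg (sub_nonneg.2 hU) h4)]
    ring
  · rw [max_eq_left hU, max_eq_right hV, max_eq_left (sub_nonneg.2 hU), max_eq_right (sub_nonpos.2 hV),
      max_eq_right (sub_nonpos.2 hU), max_eq_left (sub_nonneg.2 hV),
      max_eq_left (by nlinarith [mul_nonneg h1 h4] : U2 * V1 ≤ U1 * V2)]
    rw [zero_mul, mul_zero, min_eq_left (mul_nonneg (sub_nonneg.2 hU) h3),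
      min_eq_right (mul_nonneg h2 (sub_nonneg.2 hV))]
    ring
  · rw [max_eq_left hU, max_eq_left hV, max_eq_left (sub_nonneg.2 hU), max_eq_left (sub_nonneg.2 hV),
      max_eq_right (sub_nonpos.2 hU), max_eq_right (sub_nonpos.2 hV)]
    rcases le_total (U1 * V2) (U2 * V1) with h | h
    · rw [max_eq_right h, min_eq_right (by nlinarith : (U1 - U2) * V1 ≤ U1 * (V1 - V2))]
      simp; ring
    · rw [max_eq_left h, min_eq_left (by nlinarith : U1 * (V1 - V2) ≤ (U1 - U2) * V1)]
      simp; ring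

lemma hodge_zero (f : FS) (a b : ℝ) (ha : 0 ≤ a) (hb : 0 ≤ b) (hab : 0 < a + b)
    (h : LC (fun u => max (u.1 * b) (u.2 * a)) f = 0) : BB f f ≤ 0 := by
  have hax : ∀ k l : ℕ × ℕ → ℝ, LC k f * LC l f = 0 →
      (∀ u v : ℕ × ℕ, (u.1 : ℝ) * v.2 + u.2 * v.1 = k u * l v + l u * k v) → BB f f ≤ 0 := by
    intro k l h0 hkl
    have e : BB f f = LC k f * LC l f + LC l f * LC k f - ∑ u ∈ f.support, ∑ v ∈ f.support, f u * f v *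
        min ((u.1 : ℝ) * v.2) (u.2 * v.1) := by
      rw [← LC_sq, ← LC_sq, BB_eq, ← Finset.sum_add_distrib, ← Finset.sum_sub_distrib]
      apply Finset.sum_congr rfl
      intro u _
      rw [← Finset.sum_add_distrib, ← Finset.sum_sub_distrib]
      apply Finset.sum_congr rfl
      intro v _
      have h1 := min_add_max ((u.1 : ℝ) * v.2) (u.2 * v.1)
      have h2 := hkl u v
      have h3 : Mr u v = k u * l v + l u * k v - min ((u.1 : ℝ) * v.2) (u.2 * v.1) := by
        unfold Mr; linarith
      rw [h3]; ring
    have := psd_m f (fun u => (u.1 : ℝ)) (fun u => (u.2 : ℝ)) (fun _ => by positivity)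
      (fun _ => by positivity) f.support
    rw [e, mul_comm (LC l f), h0]
    linarith
  rcases ha.eq_or_lt with ha0 | ha0
  · have e : (fun u : ℕ × ℕ => max ((u.1 : ℝ) * b) (u.2 * a)) = fun u => b * (u.1 : ℝ) := by
      funext u; rw [← ha0, mul_zero, max_eq_left (by positivity)]; ring
    rw [e] at h
    have hb0 : 0 < b := by linarith
    refine hax (fun u => b * (u.1 : ℝ)) (fun u => (u.2 : ℝ) / b) (by rw [h, zero_mul]) ?_
    intro u v; field_simp
  rcases hb.eq_or_lt with hb0 | hb0
  · have e : (fun u : ℕ × ℕ => max ((u.1 : ℝ) * b) (u.2 * a)) = fun u => a * (u.2 : ℝ) := by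
      funext u; rw [← hb0, mul_zero, max_eq_right (by positivity)]; ring
    rw [e] at h
    refine hax (fun u => a * (u.2 : ℝ)) (fun u => (u.1 : ℝ) / a) (by rw [h, zero_mul]) ?_
    intro u v; field_simp; ring
  set k : ℕ × ℕ → ℝ := fun u => max (u.1 * b) (u.2 * a) with hk
  have p1 := psd_m f (fun u => (u.1 : ℝ) * b) (fun u => max ((u.1 : ℝ) * b - u.2 * a) 0)
    (fun _ => by positivity) (fun _ => le_max_right _ _) f.support
  have p2 := psd_m f (fun u => (u.2 : ℝ) * a) (fun u => max ((u.2 : ℝ) * a - u.1 * b) 0)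
    (fun _ => by positivity) (fun _ => le_max_right _ _) f.support
  have e : (a * b) * BB f f = LC k f * LC k f - (∑ u ∈ f.support, ∑ v ∈ f.support, f u * f v *
        min (((u.1 : ℝ) * b) * max ((v.1 : ℝ) * b - v.2 * a) 0) (max ((u.1 : ℝ) * b - u.2 * a) 0 * (v.1 * b)))
      - ∑ u ∈ f.support, ∑ v ∈ f.support, f u * f v *
        min (((u.2 : ℝ) * a) * max ((v.2 : ℝ) * a - v.1 * b) 0) (max ((u.2 : ℝ) * a - u.1 * b) 0 * (v.2 * a)) := by
    rw [← LC_sq, BB_eq, Finset.mul_sum, ← Finset.sum_sub_distrib, ← Finset.sum_sub_distrib]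
    apply Finset.sum_congr rfl
    intro u _
    rw [Finset.mul_sum, ← Finset.sum_sub_distrib, ← Finset.sum_sub_distrib]
    apply Finset.sum_congr rfl
    intro v _
    have h1 := max_ident (u.1 * b) (u.2 * a) (v.1 * b) (v.2 * a) (by positivity) (by positivity)
      (by positivity) (by positivity)
    have h2 : a * b * Mr u v = max ((u.1 * b) * (v.2 * a)) ((u.2 * a) * (v.1 * b)) := by
      unfold Mr
      rw [mul_max_of_nonneg _ _ (by positivity)]
      congr 1 <;> ring
    rw [h1] at h2
    have : k u * k v = max (u.1 * b) (u.2 * a) * max (v.1 * b) (v.2 * a) := rfl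
    rw [this]
    linear_combination (f u * f v) * h2
  rw [h] at e
  have : (a * b) * BB f f ≤ 0 := by rw [e]; linarith
  by_contra hc
  push Not at hc
  have := mul_pos (mul_pos ha0 hb0) hc
  linarith

def wF (w : List (ℕ × ℕ)) : FS := (w.map fun v => Finsupp.single v 1).sum

lemma LC_wF (k w) : LC k (wF w) = (w.map k).sum := by
  induction w with
  | nil => simp [wF]
  | cons v w ih =>
    have : wF (v :: w) = Finsupp.single v 1 + wF w := by simp [wF]
    rw [this, map_add, ih, LC_single]; simp

lemma Mr_eq (u v) : Mr u v = (mx u v : ℕ) := by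
  simp [Mr, mx]

lemma BB_wF (w w') : BB (wF w) (wF w') = (BN w w' : ℝ) := by
  rw [BB, LC_wF, BN_eq_mSum]
  congr 1
  apply List.map_congr_left
  intro v _
  rw [LC_wF, mSum_eq, Nat.cast_list_sum, List.map_map]
  congr 1
  apply List.map_congr_left
  intro u _
  rw [Mr_eq]; rfl

lemma hodge_orth (f : FS) (wo : List (ℕ × ℕ)) (hpos : ∀ u ∈ wo, 0 < u.1 + u.2) (hne : wo ≠ [])
    (h : BB f (wF wo) = 0) : BB f f ≤ 0 := by
  set H : ℝ × ℝ → ℝ := fun p => LC (fun u => max (u.1 * p.2) (u.2 * p.1)) f with hH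
  have hs : (wo.map fun v => H ((v.1 : ℝ), (v.2 : ℝ))).sum = 0 := by
    rw [← h, BB_comm, BB, LC_wF]
    congr 1
    apply List.map_congr_left
    intro v _
    simp only [hH]
    congr 2
    funext u
    rw [Mr_comm]; rfl
  have hcont : Continuous H := by
    simp only [hH, LC_eq]
    fun_prop
  have h1 : ∃ v ∈ wo, H ((v.1 : ℝ), (v.2 : ℝ)) ≤ 0 := by
    by_contra hc
    push Not at hc
    have := List.sum_pos (wo.map fun v => H ((v.1 : ℝ), (v.2 : ℝ))) (by
      intro x hx
      obtain ⟨v, hv, rfl⟩ := List.mem_map.1 hx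
      have := hc v hv
      linarith) (by simpa using hne)
    linarith
  have h2 : ∃ v ∈ wo, 0 ≤ H ((v.1 : ℝ), (v.2 : ℝ)) := by
    by_contra hc
    push Not at hc
    have := List.sum_pos (wo.map fun v => - H ((v.1 : ℝ), (v.2 : ℝ))) (by
      intro x hx
      obtain ⟨v, hv, rfl⟩ := List.mem_map.1 hx
      have := hc v hv
      linarith) (by simpa using hne)
    have e : (wo.map fun v => - H ((v.1 : ℝ), (v.2 : ℝ))).sum = - (wo.map fun v => H ((v.1 : ℝ), (v.2 : ℝ))).sum := by
      clear hs this hc h1 hpos hne h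
      induction wo with
      | nil => simp
      | cons v w ih => simp only [List.map_cons, List.sum_cons, ih]; ring
    linarith
  obtain ⟨v, hv, hv0⟩ := h1
  obtain ⟨v', hv', hv0'⟩ := h2
  set γ : ℝ → ℝ × ℝ := fun t => ((1 - t) * v.1 + t * v'.1, (1 - t) * v.2 + t * v'.2) with hγ
  have hγc : Continuous γ := by fun_prop
  have ivt := intermediate_value_Icc (zero_le_one : (0 : ℝ) ≤ 1) (hcont.comp hγc).continuousOn
  have hm : (0 : ℝ) ∈ Set.Icc ((H ∘ γ) 0) ((H ∘ γ) 1) := by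
    constructor <;> simp [hγ, hv0, hv0']
  obtain ⟨t, ⟨ht0, ht1⟩, ht⟩ := ivt hm
  have p1 : (0 : ℝ) < v.1 + v.2 := by exact_mod_cast hpos v hv
  have p2 : (0 : ℝ) < v'.1 + v'.2 := by exact_mod_cast hpos v' hv'
  have q1 : 0 ≤ 1 - t := by linarith
  refine hodge_zero f (γ t).1 (γ t).2 (by simp only [hγ]; positivity) (by simp only [hγ]; positivity) ?_ ht
  simp only [hγ]
  rcases ht0.eq_or_lt with h0 | h0
  · rw [← h0]; linarith
  · nlinarith [mul_nonneg q1 p1.le, mul_pos h0 p2]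

lemma hodge (f : FS) (wo : List (ℕ × ℕ)) (hpos : ∀ u ∈ wo, 0 < u.1 + u.2)
    (hl : 0 < BN wo wo) : BB f f ≤ BB f (wF wo) ^ 2 / (BN wo wo : ℝ) := by
  have hl' : (0 : ℝ) < BN wo wo := by exact_mod_cast hl
  have hne : wo ≠ [] := by rintro rfl; simp [BN] at hl
  set s := BB f (wF wo) / (BN wo wo : ℝ) with hs
  have e1 : s * (BN wo wo : ℝ) = BB f (wF wo) := by rw [hs]; field_simp
  have := hodge_orth (f + (-s) • wF wo) wo hpos hne (by
    rw [BB_add_left, BB_smul_left, BB_wF]; linarith)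
  rw [BB_add_left, BB_add_right, BB_add_right, BB_smul_left, BB_smul_left, BB_smul_right, BB_smul_right,
    BB_wF, BB_comm (wF wo) f] at this
  have e2 : BB f (wF wo) ^ 2 / (BN wo wo : ℝ) = s * BB f (wF wo) := by rw [hs]; ring
  rw [e2]
  have e3 : -s * (-s * (BN wo wo : ℝ)) = s * BB f (wF wo) := by rw [← e1]; ring
  rw [e3] at this
  linarith


def dt (a v : ℕ × ℕ) : ℝ := (a.1 : ℝ) * v.2 - a.2 * v.1

def RepM (θ : ℕ × ℕ → ℝ) : Prop := ∃ Z : FS, ∀ v, θ v = LC (Mr v) Z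

lemma RepM.add {θ θ'} (h : RepM θ) (h' : RepM θ') : RepM (fun v => θ v + θ' v) := by
  obtain ⟨Z, hZ⟩ := h
  obtain ⟨Z', hZ'⟩ := h'
  exact ⟨Z + Z', fun v => by simp only [map_add, hZ, hZ']⟩

lemma RepM.smul {θ} (c : ℝ) (h : RepM θ) : RepM (fun v => c * θ v) := by
  obtain ⟨Z, hZ⟩ := h
  exact ⟨c • Z, fun v => by simp only [map_smul, hZ]; rfl⟩

lemma RepM.fst : RepM (fun v => (v.1 : ℝ)) :=
  ⟨Finsupp.single (0, 1) 1, fun v => by rw [LC_single]; simp [Mr]⟩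
lemma RepM.snd : RepM (fun v => (v.2 : ℝ)) :=
  ⟨Finsupp.single (1, 0) 1, fun v => by rw [LC_single]; simp [Mr]⟩
lemma RepM.mr (a) : RepM (fun v => Mr v a) :=
  ⟨Finsupp.single a 1, fun v => by rw [LC_single, one_mul]⟩

lemma RepM.lin (α β : ℝ) : RepM (fun v => α * v.1 + β * v.2) := (RepM.fst.smul α).add (RepM.snd.smul β)

lemma RepM.dtp (a) : RepM (fun v => max (dt a v) 0) := by
  have h := (RepM.mr a).add (RepM.fst.smul (-(a.2 : ℝ)))
  convert h using 2 with v
  rw [Mr_comm, Mr, dt]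
  rcases le_total ((a.1 : ℝ) * v.2) (a.2 * v.1) with h | h
  · rw [max_eq_right (by linarith), max_eq_right h]; ring
  · rw [max_eq_left (by linarith), max_eq_left h]; ring

lemma gcd_le_dt {a v : ℕ × ℕ} (h : 0 < dt a v) : (Nat.gcd v.1 v.2 : ℝ) ≤ dt a v := by
  have e : dt a v = (((a.1 : ℤ) * v.2 - a.2 * v.1 : ℤ) : ℝ) := by simp [dt]
  rw [e] at h ⊢
  have h' : 0 < (a.1 : ℤ) * v.2 - a.2 * v.1 := by exact_mod_cast h
  have hd : ((Nat.gcd v.1 v.2 : ℕ) : ℤ) ∣ (a.1 : ℤ) * v.2 - a.2 * v.1 := by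
    apply dvd_sub
    · exact Dvd.dvd.mul_left (Int.natCast_dvd_natCast.2 (Nat.gcd_dvd_right _ _)) _
    · exact Dvd.dvd.mul_left (Int.natCast_dvd_natCast.2 (Nat.gcd_dvd_left _ _)) _
  have := Int.le_of_dvd h' hd
  exact_mod_cast this

lemma dt_zero {a v : ℕ × ℕ} (ha : Nat.gcd a.1 a.2 = 1) (h : dt a v = 0) :
    (v.1 : ℝ) = Nat.gcd v.1 v.2 * a.1 ∧ (v.2 : ℝ) = Nat.gcd v.1 v.2 * a.2 := by
  have h' : a.1 * v.2 = a.2 * v.1 := by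
    have : (a.1 : ℝ) * v.2 = a.2 * v.1 := by unfold dt at h; linarith
    exact_mod_cast this
  have hd : a.1 ∣ v.1 := (Nat.Coprime.dvd_mul_left (show Nat.Coprime a.1 a.2 from ha)).1 ⟨_, h'.symm⟩
  obtain ⟨k, hk⟩ := hd
  rcases Nat.eq_zero_or_pos a.1 with h0 | h0
  · have h1 : a.2 = 1 := by rw [h0] at ha; simpa using ha
    have h2 : v.1 = 0 := by rw [hk, h0, zero_mul]
    rw [h0, h1, h2]; simp
  · have h2 : v.2 = a.2 * k := by
      rw [hk] at h'
      have : a.1 * v.2 = a.1 * (a.2 * k) := by rw [h']; ring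
      exact Nat.eq_of_mul_eq_mul_left h0 this
    have h3 : Nat.gcd v.1 v.2 = k := by
      rw [hk, h2, Nat.gcd_mul_right, ha, one_mul]
    rw [h3, hk, h2]
    push_cast
    constructor <;> ring

lemma prim (u : ℕ × ℕ) (hu : 0 < u.1 + u.2) : ∃ a : ℕ × ℕ, Nat.gcd a.1 a.2 = 1 ∧
    u = (Nat.gcd u.1 u.2 * a.1, Nat.gcd u.1 u.2 * a.2) ∧ 0 < Nat.gcd u.1 u.2 := by
  have hg : 0 < Nat.gcd u.1 u.2 := by
    rcases Nat.eq_zero_or_pos u.1 with h | h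
    · exact Nat.gcd_pos_of_pos_right _ (by omega)
    · exact Nat.gcd_pos_of_pos_left _ h
  refine ⟨(u.1 / Nat.gcd u.1 u.2, u.2 / Nat.gcd u.1 u.2), ?_, ?_, hg⟩
  · exact Nat.Coprime.gcd_eq_one (Nat.coprime_div_gcd_div_gcd hg)
  ext
  · exact (Nat.mul_div_cancel' (Nat.gcd_dvd_left _ _)).symm
  · exact (Nat.mul_div_cancel' (Nat.gcd_dvd_right _ _)).symm

lemma lemG (l : List (ℕ × ℕ)) : ∀ (a : ℕ × ℕ) (α β : ℝ), Good l → Nat.gcd a.1 a.2 = 1 →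
    (∀ v ∈ l, 0 ≤ dt a v) → α * a.1 + β * a.2 = 1 →
    ∃ θ, RepM θ ∧ (∀ v, dt a v ≤ 0 → θ v = 0) ∧
      (∀ v, 0 ≤ dt a v → (Nat.gcd v.1 v.2 : ℝ) ≤ α * v.1 + β * v.2 + θ v) ∧
      (∀ v ∈ l, (Nat.gcd v.1 v.2 : ℝ) = α * v.1 + β * v.2 + θ v) := by
  induction l with
  | nil =>
    intro a α β _ ha _ hn
    refine ⟨fun v => (1 + |β|) * max (dt a v) 0, (RepM.dtp a).smul _, ?_, ?_, by simp⟩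
    · intro v hv; simp only; rw [max_eq_right hv, mul_zero]
    · intro v hv
      simp only
      rcases hv.eq_or_lt with h0 | h0
      · obtain ⟨h1, h2⟩ := dt_zero ha h0.symm
        rw [← h0]
        rw [max_self, mul_zero, add_zero]
        have : α * v.1 + β * v.2 = Nat.gcd v.1 v.2 := by
          calc α * v.1 + β * v.2 = α * (Nat.gcd v.1 v.2 * a.1) + β * (Nat.gcd v.1 v.2 * a.2) := by rw [← h1, ← h2]
            _ = Nat.gcd v.1 v.2 * (α * a.1 + β * a.2) := by ring
            _ = _ := by rw [hn, mul_one]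
        rw [this]
      · rw [max_eq_left hv]
        have hg := gcd_le_dt h0
        have ha1 : 1 ≤ a.1 := by
          by_contra hc
          have : a.1 = 0 := by omega
          unfold dt at h0
          rw [this] at h0
          have : (0 : ℝ) ≤ (a.2 : ℝ) * v.1 := by positivity
          simp at h0; linarith
        have ha1' : (1 : ℝ) ≤ a.1 := by exact_mod_cast ha1
        have e : (a.1 : ℝ) * (α * v.1 + β * v.2) = v.1 + β * dt a v := by
          unfold dt; linear_combination (v.1 : ℝ) * hn
        have hv1 : (0 : ℝ) ≤ v.1 := by positivity
        have h3 : 0 ≤ (a.1 : ℝ) * (α * v.1 + β * v.2 + |β| * dt a v) := by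
          have b1 : - |β| * dt a v ≤ β * dt a v := mul_le_mul_of_nonneg_right (neg_abs_le β) hv
          have b2 : |β| * dt a v ≤ a.1 * (|β| * dt a v) :=
            le_mul_of_one_le_left (mul_nonneg (abs_nonneg _) hv) ha1'
          rw [mul_add, e]; linarith
        have h4 : 0 ≤ α * v.1 + β * v.2 + |β| * dt a v := by
          by_contra hc
          push Not at hc
          have := mul_neg_of_pos_of_neg (by linarith : (0 : ℝ) < a.1) hc
          linarith
        linarith
  | cons u l ih =>
    intro a α β hg ha hl hn
    obtain ⟨b, hb1, hb2, hb3⟩ := prim u (hg.2 u (by simp))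
    set g := Nat.gcd u.1 u.2 with hgd
    have hg3 : (0 : ℝ) < g := by exact_mod_cast hb3
    have eu1 : (u.1 : ℝ) = g * b.1 := by
      have : u.1 = g * b.1 := congrArg Prod.fst hb2
      exact_mod_cast this
    have eu2 : (u.2 : ℝ) = g * b.2 := by
      have : u.2 = g * b.2 := congrArg Prod.snd hb2
      exact_mod_cast this
    have hub : ∀ v, dt u v = g * dt b v := by
      intro v; unfold dt; rw [eu1, eu2]; ring
    have hau : dt a u = g * dt a b := by
      unfold dt; rw [eu1, eu2]; ring
    have hab : 0 ≤ dt a b := by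
      have := hl u (by simp)
      rw [hau] at this
      exact nonneg_of_mul_nonneg_right this hg3
    have hbl : ∀ v ∈ l, 0 ≤ dt b v := by
      intro v hv
      have := (List.pairwise_cons.1 hg.1).1 v hv
      have h2 : (v.1 : ℝ) * u.2 ≤ u.1 * v.2 := by exact_mod_cast this
      have h3 : 0 ≤ (g : ℝ) * dt b v := by rw [← hub]; unfold dt; linarith
      exact nonneg_of_mul_nonneg_right h3 hg3
    rcases hab.eq_or_lt with h0 | h0
    · obtain ⟨θ, t1, t2, t3, t4⟩ := ih a α β hg.tail ha (fun v hv => hl v (by simp [hv])) hn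
      refine ⟨θ, t1, t2, t3, ?_⟩
      intro v hv
      rcases List.mem_cons.1 hv with rfl | hv
      · have hz : dt a v = 0 := by rw [hau, ← h0, mul_zero]
        rw [t2 v hz.le, add_zero]
        obtain ⟨h1, h2⟩ := dt_zero ha hz
        calc (Nat.gcd v.1 v.2 : ℝ) = Nat.gcd v.1 v.2 * (α * a.1 + β * a.2) := by rw [hn, mul_one]
          _ = α * (Nat.gcd v.1 v.2 * a.1) + β * (Nat.gcd v.1 v.2 * a.2) := by ring
          _ = _ := by rw [← h1, ← h2]
      · exact t4 v hv
    · set D := dt a b with hD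
      set s := α * b.1 + β * b.2 with hs
      set z := (1 - s) / D + 1 with hz
      have hzD : z * D = 1 - s + D := by rw [hz]; field_simp
      obtain ⟨θ, t1, t2, t3, t4⟩ := ih b (α - z * a.2 + (a.2 + b.2)) (β + z * a.1 - (a.1 + b.1)) hg.tail hb1 hbl
        (by
          have : (D : ℝ) = a.1 * b.2 - a.2 * b.1 := rfl
          linear_combination hzD - hs - this * (z - 1))
      set c : ℕ × ℕ := (a.1 + b.1, a.2 + b.2) with hc
      have hcv : ∀ v, dt c v = dt a v + dt b v := by
        intro v; simp only [dt, hc]; push_cast; ring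
      have hlin : ∀ v : ℕ × ℕ, (α - z * a.2 + (a.2 + b.2)) * v.1 + (β + z * a.1 - (a.1 + b.1)) * v.2
          = α * v.1 + β * v.2 + z * dt a v - dt c v := by
        intro v; rw [hcv]; unfold dt; ring
      have hneg : ∀ v, dt a v ≤ 0 → dt b v ≤ 0 := by
        intro v hv
        have ha1 : (0 : ℝ) < a.1 := by
          by_contra hcon
          have h1 : (a.1 : ℝ) = 0 := le_antisymm (not_lt.1 hcon) (by positivity)
          have h2 : D = a.1 * b.2 - a.2 * b.1 := rfl
          have h3 : (0 : ℝ) ≤ a.2 * b.1 := by positivity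
          rw [h1] at h2; linarith
        have h2 : 0 < (a.1 : ℝ) * b.2 - a.2 * b.1 := h0
        unfold dt at hv ⊢
        have p1 : (0 : ℝ) ≤ b.1 := by positivity
        have p2 : (0 : ℝ) ≤ v.1 := by positivity
        have h3 : (a.1 : ℝ) * (b.1 * v.2 - b.2 * v.1) ≤ 0 := by
          nlinarith [mul_nonneg p1 (neg_nonneg.2 hv), mul_nonneg p2 h2.le]
        by_contra hcon
        push Not at hcon
        have := mul_pos ha1 hcon
        linarith
      have hpos : ∀ v, 0 ≤ dt b v → 0 ≤ dt a v := by
        intro v hv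
        by_contra hcon
        push Not at hcon
        have h1 := hneg v hcon.le
        have h2 : dt b v = 0 := le_antisymm h1 hv
        obtain ⟨h3, h4⟩ := dt_zero hb1 h2
        have h5 : dt a v = Nat.gcd v.1 v.2 * D := by
          unfold dt
          rw [h3, h4]
          simp only [hD, dt]; ring
        have : 0 ≤ (Nat.gcd v.1 v.2 : ℝ) * D := by positivity
        linarith
      have hbig : ∀ v, 0 ≤ dt b v → α * v.1 + β * v.2 + (z * max (dt a v) 0 + (-1) * max (dt c v) 0 + θ v) =
          (α - z * a.2 + (a.2 + b.2)) * v.1 + (β + z * a.1 - (a.1 + b.1)) * v.2 + θ v := by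
        intro v hv
        rw [hlin, max_eq_left (hpos v hv), max_eq_left (by rw [hcv]; exact add_nonneg (hpos v hv) hv)]
        ring
      refine ⟨fun v => z * max (dt a v) 0 + (-1) * max (dt c v) 0 + θ v,
        (((RepM.dtp a).smul z).add ((RepM.dtp c).smul (-1))).add t1, ?_, ?_, ?_⟩
      · intro v hv
        have h1 := hneg v hv
        simp only
        rw [max_eq_right hv, max_eq_right (by rw [hcv]; linarith), t2 v h1]; ring
      · intro v hv
        simp only
        rcases le_total 0 (dt b v) with hbv | hbv
        · rw [hbig v hbv]; exact t3 v hbv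
        · rw [t2 v hbv, max_eq_left hv]
          have key : D * (α * v.1 + β * v.2 + z * dt a v) = dt a v - dt b v + D * dt a v := by
            have : (D : ℝ) = a.1 * b.2 - a.2 * b.1 := rfl
            have e1 : D * (α * v.1 + β * v.2) = - dt b v + s * dt a v := by
              rw [this, hs]; unfold dt
              linear_combination (-(b.1 : ℝ) * v.2 + b.2 * v.1) * hn
            linear_combination e1 + dt a v * hzD
          rcases hv.eq_or_lt with hv0 | hv0
          · obtain ⟨h1, h2⟩ := dt_zero ha hv0.symm
            rw [max_eq_right (by rw [hcv]; linarith)]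
            have h5 : dt b v = - (Nat.gcd v.1 v.2 * D) := by
              unfold dt
              rw [h1, h2]
              simp only [hD, dt]; ring
            rw [← hv0, h5] at key
            have : α * v.1 + β * v.2 + z * 0 = Nat.gcd v.1 v.2 := by
              apply mul_left_cancel₀ h0.ne'
              rw [key]; ring
            rw [← hv0]; linarith
          · have g1 := gcd_le_dt hv0
            have hsum : dt a v ≤ α * v.1 + β * v.2 + z * dt a v := by
              by_contra hcon
              push Not at hcon
              have := mul_lt_mul_of_pos_left hcon h0
              linarith
            rcases le_total 0 (dt c v) with hcc | hcc
            · rw [max_eq_left hcc, hcv]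
              rcases hbv.eq_or_lt with hb0 | hb0
              · have h7 := t3 v hb0.ge
                rw [hlin, t2 v hbv, hcv] at h7
                linarith
              · have g2 : (Nat.gcd v.1 v.2 : ℝ) ≤ - dt b v := by
                  have e : - dt b v = dt (v.1, v.2) b := by simp only [dt]; ring
                  have hsw : dt (b.2, b.1) (v.2, v.1) = - dt b v := by simp only [dt]; ring
                  have := gcd_le_dt (a := (b.2, b.1)) (v := (v.2, v.1)) (by rw [hsw]; linarith)
                  rw [hsw, Nat.gcd_comm] at this
                  exact this
                linarith
            · rw [max_eq_right hcc]; linarith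
      · intro v hv
        simp only
        rcases List.mem_cons.1 hv with rfl | hv
        · have hbv : dt b v = 0 := by
            have h1 := hub v
            have h2 : dt v v = 0 := by unfold dt; ring
            rw [h2] at h1
            exact (mul_eq_zero.1 h1.symm).resolve_left hg3.ne'
          rw [hbig v hbv.ge, hlin, t2 v hbv.le, hcv, hbv, hau, eu1, eu2]
          have : (g:ℝ) * (α * b.1 + β * b.2 + z * D - D) = g := by
            rw [hzD, ← hs]; ring
          rw [← hgd]
          linarith
        · rw [hbig v (hbl v hv)]; exact t4 v hv

lemma exists_psi (wo : List (ℕ × ℕ)) (ho : Good wo) (hne : wo ≠ []) :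
    ∃ ψ, RepM ψ ∧ (∀ v, (Nat.gcd v.1 v.2 : ℝ) ≤ ψ v) ∧ ∀ v ∈ wo, (Nat.gcd v.1 v.2 : ℝ) = ψ v := by
  cases wo with
  | nil => exact absurd rfl hne
  | cons u l =>
    obtain ⟨a, ha1, ha2, ha3⟩ := prim u (ho.2 u (by simp))
    set g := Nat.gcd u.1 u.2 with hgd
    have hg3 : (0 : ℝ) < g := by exact_mod_cast ha3
    have eu1 : (u.1 : ℝ) = g * a.1 := by
      have : u.1 = g * a.1 := congrArg Prod.fst ha2
      exact_mod_cast this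
    have eu2 : (u.2 : ℝ) = g * a.2 := by
      have : u.2 = g * a.2 := congrArg Prod.snd ha2
      exact_mod_cast this
    have hub : ∀ v, dt u v = g * dt a v := by
      intro v; unfold dt; rw [eu1, eu2]; ring
    have hal : ∀ v ∈ u :: l, 0 ≤ dt a v := by
      intro v hv
      have h2 : (v.1 : ℝ) * u.2 ≤ u.1 * v.2 := by
        rcases List.mem_cons.1 hv with rfl | hv
        · linarith [mul_comm (v.1 : ℝ) v.2]
        · have := (List.pairwise_cons.1 ho.1).1 v hv
          exact_mod_cast this
      have h3 : 0 ≤ (g : ℝ) * dt a v := by rw [← hub]; unfold dt; linarith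
      exact nonneg_of_mul_nonneg_right h3 hg3
    set S : ℝ := 1 / (a.1 + a.2) with hS
    have hap : (0 : ℝ) < a.1 + a.2 := by
      have h2 := ho.2 u (by simp)
      have h3 : (0 : ℝ) < u.1 + u.2 := by exact_mod_cast h2
      rw [eu1, eu2, ← mul_add] at h3
      exact (mul_pos_iff_of_pos_left hg3).1 h3
    have hSa : S * (a.1 + a.2) = 1 := by rw [hS]; field_simp
    obtain ⟨θ, t1, t2, t3, t4⟩ := lemG (u :: l) a (S + a.2) (S - a.1) ho ha1 hal
      (by linear_combination hSa)
    refine ⟨fun v => (S + a.2) * v.1 + (S - a.1) * v.2 + θ v, (RepM.lin _ _).add t1, ?_, t4⟩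
    intro v
    rcases le_total 0 (dt a v) with h | h
    · exact t3 v h
    · simp only
      rcases h.eq_or_lt with h0 | h0
      · exact t3 v h0.ge
      · rw [t2 v h]
        have hsw : dt (a.2, a.1) (v.2, v.1) = - dt a v := by simp only [dt]; ring
        have := gcd_le_dt (a := (a.2, a.1)) (v := (v.2, v.1)) (by rw [hsw]; linarith)
        rw [hsw, Nat.gcd_comm] at this
        simp only [dt] at this
        have hS0 : 0 ≤ S := by positivity
        have p1 : 0 ≤ S * v.1 := by positivity
        have p2 : 0 ≤ S * v.2 := by positivity
        nlinarith

lemma el_eq (w) : (el w : ℝ) = (w.map fun v => (v.1 : ℝ) + v.2 + Nat.gcd v.1 v.2).sum := by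
  induction w with
  | nil => simp [el]
  | cons v w ih => rw [el_cons, Nat.cast_add, ih]; simp

theorem upper (wo : List (ℕ × ℕ)) (ho : Good wo) (hl : 0 < BN wo wo) : ∃ C : ℝ, ∀ w,
    (BN w w : ℝ) + el w ≤ ((BN w wo : ℝ) + el wo / 2) ^ 2 / (BN wo wo : ℝ) + C := by
  have hne : wo ≠ [] := by rintro rfl; simp [BN] at hl
  obtain ⟨ψ, hr, h1, h2⟩ := exists_psi wo ho hne
  obtain ⟨Z, hZ⟩ := (RepM.fst.add RepM.snd).add hr
  have e : ∀ w, BB (wF w) Z = (w.map fun v => (v.1 : ℝ) + v.2 + ψ v).sum := by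
    intro w
    rw [BB, LC_wF]
    congr 1
    apply List.map_congr_left
    intro v _
    exact (hZ v).symm
  have e1 : ∀ w, (el w : ℝ) ≤ BB (wF w) Z := by
    intro w
    rw [e, el_eq]
    apply List.sum_le_sum
    intro v _
    have := h1 v
    linarith
  have e2 : (el wo : ℝ) = BB (wF wo) Z := by
    rw [e, el_eq]
    congr 1
    apply List.map_congr_left
    intro v hv
    rw [h2 v hv]
  refine ⟨- BB Z Z / 4, fun w => ?_⟩
  have h := hodge (wF w + (1 / 2 : ℝ) • Z) wo ho.2 hl
  rw [BB_add_left, BB_add_left, BB_add_right, BB_add_right, BB_smul_left, BB_smul_left, BB_smul_left, BB_smul_right, BB_smul_right,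
    BB_wF, BB_wF, BB_comm Z (wF w), BB_comm Z (wF wo), ← e2] at h
  have := e1 w
  have e3 : (BN w wo : ℝ) + 1 / 2 * el wo = BN w wo + el wo / 2 := by ring
  rw [e3] at h
  linarith


section asm
variable {Ω : Set (ℝ × ℝ)} {wo : List (ℕ × ℕ)}

lemma cap_le (hΩ : Ω = {p : ℝ × ℝ | chH wo p.1 p.2}) (ho : Good wo) {w k} {R : ℕ} (hg : Good w)
    (hB : BN w wo ≤ R) (hk : k + 1 ≤ cnt w) : echCap Ω k ≤ R := by
  obtain ⟨w', g1, g2, g3⟩ := remove_many (wo := wo) hg hk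
  have hne : Ω.Nonempty := ⟨(0, 0), by rw [hΩ]; simpa using chH_zero ho⟩
  obtain ⟨P, p1, p2, p3⟩ := exists_poly hne (fun p hp => by rw [hΩ] at hp; exact hp) ho g1
  have hle : omegaPerim Ω P ≤ R := p3.trans (by exact_mod_cast g3.trans hB)
  refine le_trans (csInf_le ⟨0, ?_⟩ ⟨P, p1, by rw [p2, g2], rfl⟩) hle
  rintro _ ⟨Q, q1, q2, rfl⟩
  obtain ⟨v, v1, v2⟩ := exists_chain q1
  exact le_trans (by positivity) (BN_le_perim hΩ ho q1 v1 v2)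

lemma of_cap_le (hΩ : Ω = {p : ℝ × ℝ | chH wo p.1 p.2}) (ho : Good wo) {k} {R : ℕ}
    (h : echCap Ω k ≤ R) : ∃ w, Good w ∧ cnt w = k + 1 ∧ BN w wo ≤ R := by
  have hne : Ω.Nonempty := ⟨(0, 0), by rw [hΩ]; simpa using chH_zero ho⟩
  have hs : { r | ∃ P : ClockPolygon, IsCompetitor P ∧
      latticeCount P.body = k + 1 ∧ omegaPerim Ω P = r }.Nonempty := by
    have hg : Good [(k + 1, 0)] := ⟨by simp, by simp⟩
    have hc := cnt_eq hg
    have h1 : BN [(k + 1, 0)] [(k + 1, 0)] = 0 := by simp [BN, mx]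
    have h2 : el [(k + 1, 0)] = k + 1 + (k + 1) := by simp [el]
    obtain ⟨w', g1, g2, g3⟩ := remove_many (wo := wo) (k := k) hg (by omega)
    obtain ⟨P, p1, p2, p3⟩ := exists_poly hne (fun p hp => by rw [hΩ] at hp; exact hp) ho g1
    exact ⟨_, P, p1, by rw [p2, g2], rfl⟩
  obtain ⟨a, ⟨P, p1, p2, rfl⟩, ha⟩ := exists_lt_of_csInf_lt hs
    (show echCap Ω k < (R : ℝ) + 1 by linarith)
  obtain ⟨w, g1, g2⟩ := exists_chain p1
  refine ⟨w, g1, ?_, ?_⟩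
  · rw [← p2, g2, lattice_cnt]
  · have := BN_le_perim hΩ ho p1 g1 g2
    have h3 : (BN w wo : ℝ) < R + 1 := by linarith
    have h4 : BN w wo < R + 1 := by exact_mod_cast h3
    omega

lemma cap_eq (hΩ : Ω = {p : ℝ × ℝ | chH wo p.1 p.2}) (ho : Good wo) {C : ℝ}
    (hl : 0 < BN wo wo) (hC : ∀ w, (BN w w : ℝ) + el w ≤ ((BN w wo : ℝ) + el wo / 2) ^ 2 / (BN wo wo : ℝ) + C)
    (R : ℕ) : (∃ w, Good w ∧ BN w wo ≤ R ∧ capFn Ω R = cnt w ∧ ∀ w', Good w' → BN w' wo ≤ R → cnt w' ≤ cnt w) ∧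
      2 * (capFn Ω R : ℝ) ≤ ((R : ℝ) + el wo / 2) ^ 2 / (BN wo wo : ℝ) + C + 2 := by
  have hb : ∀ w, Good w → BN w wo ≤ R → 2 * (cnt w : ℝ) ≤ ((R : ℝ) + el wo / 2) ^ 2 / (BN wo wo : ℝ) + C + 2 := by
    intro w hg hB
    have h1 := cnt_eq hg
    have h2 : 2 * (cnt w : ℝ) = BN w w + el w + 2 := by exact_mod_cast h1
    have h3 := hC w
    have hB' : (BN w wo : ℝ) ≤ R := by exact_mod_cast hB
    have h4 : ((BN w wo : ℝ) + el wo / 2) ^ 2 / (BN wo wo : ℝ) ≤ ((R : ℝ) + el wo / 2) ^ 2 / (BN wo wo : ℝ) := by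
      gcongr
    linarith
  set S : Set ℕ := {n | ∃ w, Good w ∧ BN w wo ≤ R ∧ cnt w = n} with hS
  have hne : S.Nonempty := ⟨cnt [], [], Good.nil, by simp [BN], rfl⟩
  have hbd : BddAbove S := by
    refine ⟨⌈((R : ℝ) + el wo / 2) ^ 2 / (BN wo wo : ℝ) + C + 2⌉₊, ?_⟩
    rintro _ ⟨w, g1, g2, rfl⟩
    have h1 := hb w g1 g2
    have h2 := Nat.le_ceil (((R : ℝ) + el wo / 2) ^ 2 / (BN wo wo : ℝ) + C + 2)
    have h3 : (0 : ℝ) ≤ cnt w := by positivity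
    have : (cnt w : ℝ) ≤ ⌈((R : ℝ) + el wo / 2) ^ 2 / (BN wo wo : ℝ) + C + 2⌉₊ := by linarith
    exact_mod_cast this
  obtain ⟨w, g1, g2, g3⟩ := Nat.sSup_mem hne hbd
  have hmax : ∀ w', Good w' → BN w' wo ≤ R → cnt w' ≤ cnt w := by
    intro w' h1 h2
    rw [g3]
    exact le_csSup hbd ⟨w', h1, h2, rfl⟩
  have hcap : capFn Ω R = cnt w := by
    have : {k : ℕ | echCap Ω k ≤ R} = ((Finset.range (cnt w) : Finset ℕ) : Set ℕ) := by
      ext k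
      simp only [Set.mem_setOf_eq, Finset.coe_range, Set.mem_Iio]
      constructor
      · intro h
        obtain ⟨w', h1, h2, h3⟩ := of_cap_le hΩ ho h
        have := hmax w' h1 h3
        omega
      · intro h
        exact cap_le hΩ ho g1 g2 h
    rw [capFn, this, Set.ncard_coe_finset, Finset.card_range]
  exact ⟨⟨w, g1, g2, hcap, hmax⟩, by rw [hcap]; exact hb w g1 g2⟩

lemma cap_step (hΩ : Ω = {p : ℝ × ℝ | chH wo p.1 p.2}) (ho : Good wo) {C : ℝ}
    (hl : 0 < BN wo wo) (hC : ∀ w, (BN w w : ℝ) + el w ≤ ((BN w wo : ℝ) + el wo / 2) ^ 2 / (BN wo wo : ℝ) + C)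
    (R : ℕ) (ht : ∃ k, echCap Ω k = R) :
    2 * capFn Ω R + 2 * R + BN wo wo + el wo ≤ 2 * capFn Ω ((R + BN wo wo : ℕ) : ℝ) := by
  obtain ⟨⟨w, g1, g2, g3, g4⟩, -⟩ := cap_eq hΩ ho hl hC R
  obtain ⟨⟨v, f1, f2, f3, f4⟩, -⟩ := cap_eq hΩ ho hl hC (R + BN wo wo)
  obtain ⟨k, hk⟩ := ht
  have hB : BN w wo = R := by
    by_contra hne
    have hlt : BN w wo ≤ R - 1 := by omega
    obtain ⟨w', h1, h2, h3⟩ := of_cap_le hΩ ho hk.le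
    have h5 := g4 w' h1 h3
    have h6 := cap_le hΩ ho g1 hlt (show k + 1 ≤ cnt w by omega)
    rw [hk] at h6
    have h7 : R ≤ R - 1 := by exact_mod_cast h6
    omega
  obtain ⟨w', m1, m2, m3⟩ := merge g1 ho
  have := f4 w' m1 (by omega)
  rw [g3, f3]
  rw [hB] at m3
  omega

lemma count_dilate (hΩ : Ω = {p : ℝ × ℝ | chH wo p.1 p.2}) (ho : Good wo) (x : ℕ) (hx : 0 < x) :
    2 * latticeCount ((x : ℝ) • Ω) = x * x * BN wo wo + x * el wo + 2 := by
  have hx' : (0 : ℝ) < x := by exact_mod_cast hx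
  have : (x : ℝ) • Ω = {p : ℝ × ℝ | chH (scl x wo) p.1 p.2} := by
    ext p
    rw [Set.mem_smul_set, hΩ]
    constructor
    · rintro ⟨q, hq, rfl⟩
      exact (chH_scl hx wo _ _).2 hq
    · intro hp
      refine ⟨(p.1 / x, p.2 / x), ?_, ?_⟩
      · refine (chH_scl hx wo _ _).1 ?_
        simp only [mul_div_cancel₀ _ hx'.ne']
        exact hp
      · ext
        · show (x : ℝ) * (p.1 / x) = p.1
          field_simp
        · show (x : ℝ) * (p.2 / x) = p.2
          field_simp
  rw [this, lattice_cnt, cnt_eq (Good.scl hx ho), BN_scl, el_scl]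

end asm

lemma event_const (d : ℕ → ℤ) (x₁ : ℕ) (K : ℤ) (h1 : ∀ x, x₁ ≤ x → d x ≤ d (x + 1))
    (h2 : ∀ x, x₁ ≤ x → d x ≤ K) : ∃ γ x₀, ∀ x, x₀ ≤ x → d x = γ := by
  have hm : ∀ n x, x₁ ≤ x → d x ≤ d (x + n) := by
    intro n
    induction n with
    | zero => intro x _; simp
    | succ n ih => intro x hx; exact (ih x hx).trans (h1 (x + n) (by omega))
  obtain ⟨ub, ⟨n, hn, rfl⟩, hu⟩ := Int.exists_greatest_of_bdd (P := fun z => ∃ n, x₁ ≤ n ∧ d n = z)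
    ⟨K, by rintro _ ⟨n, hn, rfl⟩; exact h2 n hn⟩ ⟨_, x₁, le_rfl, rfl⟩
  refine ⟨d n, n, fun x hx => le_antisymm (hu _ ⟨x, by omega, rfl⟩) ?_⟩
  obtain ⟨m, rfl⟩ := Nat.exists_eq_add_of_le hx
  exact hm m n hn


/-- For a tightly constrained convex toric lattice domain,
on each residue class `r` mod `λ = ℓ_Ω(∂Ω)` the cap function eventually agrees
with the Ehrhart (lattice-point counting) function of `Ω` plus `r·x + γ_r`. -/
theorem cap_eventually_ehrhart (Ω : ConvexDomain) (hlat : Ω.IsLattice)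
    (r₀ : ℕ) (htight : TightlyConstrained Ω r₀)
    (lam : ℕ) (hlam : (lam : ℝ) = omegaPerim Ω.body Ω.P) (hlampos : 0 < lam) :
    ∀ r : ℕ, r < lam → ∃ γ : ℤ, ∃ x₀ : ℕ, ∀ x : ℕ, x₀ ≤ x →
      (capFn Ω.body ((r + lam * x : ℕ) : ℝ) : ℤ)
        = (latticeCount ((x : ℝ) • Ω.body) : ℤ) + (r : ℤ) * (x : ℤ) + γ := by
  obtain ⟨wo, ho, hb, hp⟩ := perim_self Ω hlat
  have hlw : lam = BN wo wo := by rw [hp] at hlam; exact_mod_cast hlam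
  subst hlw
  obtain ⟨C, hC⟩ := upper wo ho hlampos
  intro r hr
  set d : ℕ → ℤ := fun x => (capFn Ω.body ((r + BN wo wo * x : ℕ) : ℝ) : ℤ)
        - (latticeCount ((x : ℝ) • Ω.body) : ℤ) - (r : ℤ) * (x : ℤ) with hd
  obtain ⟨γ, x₀, h⟩ := event_const d (r₀ + 1)
    ⌈(((r : ℝ) + el wo / 2) ^ 2 / (BN wo wo : ℝ) + C) / 2⌉ (by
      intro x hx
      have hR : r₀ ≤ r + BN wo wo * x := by
        have : 1 * x ≤ BN wo wo * x := Nat.mul_le_mul_right _ hlampos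
        omega
      have h1 := cap_step hb ho hlampos hC (r + BN wo wo * x) (htight _ hR)
      have h2 := count_dilate hb ho x (by omega)
      have h3 := count_dilate hb ho (x + 1) (by omega)
      have e : r + BN wo wo * x + BN wo wo = r + BN wo wo * (x + 1) := by ring
      rw [e] at h1
      simp only [hd]
      zify at h1 h2 h3
      push_cast at h1 h2 h3 ⊢
      linarith) (by
      intro x hx
      have h1 := (cap_eq hb ho hlampos hC (r + BN wo wo * x)).2
      have h2 := count_dilate hb ho x (by omega)
      have h2' : 2 * (latticeCount ((x : ℝ) • Ω.body) : ℝ) = x * x * BN wo wo + x * el wo + 2 := by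
        exact_mod_cast h2
      have hl : (0 : ℝ) < BN wo wo := by exact_mod_cast hlampos
      have e : (((r + BN wo wo * x : ℕ) : ℝ) + el wo / 2) ^ 2 / (BN wo wo : ℝ) =
          ((r : ℝ) + el wo / 2) ^ 2 / (BN wo wo : ℝ) + x * x * BN wo wo + x * el wo + 2 * r * x := by
        push_cast
        field_simp
        ring
      rw [e] at h1
      have h3 : ((d x : ℤ) : ℝ) ≤ (((r : ℝ) + el wo / 2) ^ 2 / (BN wo wo : ℝ) + C) / 2 := by
        simp only [hd]
        rw [Int.cast_sub, Int.cast_sub, Int.cast_mul, Int.cast_natCast, Int.cast_natCast, Int.cast_natCast,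
          Int.cast_natCast]
        linarith
      have h4 := h3.trans (Int.le_ceil _)
      exact_mod_cast h4)
  refine ⟨γ, x₀, fun x hx => ?_⟩
  have := h x hx
  simp only [hd] at this
  linarith

end
end

section
/- Let Ω be a convex lattice domain such that X_Ω is tightly constrained with lower bound r₀ = 0, and set λ := ℓ_Ω(∂Ω). Then for every r ∈ ℤ≥0, the dilate rΩ contains the most lattice points among competitor convex lattice domains of Ω-perimeter at most rλ: every competitor convex lattice domain Λ with ℓ_Ω(∂Λ) ≤ r·λ satisfies L_Λ ≤ #(rΩ ∩ ℤ²). -/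
open scoped BigOperators Pointwise

noncomputable section

lemma hull_le (P : ClockPolygon) (α β c : ℝ)
    (h : ∀ i, α * (P.verts i).1 + β * (P.verts i).2 ≤ c) :
    ∀ q ∈ P.body, α * q.1 + β * q.2 ≤ c := by
  intro q hq
  have hc : Convex ℝ {q : ℝ × ℝ | α * q.1 + β * q.2 ≤ c} := by
    intro x hx y hy s t hs ht hst
    simp only [Set.mem_ofPred_eq, Prod.fst_add, Prod.snd_add, Prod.smul_fst, Prod.smul_snd,
      smul_eq_mul] at *
    have : t = 1 - s := by linarith
    subst this
    nlinarith [mul_le_mul_of_nonneg_left hx hs, mul_le_mul_of_nonneg_left hy ht]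
  have : convexHull ℝ (Set.range P.verts) ⊆ {q : ℝ × ℝ | α * q.1 + β * q.2 ≤ c} := by
    refine convexHull_min ?_ hc
    rintro _ ⟨i, rfl⟩
    exact h i
  exact this hq

lemma vert_mem (P : ClockPolygon) (i : ℕ) : P.verts i ∈ P.body :=
  subset_convexHull ℝ _ ⟨i, rfl⟩

lemma verts_mod (P : ClockPolygon) (i : ℕ) : P.verts (i % P.n) = P.verts i :=
  (show Function.Periodic P.verts P.n from P.periodic).map_mod_nat i

lemma exists_max (P : ClockPolygon) (f : ℝ × ℝ → ℝ) :
    ∃ j, ∀ i, f (P.verts i) ≤ f (P.verts j) := by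
  obtain ⟨j, _, hj⟩ := Finset.exists_max_image (Finset.range P.n) (fun i => f (P.verts i))
    ⟨0, by simpa using P.npos⟩
  refine ⟨j, fun i => ?_⟩
  have := hj (i % P.n) (by simpa using Nat.mod_lt _ P.npos)
  simpa [verts_mod] using this

lemma det_bdd (P : ClockPolygon) (v : ℝ × ℝ) : BddAbove (det2 v '' P.body) := by
  obtain ⟨j, hj⟩ := exists_max P (det2 v)
  refine ⟨det2 v (P.verts j), ?_⟩
  rintro _ ⟨q, hq, rfl⟩
  have := hull_le P (-v.2) v.1 (det2 v (P.verts j))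
    (fun i => by have := hj i; unfold det2 at *; linarith) q hq
  unfold det2 at *; linarith

lemma det_le_len (P : ClockPolygon) (v p : ℝ × ℝ) (hp : p ∈ P.body) :
    det2 v p ≤ omegaLen P.body v :=
  le_csSup (det_bdd P v) ⟨p, hp, rfl⟩

lemma path_le (B P : ClockPolygon) (p : ℝ × ℝ) (hp : p ∈ B.body) (i j : ℕ) (hij : i ≤ j) :
    det2 (P.verts j - P.verts i) p ≤
      ∑ k ∈ Finset.Ico i j, omegaLen B.body (P.verts (k + 1) - P.verts k) := by
  induction j, hij using Nat.le_induction with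
  | base => simp [det2]
  | succ j hij ih =>
    rw [Finset.sum_Ico_succ_top hij]
    have := det_le_len B (P.verts (j + 1) - P.verts j) p hp
    simp only [det2, Prod.fst_sub, Prod.snd_sub] at *
    linarith

lemma sum_periodic (f : ℕ → ℝ) (n : ℕ) (hf : ∀ i, f (i + n) = f i) (i : ℕ) :
    ∑ k ∈ Finset.Ico i (i + n), f k = ∑ k ∈ Finset.range n, f k := by
  induction i with
  | zero => simp
  | succ i ih =>
    rw [← ih]
    rcases Nat.eq_zero_or_pos n with rfl | hn
    · simp
    · rw [Finset.sum_eq_sum_Ico_succ_bot (show i < i + n by omega),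
        show i + 1 + n = (i + n) + 1 by ring,
        Finset.sum_Ico_succ_top (show i + 1 ≤ i + n by omega), hf]
      ring

lemma perim_Ico (S : Set (ℝ × ℝ)) (P : ClockPolygon) (i : ℕ) :
    omegaPerim S P =
      ∑ k ∈ Finset.Ico i (i + P.n), omegaLen S (P.verts (k + 1) - P.verts k) := by
  unfold omegaPerim
  rw [sum_periodic]
  intro k
  rw [show k + P.n + 1 = (k + 1) + P.n by ring, P.periodic, P.periodic]

lemma tri_le (B P : ClockPolygon) (p q s : ℝ × ℝ) (hp : p ∈ B.body) (hq : q ∈ B.body)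
    (hs : s ∈ B.body) (i j k : ℕ) (hij : i ≤ j) (hjk : j ≤ k) (hk : k ≤ i + P.n) :
    det2 (P.verts j - P.verts i) p + det2 (P.verts k - P.verts j) q
      + det2 (P.verts i - P.verts k) s ≤ omegaPerim B.body P := by
  rw [perim_Ico _ _ i, ← Finset.sum_Ico_consecutive _ hij (hjk.trans hk),
    ← Finset.sum_Ico_consecutive _ hjk hk]
  have h1 := path_le B P p hp i j hij
  have h2 := path_le B P q hq j k hjk
  have h3 := path_le B P s hs k (i + P.n) hk
  rw [P.periodic] at h3
  linarith

lemma exists_shift (P : ClockPolygon) (i j : ℕ) :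
    ∃ j', i ≤ j' ∧ j' ≤ i + P.n ∧ P.verts j' = P.verts j := by
  have hn := P.npos
  have hi := Nat.mod_lt i hn
  have hj := Nat.mod_lt j hn
  have hd := Nat.div_add_mod i P.n
  have key : ∀ m, P.verts (P.n * m + j % P.n) = P.verts j := by
    intro m
    rw [← verts_mod P (P.n * m + j % P.n)]
    simp [verts_mod]
  by_cases h : i % P.n ≤ j % P.n
  · exact ⟨P.n * (i / P.n) + j % P.n, by omega, by omega, key _⟩
  · exact ⟨P.n * (i / P.n + 1) + j % P.n, by rw [mul_add]; omega, by rw [mul_add]; omega, key _⟩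

lemma cyc_le (B P : ClockPolygon) (i j k : ℕ) (h0 : P.verts i = 0)
    (p1 p2 p3 q1 q2 q3 : ℝ × ℝ) (hp1 : p1 ∈ B.body) (hp2 : p2 ∈ B.body) (hp3 : p3 ∈ B.body)
    (hq1 : q1 ∈ B.body) (hq2 : q2 ∈ B.body) (hq3 : q3 ∈ B.body) :
    det2 (P.verts j) p1 + det2 (P.verts k - P.verts j) p2 + det2 (- P.verts k) p3
        ≤ omegaPerim B.body P ∨
    det2 (P.verts k) q1 + det2 (P.verts j - P.verts k) q2 + det2 (- P.verts j) q3
        ≤ omegaPerim B.body P := by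
  obtain ⟨j', h1, h2, hj⟩ := exists_shift P i j
  obtain ⟨k', h3, h4, hk⟩ := exists_shift P i k
  rcases le_total j' k' with h | h
  · left
    have := tri_le B P p1 p2 p3 hp1 hp2 hp3 i j' k' h1 h h4
    simpa [h0, hj, hk] using this
  · right
    have := tri_le B P q1 q2 q3 hq1 hq2 hq3 i k' j' h3 h h2
    simpa [h0, hj, hk] using this

/-- lattice nonneg points have natural coordinates -/
lemma nat_coords {p : ℝ × ℝ} (hl : IsLatticePt p) (h1 : 0 ≤ p.1) (h2 : 0 ≤ p.2) :
    ∃ x y : ℕ, p = ((x : ℝ), (y : ℝ)) := by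
  obtain ⟨⟨m, hm⟩, ⟨l, hl⟩⟩ := hl
  rw [hm] at h1
  rw [hl] at h2
  lift m to ℕ using (by exact_mod_cast h1)
  lift l to ℕ using (by exact_mod_cast h2)
  exact ⟨m, l, Prod.ext (by simpa using hm) (by simpa using hl)⟩

lemma zero_vert (P : ClockPolygon) (hn : ∀ i, ∃ x y : ℕ, P.verts i = ((x : ℝ), (y : ℝ)))
    (h0 : ((0 : ℝ), (0 : ℝ)) ∈ P.body) : ∃ i, P.verts i = 0 := by
  by_contra! hc
  have := hull_le P (-1) (-1) (-1) (fun i => by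
    obtain ⟨x, y, hxy⟩ := hn i
    have hne := hc i
    rw [hxy] at hne ⊢
    have : 1 ≤ x + y := by
      by_contra h
      have hx : x = 0 := by omega
      have hy : y = 0 := by omega
      exact hne (by simp [hx, hy])
    have : (1 : ℝ) ≤ x + y := by exact_mod_cast this
    simp only
    linarith) _ h0
  norm_num at this

def gridF (c h M : ℕ) : Finset (Σ _ : ℕ, ℕ) :=
  (Finset.range (h + 1)).sigma (fun y => Finset.range (M - c * y + 1))

lemma grid_card (c h M : ℕ) (hM : c * h ≤ M) :
    2 * ((gridF c h M).card : ℤ) = (h + 1) * (2 * M + 2 - c * h) := by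
  unfold gridF
  rw [Finset.card_sigma]
  simp only [Finset.card_range]
  induction h with
  | zero => simp; ring
  | succ h ih =>
    have h1 : c * h ≤ M := le_trans (Nat.mul_le_mul_left _ (Nat.le_succ h)) hM
    have := ih h1
    rw [Finset.sum_range_succ]
    push_cast [Nat.cast_sub hM] at this ⊢
    rw [mul_add, this]
    ring

lemma grid_le (b c h M r : ℕ) (hM : c * h ≤ M) (hs : 1 ≤ b + c + b)
    (hb : b * h + M ≤ r * (b + c + b)) :
    (gridF c h M).card ≤ (gridF c r (r * (b + c))).card := by
  have h1 := grid_card c h M hM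
  have h2 := grid_card c r (r * (b + c)) (by nlinarith)
  have hb' : (b : ℤ) * h + M ≤ r * (b + c + b) := by exact_mod_cast hb
  have hs' : (1 : ℤ) ≤ b + c + b := by exact_mod_cast hs
  push_cast at h2
  have h3 : 2 * ((gridF c h M).card : ℤ) ≤
      (h + 1) * (2 * (r * (b + c + b) - b * h) + 2 - c * h) := by
    rw [h1]
    apply mul_le_mul_of_nonneg_left _ (by positivity)
    linarith
  have key : 0 ≤ 2 * ((r : ℤ) - h) + (b + c + b) * (((r : ℤ) - h) * (r - h - 1)) := by
    generalize hd : (r : ℤ) - h = d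
    generalize (b + c + b : ℤ) = s at *
    have hdd : 0 ≤ d * (d - 1) := by
      rcases le_or_gt d 0 with h | h
      · nlinarith
      · have : 0 ≤ d - 1 := by omega
        positivity
    have : d * (d - 1) ≤ s * (d * (d - 1)) := by nlinarith
    have : 0 ≤ d * (d + 1) := by
      rcases le_or_gt 0 d with h | h
      · positivity
      · have : d + 1 ≤ 0 := by omega
        nlinarith
    nlinarith
  have : (2 : ℤ) * (gridF c h M).card ≤ 2 * (gridF c r (r * (b + c))).card := by
    rw [h2]
    refine h3.trans ?_
    nlinarith
  omega

def gridI (c h M : ℕ) : Finset (ℝ × ℝ) :=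
  (gridF c h M).map ⟨fun z => ((z.2 : ℝ), (z.1 : ℝ)), by
    rintro ⟨y, x⟩ ⟨y', x'⟩ h
    simp only [Prod.mk.injEq, Nat.cast_inj] at h
    obtain ⟨rfl, rfl⟩ := h
    rfl⟩

lemma mem_gridI (c h M x y : ℕ) (hM : c * h ≤ M) :
    ((x : ℝ), (y : ℝ)) ∈ gridI c h M ↔ y ≤ h ∧ x + c * y ≤ M := by
  have : ((x : ℝ), (y : ℝ)) ∈ gridI c h M ↔ (⟨y, x⟩ : Σ _ : ℕ, ℕ) ∈ gridF c h M := by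
    unfold gridI
    rw [Finset.mem_map]
    constructor
    · rintro ⟨⟨y', x'⟩, hm, he⟩
      replace he : ((x' : ℝ), (y' : ℝ)) = ((x : ℝ), (y : ℝ)) := he
      simp only [Prod.mk.injEq, Nat.cast_inj] at he
      obtain ⟨rfl, rfl⟩ := he
      exact hm
    · intro hm
      exact ⟨_, hm, rfl⟩
  rw [this]
  simp only [gridF, Finset.mem_sigma, Finset.mem_range]
  constructor
  · rintro ⟨h1, h2⟩
    have : c * y ≤ c * h := Nat.mul_le_mul_left _ (by omega)
    omega
  · rintro ⟨h1, h2⟩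
    omega

lemma count_core (S R : Set (ℝ × ℝ)) (b c h M r : ℕ) (hM : c * h ≤ M) (hs : 1 ≤ b + c + b)
    (hb : b * h + M ≤ r * (b + c + b))
    (hS : ∀ x y : ℕ, ((x : ℝ), (y : ℝ)) ∈ S → y ≤ h ∧ x + c * y ≤ M)
    (hS0 : ∀ q ∈ S, 0 ≤ q.1 ∧ 0 ≤ q.2)
    (hR0 : ∀ q ∈ R, 0 ≤ q.1 ∧ 0 ≤ q.2)
    (A : ℕ) (hRb : ∀ q ∈ R, q.1 ≤ A ∧ q.2 ≤ A)
    (hR : ∀ x y : ℕ, y ≤ r → x + c * y ≤ r * (b + c) → ((x : ℝ), (y : ℝ)) ∈ R) :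
    latticeCount S ≤ latticeCount R := by
  have hM' : c * r ≤ r * (b + c) := by nlinarith
  have e1 : latticeCount S ≤ (gridI c h M).card := by
    unfold latticeCount
    rw [← Set.ncard_coe_finset]
    refine Set.ncard_le_ncard ?_ (Finset.finite_toSet _)
    rintro p ⟨hp, hl⟩
    obtain ⟨x, y, rfl⟩ := nat_coords hl (hS0 p hp).1 (hS0 p hp).2
    exact (mem_gridI c h M x y hM).2 (hS x y hp)
  have e2 : (gridI c r (r * (b + c))).card ≤ latticeCount R := by
    unfold latticeCount
    rw [← Set.ncard_coe_finset]
    refine Set.ncard_le_ncard ?_ ?_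
    · intro p hp
      have hp' := hp
      simp only [gridI, Finset.coe_map, Set.mem_image] at hp'
      obtain ⟨⟨y, x⟩, _, rfl⟩ := hp'
      have := (mem_gridI c r _ x y hM').1 hp
      exact ⟨hR x y this.1 this.2, ⟨x, (Int.cast_natCast x).symm⟩, ⟨y, (Int.cast_natCast y).symm⟩⟩
    · refine Set.Finite.subset (Finset.finite_toSet (gridI 0 A A)) ?_
      rintro p ⟨hp, hl⟩
      obtain ⟨x, y, rfl⟩ := nat_coords hl (hR0 p hp).1 (hR0 p hp).2
      have := hRb _ hp
      simp only [Nat.cast_le] at this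
      exact (mem_gridI 0 A A x y (by simp)).2 (by simpa using this.symm)
  have := grid_le b c h M r hM hs hb
  simp only [gridI, Finset.card_map] at e1 e2
  omega

lemma latticeCount_swap (S : Set (ℝ × ℝ)) : latticeCount (Prod.swap '' S) = latticeCount S := by
  unfold latticeCount
  rw [← Set.ncard_image_of_injective {p ∈ S | IsLatticePt p} Prod.swap_injective]
  congr 1
  ext ⟨x, y⟩
  constructor
  · rintro ⟨⟨q, hq, he⟩, h1, h2⟩
    refine ⟨q, ⟨hq, ?_⟩, he⟩
    have : q = (y, x) := by rw [← Prod.swap_swap q, he]; rfl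
    subst this
    exact ⟨h2, h1⟩
  · rintro ⟨⟨u, v⟩, ⟨hq, h1, h2⟩, he⟩
    rw [← he]
    exact ⟨⟨_, hq, rfl⟩, h2, h1⟩

lemma len_self (P : ClockPolygon) (i : ℕ) :
    omegaLen P.body (P.verts (i + 1) - P.verts i) ≤ det2 (P.verts (i + 1)) (P.verts i) := by
  refine csSup_le ⟨_, _, vert_mem P 0, rfl⟩ ?_
  rintro _ ⟨q, hq, rfl⟩
  have := P.clockwise i q hq
  simp only [det2, Prod.fst_sub, Prod.snd_sub] at *
  linarith

/-- abstract summation for the self-perimeter -/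
lemma self_sum (P : ClockPolygon) (φ : ℝ × ℝ → ℝ) (V : ℝ × ℝ) (s : ℝ) (hs : 0 ≤ s)
    (h : ∀ i, det2 (P.verts (i + 1)) (P.verts i) - (φ (P.verts (i + 1)) - φ (P.verts i)) ≤ 0 ∨
      (P.verts i = V ∧
      det2 (P.verts (i + 1)) (P.verts i) - (φ (P.verts (i + 1)) - φ (P.verts i)) ≤ s)) :
    omegaPerim P.body P ≤ s := by
  classical
  have tel : ∑ i ∈ Finset.range P.n, (φ (P.verts (i + 1)) - φ (P.verts i)) = 0 := by
    rw [Finset.sum_range_sub (fun i => φ (P.verts i))]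
    have := P.periodic 0
    simp only [zero_add] at this
    rw [this, sub_self]
  have h1 : omegaPerim P.body P ≤ ∑ i ∈ Finset.range P.n,
      (det2 (P.verts (i + 1)) (P.verts i) - (φ (P.verts (i + 1)) - φ (P.verts i))) := by
    rw [Finset.sum_sub_distrib, tel, sub_zero]
    exact Finset.sum_le_sum fun i _ => len_self P i
  refine h1.trans ?_
  by_cases hV : ∃ i0 < P.n, P.verts i0 = V
  · obtain ⟨i0, hi0, hv⟩ := hV
    calc _ ≤ ∑ i ∈ Finset.range P.n, (if i = i0 then s else 0) := by
          refine Finset.sum_le_sum fun i hi => ?_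
          rcases h i with h | ⟨h, h'⟩
          · refine h.trans ?_
            split_ifs <;> simp [hs]
          · rw [if_pos (P.inj i i0 (by simpa using hi) hi0 (h.trans hv.symm))]
            exact h'
      _ ≤ s := by
          rw [Finset.sum_ite_eq']
          split_ifs <;> simp [hs]
  · refine le_trans (Finset.sum_nonpos fun i hi => ?_) hs
    rcases h i with h | ⟨h, _⟩
    · exact h
    · exact absurd ⟨i, by simpa using hi, h⟩ hV


lemma dom_nat (Ω : ConvexDomain) (hlat : Ω.IsLattice) :
    ∀ i, ∃ x y : ℕ, Ω.P.verts i = ((x : ℝ), (y : ℝ)) := fun i =>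
  nat_coords (hlat i) (Ω.nonneg _ (vert_mem _ i)).1 (Ω.nonneg _ (vert_mem _ i)).2

lemma dom_pos (Ω : ConvexDomain) (_hlat : Ω.IsLattice) :
    (∃ i, 0 < (Ω.P.verts i).1) ∧ (∃ i, 0 < (Ω.P.verts i).2) := by
  obtain ⟨q, hq⟩ := Ω.int_nonempty
  have hcont : Continuous (fun t : ℝ => q + t • ((1 : ℝ), (1 : ℝ))) := by fun_prop
  have hev : ∀ᶠ t : ℝ in nhds 0, q + t • ((1 : ℝ), (1 : ℝ)) ∈ interior Ω.P.body := by
    apply hcont.continuousAt.eventually_mem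
    simpa using isOpen_interior.mem_nhds hq
  have hev' : ∀ᶠ t : ℝ in nhdsWithin 0 (Set.Ioi 0),
      q + t • ((1 : ℝ), (1 : ℝ)) ∈ interior Ω.P.body := hev.filter_mono nhdsWithin_le_nhds
  obtain ⟨t, ht, htpos⟩ := (hev'.and self_mem_nhdsWithin).exists
  have htpos : 0 < t := htpos
  have hm := interior_subset ht
  have h0 := Ω.nonneg q (interior_subset hq)
  constructor
  · by_contra! hc
    have := hull_le Ω.P 1 0 0 (fun i => by have := hc i; linarith) _ hm
    simp at this
    linarith
  · by_contra! hc
    have := hull_le Ω.P 0 1 0 (fun i => by have := hc i; linarith) _ hm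
    simp at this
    linarith

lemma dil_case_std (Ω : ConvexDomain) (a b : ℝ) (hbn : 0 ≤ b) (han : 0 ≤ a)
    (ha : (a, (0 : ℝ)) ∈ Ω.body) (hb : (b, (1 : ℝ)) ∈ Ω.body) (r x y : ℕ)
    (hy : y ≤ r) (hx : (x : ℝ) + (a - b) * y ≤ r * a) :
    ((x : ℝ), (y : ℝ)) ∈ (r : ℝ) • Ω.body := by
  rcases Nat.eq_zero_or_pos r with rfl | hr
  · have hy0 : y = 0 := by omega
    subst hy0
    have : (x : ℝ) ≤ 0 := by simpa using hx
    have : x = 0 := by exact_mod_cast le_antisymm this (Nat.cast_nonneg x)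
    subst this
    exact ⟨_, Ω.zero_mem, by simp; rfl⟩
  · have hr' : (0 : ℝ) < r := by exact_mod_cast hr
    have hy' : (y : ℝ) ≤ r := by exact_mod_cast hy
    have ht0 : 0 ≤ (y : ℝ) / r := by positivity
    have ht1 : (y : ℝ) / r ≤ 1 := by rw [div_le_one hr']; exact hy'
    have hconv : Convex ℝ Ω.body := convex_convexHull ℝ _
    have h1 := hconv ha hb (sub_nonneg.2 ht1) ht0 (by ring)
    have h2 : ((x : ℝ) / r, (y : ℝ) / r) ∈ Ω.body := by
      apply Ω.rect _ h1
      have hxx : (x : ℝ) / r ≤ (1 - (y : ℝ) / r) * a + (y : ℝ) / r * b := by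
        rw [div_le_iff₀ hr']
        field_simp
        linarith
      simp only [Set.mem_prod, Set.mem_Icc, Prod.fst_add, Prod.snd_add, Prod.smul_fst,
        Prod.smul_snd, smul_eq_mul, mul_zero, mul_one, zero_add]
      exact ⟨⟨by positivity, hxx⟩, ⟨ht0, le_rfl⟩⟩
    refine ⟨_, h2, ?_⟩
    simp only [Prod.smul_mk, smul_eq_mul]
    rw [mul_div_cancel₀ _ hr'.ne', mul_div_cancel₀ _ hr'.ne']

lemma case_std (Ω : ConvexDomain) (hlat : Ω.IsLattice)
    (hH : ∀ i, (Ω.P.verts i).2 < 2) (r : ℕ) (Λ : ClockPolygon) (hΛ : IsCompetitor Λ)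
    (hper : omegaPerim Ω.body Λ ≤ (r : ℝ) * omegaPerim Ω.body Ω.P) :
    latticeCount Λ.body ≤ latticeCount ((r : ℝ) • Ω.body) := by
  have hΩn := dom_nat Ω hlat
  have hΛn : ∀ i, ∃ x y : ℕ, Λ.verts i = ((x : ℝ), (y : ℝ)) := fun i =>
    nat_coords (hΛ.1 i) (hΛ.2.1 i).1 (hΛ.2.1 i).2
  -- the vertex coordinates of the domain
  have hΩc : ∀ i, ∃ x y : ℕ, Ω.P.verts i = ((x : ℝ), (y : ℝ)) ∧ y ≤ 1 := by
    intro i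
    obtain ⟨x, y, h⟩ := hΩn i
    have h2 := hH i
    rw [h] at h2
    simp only at h2
    refine ⟨x, y, h, ?_⟩
    have : y < 2 := by exact_mod_cast h2
    omega
  obtain ⟨ja, hja⟩ := exists_max Ω.P (fun p => p.1)
  obtain ⟨a, ya, hae, _⟩ := hΩc ja
  obtain ⟨jb, hjb⟩ := exists_max Ω.P (fun p => p.2 * (p.1 + 1))
  obtain ⟨b, yb, hbe, hyb⟩ := hΩc jb
  have hxa : ∀ i, (Ω.P.verts i).1 ≤ a := by
    intro i
    have := hja i
    rw [hae] at this
    exact this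
  obtain ⟨⟨ix, hix⟩, ⟨iy, hiy⟩⟩ := dom_pos Ω hlat
  have hyb1 : yb = 1 := by
    by_contra hne
    have h0 : yb = 0 := by omega
    have := hjb iy
    simp only [hbe, h0] at this
    obtain ⟨x, y, h, _⟩ := hΩc iy
    rw [h] at this hiy
    simp only at this hiy
    have hx : (0 : ℝ) ≤ x := Nat.cast_nonneg x
    push_cast at this
    nlinarith
  subst hyb1
  have hxb : ∀ i, (Ω.P.verts i).2 = 1 → (Ω.P.verts i).1 ≤ b := by
    intro i hi
    have := hjb i
    simp only [hbe, hi] at this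
    push_cast at this
    linarith
  have han : (0 : ℝ) ≤ a := Nat.cast_nonneg a
  have hbn : (0 : ℝ) ≤ b := Nat.cast_nonneg b
  have hmb : ((b : ℝ), (1 : ℝ)) ∈ Ω.body := by
    have := vert_mem Ω.P jb
    rw [hbe, Nat.cast_one] at this
    exact this
  have hma : ((a : ℝ), (0 : ℝ)) ∈ Ω.body := by
    have := vert_mem Ω.P ja
    rw [hae] at this
    exact Ω.rect _ this (by simp)
  have hm1 : ((0 : ℝ), (1 : ℝ)) ∈ Ω.body :=
    Ω.rect _ hmb (by simp)
  have hbx : ∀ q ∈ Ω.body, q.1 ≤ a ∧ q.2 ≤ 1 := by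
    intro q hq
    have h1 := hull_le Ω.P 1 0 a (fun i => by have := hxa i; linarith) q hq
    have h2 := hull_le Ω.P 0 1 1 (fun i => by
      obtain ⟨x, y, h, h'⟩ := hΩc i
      rw [h]
      have : (y : ℝ) ≤ 1 := by exact_mod_cast h'
      simp only
      linarith) q hq
    constructor <;> linarith
  have hba : b ≤ a := by
    have := (hbx _ hmb).1
    simp only at this
    exact_mod_cast this
  obtain ⟨c, rfl⟩ := Nat.exists_eq_add_of_le hba
  have ha1 : 1 ≤ b + c := by
    have h := hxa ix
    have h2 := lt_of_lt_of_le hix h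
    exact_mod_cast h2
  have hself : omegaPerim Ω.body Ω.P ≤ ((b + c : ℕ) : ℝ) + b := by
    refine self_sum Ω.P (fun p => p.1 * p.2) ((b : ℝ), (1 : ℝ)) _ (by positivity) ?_
    intro i
    obtain ⟨x, y, h, hy⟩ := hΩc i
    obtain ⟨x', y', h', hy'⟩ := hΩc (i + 1)
    have c1 := hxa i
    have c2 := hxa (i + 1)
    have c3 := hxb i
    have c4 := hxb (i + 1)
    have cw := Ω.P.clockwise i _ hmb
    rw [h] at c1 c3 cw
    rw [h'] at c2 c4 cw
    rw [h, h']
    have n1 : (0 : ℝ) ≤ x := Nat.cast_nonneg x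
    have n2 : (0 : ℝ) ≤ x' := Nat.cast_nonneg x'
    simp only [det2, Prod.mk_sub_mk] at *
    interval_cases y <;> interval_cases y' <;> norm_num at *
    all_goals first
      | linarith [Nat.cast_nonneg (α := ℝ) x, Nat.cast_nonneg (α := ℝ) x']
      | (left; linarith)
      | (right; exact ⟨le_antisymm c3 cw, by
          have : (x : ℝ) ≤ b := by exact_mod_cast c3
          linarith⟩)
      | (right; exact ⟨le_antisymm c1 cw, by
          have : (x' : ℝ) ≤ b := by exact_mod_cast c4
          linarith⟩)
  -- data of the competitor
  obtain ⟨i0, hi0⟩ := zero_vert Λ hΛn hΛ.2.2.1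
  obtain ⟨jT, hjT⟩ := exists_max Λ (fun p => p.2)
  obtain ⟨jQ, hjQ⟩ := exists_max Λ (fun p => p.1 + c * p.2)
  obtain ⟨Tx, h, hT⟩ := hΛn jT
  obtain ⟨Qx, Qy, hQ⟩ := hΛn jQ
  have hTQ : (Tx : ℝ) + c * h ≤ Qx + c * Qy := by
    have := hjQ jT
    simpa [hT, hQ] using this
  have hQT : (Qy : ℝ) ≤ h := by
    have := hjT jQ
    simpa [hT, hQ] using this
  have hlow : (b : ℝ) * h + (Qx + c * Qy) ≤ omegaPerim Ω.body Λ := by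
    have := cyc_le Ω.P Λ i0 jT jQ hi0 (0, 1) (b, 1) (((b + c : ℕ) : ℝ), 0) (0, 1) (0, 0)
      (((b + c : ℕ) : ℝ), 0) hm1 hmb hma hm1 Ω.zero_mem hma
    rw [hT, hQ] at this
    simp only [det2, Prod.mk_sub_mk, Prod.neg_mk] at this
    push_cast at this
    have hcc : (0 : ℝ) ≤ c := Nat.cast_nonneg c
    have hm := mul_le_mul_of_nonneg_left hQT hcc
    change _ ≤ omegaPerim Ω.P.body Λ
    rcases this with h | h <;> nlinarith
  have hcast : (b : ℝ) * h + (Qx + c * Qy) ≤ r * (((b + c : ℕ) : ℝ) + b) :=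
    hlow.trans (hper.trans (mul_le_mul_of_nonneg_left hself (Nat.cast_nonneg r)))
  have hΛpos : ∀ q ∈ Λ.body, 0 ≤ q.1 ∧ 0 ≤ q.2 := by
    intro q hq
    have h1 := hull_le Λ (-1) 0 0 (fun i => by have := (hΛ.2.1 i).1; linarith) q hq
    have h2 := hull_le Λ 0 (-1) 0 (fun i => by have := (hΛ.2.1 i).2; linarith) q hq
    constructor <;> linarith
  have hrn : (0 : ℝ) ≤ r := Nat.cast_nonneg r
  refine count_core _ _ b c h (Qx + c * Qy) r ?_ (by omega) (by exact_mod_cast hcast) ?_ ?_ ?_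
    (r * (b + c)) ?_ ?_
  · have : (c : ℝ) * h ≤ Qx + c * Qy := by
      have : (0 : ℝ) ≤ Tx := Nat.cast_nonneg Tx
      linarith
    exact_mod_cast this
  · intro x y hxy
    have hxy : ((x : ℝ), (y : ℝ)) ∈ Λ.body := by
      exact hxy
      
      
    have h1 := hull_le Λ 0 1 h (fun i => by
      have := hjT i
      rw [hT] at this
      simp only at this
      linarith) _ hxy
    have h2 := hull_le Λ 1 c (Qx + c * Qy) (fun i => by
      have := hjQ i
      rw [hQ] at this
      simp only at this
      linarith) _ hxy
    simp only at h1 h2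
    constructor
    · have : (y : ℝ) ≤ h := by linarith
      exact_mod_cast this
    · have : (x : ℝ) + c * y ≤ Qx + c * Qy := by linarith
      exact_mod_cast this
  · exact hΛpos
  · rintro _ ⟨q, hq, rfl⟩
    have := Ω.nonneg q hq
    exact ⟨mul_nonneg hrn this.1, mul_nonneg hrn this.2⟩
  · rintro _ ⟨q, hq, rfl⟩
    have := hbx q hq
    have h1 : (1 : ℝ) ≤ ((b + c : ℕ) : ℝ) := by exact_mod_cast ha1
    rw [Nat.cast_mul]
    exact ⟨mul_le_mul_of_nonneg_left this.1 hrn,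
      mul_le_mul_of_nonneg_left (this.2.trans h1) hrn⟩
  · intro x y hy hx
    have hx' : (x : ℝ) + c * y ≤ r * (b + c) := by exact_mod_cast hx
    have := dil_case_std Ω _ _ hbn han hma hmb r x y hy (by push_cast; linarith)
    exact this

lemma dil_case_swap (Ω : ConvexDomain) (a b : ℝ) (hbn : 0 ≤ b) (han : 0 ≤ a)
    (ha : ((0 : ℝ), a) ∈ Ω.body) (hb : ((1 : ℝ), b) ∈ Ω.body) (r x y : ℕ)
    (hy : y ≤ r) (hx : (x : ℝ) + (a - b) * y ≤ r * a) :
    ((y : ℝ), (x : ℝ)) ∈ (r : ℝ) • Ω.body := by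
  rcases Nat.eq_zero_or_pos r with rfl | hr
  · have hy0 : y = 0 := by omega
    subst hy0
    have : (x : ℝ) ≤ 0 := by simpa using hx
    have : x = 0 := by exact_mod_cast le_antisymm this (Nat.cast_nonneg x)
    subst this
    exact ⟨_, Ω.zero_mem, by simp; rfl⟩
  · have hr' : (0 : ℝ) < r := by exact_mod_cast hr
    have hy' : (y : ℝ) ≤ r := by exact_mod_cast hy
    have ht0 : 0 ≤ (y : ℝ) / r := by positivity
    have ht1 : (y : ℝ) / r ≤ 1 := by rw [div_le_one hr']; exact hy'
    have hconv : Convex ℝ Ω.body := convex_convexHull ℝ _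
    have h1 := hconv ha hb (sub_nonneg.2 ht1) ht0 (by ring)
    have h2 : ((y : ℝ) / r, (x : ℝ) / r) ∈ Ω.body := by
      apply Ω.rect _ h1
      have hxx : (x : ℝ) / r ≤ (1 - (y : ℝ) / r) * a + (y : ℝ) / r * b := by
        rw [div_le_iff₀ hr']
        field_simp
        linarith
      simp only [Set.mem_prod, Set.mem_Icc, Prod.fst_add, Prod.snd_add, Prod.smul_fst,
        Prod.smul_snd, smul_eq_mul, mul_zero, mul_one, zero_add]
      exact ⟨⟨ht0, le_rfl⟩, ⟨by positivity, hxx⟩⟩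
    refine ⟨_, h2, ?_⟩
    simp only [Prod.smul_mk, smul_eq_mul]
    rw [mul_div_cancel₀ _ hr'.ne', mul_div_cancel₀ _ hr'.ne']

lemma case_swap (Ω : ConvexDomain) (hlat : Ω.IsLattice)
    (hH : ∀ i, (Ω.P.verts i).1 < 2) (r : ℕ) (Λ : ClockPolygon) (hΛ : IsCompetitor Λ)
    (hper : omegaPerim Ω.body Λ ≤ (r : ℝ) * omegaPerim Ω.body Ω.P) :
    latticeCount Λ.body ≤ latticeCount ((r : ℝ) • Ω.body) := by
  have hΩn := dom_nat Ω hlat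
  have hΛn : ∀ i, ∃ x y : ℕ, Λ.verts i = ((x : ℝ), (y : ℝ)) := fun i =>
    nat_coords (hΛ.1 i) (hΛ.2.1 i).1 (hΛ.2.1 i).2
  -- the vertex coordinates of the domain
  have hΩc : ∀ i, ∃ x y : ℕ, Ω.P.verts i = ((y : ℝ), (x : ℝ)) ∧ y ≤ 1 := by
    intro i
    obtain ⟨x, y, h⟩ := hΩn i
    have h2 := hH i
    rw [h] at h2
    simp only at h2
    refine ⟨y, x, h, ?_⟩
    have : x < 2 := by exact_mod_cast h2
    omega
  obtain ⟨ja, hja⟩ := exists_max Ω.P (fun p => p.2)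
  obtain ⟨a, ya, hae, _⟩ := hΩc ja
  obtain ⟨jb, hjb⟩ := exists_max Ω.P (fun p => p.1 * (p.2 + 1))
  obtain ⟨b, yb, hbe, hyb⟩ := hΩc jb
  have hxa : ∀ i, (Ω.P.verts i).2 ≤ a := by
    intro i
    have := hja i
    rw [hae] at this
    exact this
  obtain ⟨⟨ix, hix⟩, ⟨iy, hiy⟩⟩ := dom_pos Ω hlat
  have hyb1 : yb = 1 := by
    by_contra hne
    have h0 : yb = 0 := by omega
    have := hjb ix
    simp only [hbe, h0] at this
    obtain ⟨x, y, h, _⟩ := hΩc ix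
    rw [h] at this hix
    simp only at this hix
    have hx : (0 : ℝ) ≤ x := Nat.cast_nonneg x
    push_cast at this
    nlinarith
  subst hyb1
  have hxb : ∀ i, (Ω.P.verts i).1 = 1 → (Ω.P.verts i).2 ≤ b := by
    intro i hi
    have := hjb i
    simp only [hbe, hi] at this
    push_cast at this
    linarith
  have han : (0 : ℝ) ≤ a := Nat.cast_nonneg a
  have hbn : (0 : ℝ) ≤ b := Nat.cast_nonneg b
  have hmb : ((1 : ℝ), (b : ℝ)) ∈ Ω.body := by
    have := vert_mem Ω.P jb
    rw [hbe, Nat.cast_one] at this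
    exact this
  have hma : ((0 : ℝ), (a : ℝ)) ∈ Ω.body := by
    have := vert_mem Ω.P ja
    rw [hae] at this
    exact Ω.rect _ this (by simp)
  have hm1 : ((1 : ℝ), (0 : ℝ)) ∈ Ω.body :=
    Ω.rect _ hmb (by simp)
  have hbx : ∀ q ∈ Ω.body, q.2 ≤ a ∧ q.1 ≤ 1 := by
    intro q hq
    have h1 := hull_le Ω.P 0 1 a (fun i => by have := hxa i; linarith) q hq
    have h2 := hull_le Ω.P 1 0 1 (fun i => by
      obtain ⟨x, y, h, h'⟩ := hΩc i
      rw [h]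
      have : (y : ℝ) ≤ 1 := by exact_mod_cast h'
      simp only
      linarith) q hq
    constructor <;> linarith
  have hba : b ≤ a := by
    have := (hbx _ hmb).1
    simp only at this
    exact_mod_cast this
  obtain ⟨c, rfl⟩ := Nat.exists_eq_add_of_le hba
  have ha1 : 1 ≤ b + c := by
    have h := hxa iy
    have h2 := lt_of_lt_of_le hiy h
    exact_mod_cast h2
  have hself : omegaPerim Ω.body Ω.P ≤ ((b + c : ℕ) : ℝ) + b := by
    refine self_sum Ω.P (fun p => -(p.1 * p.2)) ((0 : ℝ), ((b + c : ℕ) : ℝ)) _ (by positivity) ?_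
    intro i
    obtain ⟨x, y, h, hy⟩ := hΩc i
    obtain ⟨x', y', h', hy'⟩ := hΩc (i + 1)
    have c1 := hxa i
    have c2 := hxa (i + 1)
    have c3 := hxb i
    have c4 := hxb (i + 1)
    have cw := Ω.P.clockwise i _ hma
    rw [h] at c1 c3 cw
    rw [h'] at c2 c4 cw
    rw [h, h']
    have n1 : (0 : ℝ) ≤ x := Nat.cast_nonneg x
    have n2 : (0 : ℝ) ≤ x' := Nat.cast_nonneg x'
    simp only [det2, Prod.mk_sub_mk] at *
    interval_cases y <;> interval_cases y' <;> norm_num at *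
    all_goals first
      | linarith [Nat.cast_nonneg (α := ℝ) x, Nat.cast_nonneg (α := ℝ) x']
      | (left; linarith)
      | (right; exact ⟨le_antisymm c3 cw, by
          have : (x : ℝ) ≤ b := by exact_mod_cast c3
          linarith⟩)
      | (right; exact ⟨le_antisymm c1 cw, by
          have : (x' : ℝ) ≤ b := by exact_mod_cast c4
          linarith⟩)
  -- data of the competitor
  obtain ⟨i0, hi0⟩ := zero_vert Λ hΛn hΛ.2.2.1
  obtain ⟨jT, hjT⟩ := exists_max Λ (fun p => p.1)
  obtain ⟨jQ, hjQ⟩ := exists_max Λ (fun p => p.2 + c * p.1)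
  obtain ⟨h, Tx, hT⟩ := hΛn jT
  obtain ⟨Qy, Qx, hQ⟩ := hΛn jQ
  have hTQ : (Tx : ℝ) + c * h ≤ Qx + c * Qy := by
    have := hjQ jT
    simpa [hT, hQ] using this
  have hQT : (Qy : ℝ) ≤ h := by
    have := hjT jQ
    simpa [hT, hQ] using this
  have hlow : (b : ℝ) * h + (Qx + c * Qy) ≤ omegaPerim Ω.body Λ := by
    have := cyc_le Ω.P Λ i0 jQ jT hi0 (0, ((b + c : ℕ) : ℝ)) (1, b) (1, 0)
      (0, ((b + c : ℕ) : ℝ)) (0, 0) (1, 0) hma hmb hm1 hma Ω.zero_mem hm1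
    rw [hT, hQ] at this
    simp only [det2, Prod.mk_sub_mk, Prod.neg_mk] at this
    push_cast at this
    have hcc : (0 : ℝ) ≤ c := Nat.cast_nonneg c
    have hm := mul_le_mul_of_nonneg_left hQT hcc
    change _ ≤ omegaPerim Ω.P.body Λ
    rcases this with h | h <;> nlinarith
  have hcast : (b : ℝ) * h + (Qx + c * Qy) ≤ r * (((b + c : ℕ) : ℝ) + b) :=
    hlow.trans (hper.trans (mul_le_mul_of_nonneg_left hself (Nat.cast_nonneg r)))
  have hΛpos : ∀ q ∈ Λ.body, 0 ≤ q.1 ∧ 0 ≤ q.2 := by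
    intro q hq
    have h1 := hull_le Λ (-1) 0 0 (fun i => by have := (hΛ.2.1 i).1; linarith) q hq
    have h2 := hull_le Λ 0 (-1) 0 (fun i => by have := (hΛ.2.1 i).2; linarith) q hq
    constructor <;> linarith
  have hrn : (0 : ℝ) ≤ r := Nat.cast_nonneg r
  rw [← latticeCount_swap Λ.body, ← latticeCount_swap ((r : ℝ) • Ω.body)]
  refine count_core _ _ b c h (Qx + c * Qy) r ?_ (by omega) (by exact_mod_cast hcast) ?_ ?_ ?_
    (r * (b + c)) ?_ ?_
  · have : (c : ℝ) * h ≤ Qx + c * Qy := by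
      have : (0 : ℝ) ≤ Tx := Nat.cast_nonneg Tx
      linarith
    exact_mod_cast this
  · intro x y hxy
    have hxy : ((y : ℝ), (x : ℝ)) ∈ Λ.body := by
      obtain ⟨q, hq, he⟩ := hxy
      rw [← Prod.swap_swap q, he] at hq
      exact hq
    have h1 := hull_le Λ 1 0 h (fun i => by
      have := hjT i
      rw [hT] at this
      simp only at this
      linarith) _ hxy
    have h2 := hull_le Λ c 1 (Qx + c * Qy) (fun i => by
      have := hjQ i
      rw [hQ] at this
      simp only at this
      linarith) _ hxy
    simp only at h1 h2
    constructor
    · have : (y : ℝ) ≤ h := by linarith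
      exact_mod_cast this
    · have : (x : ℝ) + c * y ≤ Qx + c * Qy := by linarith
      exact_mod_cast this
  · rintro _ ⟨q, hq, rfl⟩
    exact (hΛpos q hq).symm
  · rintro _ ⟨_, ⟨q, hq, rfl⟩, rfl⟩
    have := Ω.nonneg q hq
    exact ⟨mul_nonneg hrn this.2, mul_nonneg hrn this.1⟩
  · rintro _ ⟨_, ⟨q, hq, rfl⟩, rfl⟩
    have := hbx q hq
    have h1 : (1 : ℝ) ≤ ((b + c : ℕ) : ℝ) := by exact_mod_cast ha1
    rw [Nat.cast_mul]
    exact ⟨mul_le_mul_of_nonneg_left this.1 hrn,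
      mul_le_mul_of_nonneg_left (this.2.trans h1) hrn⟩
  · intro x y hy hx
    have hx' : (x : ℝ) + c * y ≤ r * (b + c) := by exact_mod_cast hx
    have := dil_case_swap Ω _ _ hbn han hma hmb r x y hy (by push_cast; linarith)
    exact ⟨_, this, rfl⟩

lemma perim_zero (B P : ClockPolygon) (h : ∀ i, P.verts i = 0) : omegaPerim B.body P = 0 := by
  unfold omegaPerim
  refine Finset.sum_eq_zero fun i _ => ?_
  rw [h, h]
  unfold omegaLen
  have : det2 (0 - 0) '' B.body = {0} := by
    ext z
    constructor
    · rintro ⟨q, _, rfl⟩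
      simp [det2]
    · rintro rfl
      exact ⟨_, vert_mem B 0, by simp [det2]⟩
  rw [this, csSup_singleton]

lemma perim_nonneg (Ω : ConvexDomain) (P : ClockPolygon) : 0 ≤ omegaPerim Ω.body P := by
  refine Finset.sum_nonneg fun i _ => ?_
  have := det_le_len Ω.P (P.verts (i + 1) - P.verts i) _ Ω.zero_mem
  have h0 : det2 (P.verts (i + 1) - P.verts i) ((0 : ℝ), (0 : ℝ)) = 0 := by simp [det2]
  rw [h0] at this
  exact this

lemma small (Ω : ConvexDomain) (htight : TightlyConstrained Ω 0) :
    (∀ i, (Ω.P.verts i).2 < 2) ∨ (∀ i, (Ω.P.verts i).1 < 2) := by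
  obtain ⟨k, hk⟩ := htight 1 (Nat.zero_le _)
  unfold echCap at hk
  set S := { r | ∃ P : ClockPolygon, IsCompetitor P ∧
      latticeCount P.body = k + 1 ∧ omegaPerim Ω.body P = r } with hS
  have hne : S.Nonempty := by
    by_contra h
    rw [Set.not_nonempty_iff_eq_empty] at h
    rw [h] at hk
    simp at hk
  obtain ⟨s, hsS, hs2⟩ := exists_lt_of_csInf_lt hne (show sInf S < 2 by rw [hk]; norm_num)
  have hbd : BddBelow S := by
    refine ⟨0, ?_⟩
    rintro _ ⟨P, _, _, rfl⟩
    exact perim_nonneg Ω P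
  have hs1 : 1 ≤ s := by
    have := csInf_le hbd hsS
    rw [hk] at this
    simpa using this
  obtain ⟨P, hP, _, rfl⟩ := hsS
  have hn : ∀ i, ∃ x y : ℕ, P.verts i = ((x : ℝ), (y : ℝ)) := fun i =>
    nat_coords (hP.1 i) (hP.2.1 i).1 (hP.2.1 i).2
  obtain ⟨i0, hi0⟩ := zero_vert P hn hP.2.2.1
  have hex : ∃ j, P.verts j ≠ 0 := by
    by_contra! hc
    have h0 : omegaPerim Ω.body P = 0 := perim_zero Ω.P P hc
    linarith
  obtain ⟨j, hj⟩ := hex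
  obtain ⟨x, y, hxy⟩ := hn j
  rw [hxy] at hj
  have key : ∀ p q : ℝ × ℝ, p ∈ Ω.body → q ∈ Ω.body →
      det2 ((x : ℝ), (y : ℝ)) p + det2 (-((x : ℝ), (y : ℝ))) q ≤ omegaPerim Ω.body P := by
    intro p q hp hq
    have := cyc_le Ω.P P i0 j j hi0 p p q p p q hp hp hq hp hp hq
    rw [hxy] at this
    have hz : det2 (((x : ℝ), (y : ℝ)) - ((x : ℝ), (y : ℝ))) p = 0 := by simp [det2]
    rw [hz, add_zero, or_self] at this
    exact this
  rcases Nat.eq_zero_or_pos x with hx | hx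
  · right
    have hy : 1 ≤ y := by
      by_contra hy
      exact hj (by simp [hx, show y = 0 by omega])
    have hy' : (1 : ℝ) ≤ y := by exact_mod_cast hy
    intro i
    have h0 := Ω.nonneg _ (vert_mem Ω.P i)
    have hm : ((Ω.P.verts i).1, (0 : ℝ)) ∈ Ω.body :=
      Ω.rect _ (vert_mem Ω.P i) ⟨⟨h0.1, le_rfl⟩, ⟨le_rfl, h0.2⟩⟩
    have := key _ _ Ω.zero_mem hm
    simp only [det2, Prod.neg_mk] at this
    nlinarith
  · left
    have hx' : (1 : ℝ) ≤ x := by exact_mod_cast hx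
    intro i
    have h0 := Ω.nonneg _ (vert_mem Ω.P i)
    have hm : ((0 : ℝ), (Ω.P.verts i).2) ∈ Ω.body :=
      Ω.rect _ (vert_mem Ω.P i) ⟨⟨le_rfl, h0.1⟩, ⟨h0.2, le_rfl⟩⟩
    have := key _ _ hm Ω.zero_mem
    simp only [det2, Prod.neg_mk] at this
    nlinarith

/-- If `X_Ω` is tightly constrained with lower bound `0`,
then for every `r ∈ ℤ≥0` the dilate `rΩ` contains the most lattice points
among competitor convex lattice domains of `Ω`-perimeter at most `r·λ`,
where `λ = ℓ_Ω(∂Ω)`. -/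
theorem dilate_maximizes_lattice_points (Ω : ConvexDomain) (hlat : Ω.IsLattice)
    (htight : TightlyConstrained Ω 0) :
    ∀ r : ℕ, ∀ Λ : ClockPolygon, IsCompetitor Λ →
      omegaPerim Ω.body Λ ≤ (r : ℝ) * omegaPerim Ω.body Ω.P →
      latticeCount Λ.body ≤ latticeCount ((r : ℝ) • Ω.body) := by
  intro r Λ hΛ hper
  rcases small Ω htight with h | h
  · exact case_std Ω hlat h r Λ hΛ hper
  · exact case_swap Ω hlat h r Λ hΛ hper

end
end
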